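/- arXiv:1602.05937 — 6 statements merged into one kernel-verified Lean document; each statement's English description precedes it below -/
import Mathlib

section
/- Let (G,d) be an admissible pair with G having at least one vertex, and let F be a graph. Then t(F,G,d) = 1 if and only if at least one of the following holds: (a) F has no edges; or (b) F is a forest and every vertex of G has degree exactly d; or (c) F is bipartite and every connected component of G is isomorphic to the complete bipartite graph K_{d,d}. -/
open Filter Topology

noncomputable def homCount {α β : Type*} (F : SimpleGraph α) (G : SimpleGraph β) : ℕ :=
  Nat.card (F →g G)

noncomputable def injCount {α β : Type*} (F : SimpleGraph α) (G : SimpleGraph β) : ℕ :=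
  Nat.card {f : F →g G // Function.Injective f}

noncomputable def vdegree {α : Type*} (G : SimpleGraph α) (x : α) : ℕ :=
  Nat.card (G.neighborSet x)

noncomputable def edgeCount {α : Type*} (G : SimpleGraph α) : ℕ := Nat.card G.edgeSet

noncomputable def numComponents {α : Type*} (F : SimpleGraph α) : ℕ :=
  Nat.card F.ConnectedComponent

noncomputable def numBigComponents {α : Type*} (F : SimpleGraph α) : ℕ :=
  Nat.card {c : F.ConnectedComponent // 2 ≤ Nat.card c.supp}

def Admissible {α : Type*} (G : SimpleGraph α) (d : ℝ) : Prop :=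
  1 ≤ d ∧ ∀ x : α, (vdegree G x : ℝ) ≤ d

noncomputable def homDensity {α β : Type*} (F : SimpleGraph α) (G : SimpleGraph β) (d : ℝ) : ℝ :=
  (homCount F G : ℝ) /
    ((Nat.card β : ℝ) ^ numComponents F * d ^ (Nat.card α - numComponents F))

noncomputable def injDensity {α β : Type*} (F : SimpleGraph α) (G : SimpleGraph β) (d : ℝ) : ℝ :=
  (injCount F G : ℝ) /
    ((Nat.card β : ℝ) ^ numComponents F * d ^ numBigComponents F *
      (d - 1) ^ (Nat.card α - numComponents F - numBigComponents F))

/-- A breadth-first spanning forest of `F`: every vertex of nonzero rank has a parent, adjacent to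
it and of rank one less, and the vertices of rank zero are the roots, one in each component. -/
structure SpanningForest {α : Type*} (F : SimpleGraph α) where
  root : α → α
  parent : α → α
  rank : α → ℕ
  adj_parent : ∀ s, rank s ≠ 0 → F.Adj (parent s) s
  rank_parent : ∀ s, rank s ≠ 0 → rank (parent s) + 1 = rank s
  root_parent : ∀ s, rank s ≠ 0 → root (parent s) = root s
  root_eq : ∀ s, rank s = 0 → root s = s
  root_adj : ∀ s t, F.Adj s t → root s = root t
  card_roots : Nat.card {s // rank s = 0} = numComponents F

theorem SpanningForest.exists_of_section {α : Type*} (F : SimpleGraph α)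
    (o : F.ConnectedComponent → α) (ho : ∀ c, F.connectedComponentMk (o c) = c) :
    ∃ T : SpanningForest F, ∀ s, T.rank s = F.dist (o (F.connectedComponentMk s)) s := by
  have hreach : ∀ s, F.Reachable (o (F.connectedComponentMk s)) s := fun s =>
    SimpleGraph.ConnectedComponent.exact (ho _)
  have hpar : ∀ s, ∃ q, F.dist (o (F.connectedComponentMk s)) s ≠ 0 →
      F.Adj q s ∧ F.dist (o (F.connectedComponentMk s)) q + 1 =
        F.dist (o (F.connectedComponentMk s)) s := by
    intro s
    by_cases h : F.dist (o (F.connectedComponentMk s)) s = 0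
    · exact ⟨s, fun h' => absurd h h'⟩
    obtain ⟨w, hw⟩ := (hreach s).exists_walk_length_eq_dist
    obtain ⟨q, w', hq, hw'⟩ : ∃ q, ∃ w' : F.Walk (o (F.connectedComponentMk s)) q,
        F.Adj q s ∧ w'.length + 1 = w.length := by
      have hn : ¬ w.Nil := by
        rw [← SimpleGraph.Walk.length_eq_zero_iff]; omega
      refine ⟨w.penultimate, w.dropLast, w.adj_penultimate hn, ?_⟩
      simp only [SimpleGraph.Walk.dropLast, SimpleGraph.Walk.take_length]
      omega
    refine ⟨q, fun _ => ⟨hq, le_antisymm ?_ ?_⟩⟩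
    · have := SimpleGraph.dist_le w'
      omega
    · obtain ⟨w₂, hw₂⟩ := w'.reachable.exists_walk_length_eq_dist
      have := SimpleGraph.dist_le (w₂.concat hq)
      rw [SimpleGraph.Walk.length_concat] at this
      omega
  choose q hq using hpar
  have hroot : ∀ s, F.dist (o (F.connectedComponentMk s)) s ≠ 0 →
      F.connectedComponentMk (q s) = F.connectedComponentMk s := fun s hs =>
    SimpleGraph.ConnectedComponent.sound (hq s hs).1.reachable
  refine ⟨⟨fun s => o (F.connectedComponentMk s), q,
    fun s => F.dist (o (F.connectedComponentMk s)) s, fun s hs => (hq s hs).1, ?_, ?_, ?_, ?_, ?_⟩,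
    fun _ => rfl⟩
  · intro s hs
    rw [hroot s hs]
    exact (hq s hs).2
  · intro s hs
    rw [hroot s hs]
  · intro s hs
    exact (hreach s).dist_eq_zero_iff.1 hs
  · intro s t hst
    exact congrArg o (SimpleGraph.ConnectedComponent.sound hst.reachable)
  · refine Nat.card_congr ⟨fun s => F.connectedComponentMk s.1, fun c => ⟨o c, ?_⟩, ?_, ho⟩
    · rw [ho, SimpleGraph.dist_self]
    · rintro ⟨s, hs⟩
      exact Subtype.ext ((hreach s).dist_eq_zero_iff.1 hs)

theorem SpanningForest.nonempty {α : Type*} (F : SimpleGraph α) : Nonempty (SpanningForest F) :=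
  ⟨(SpanningForest.exists_of_section F (fun c => c.exists_rep.choose)
    fun c => c.exists_rep.choose_spec).choose⟩

theorem SpanningForest.exists_of_vertex {α : Type*} (F : SimpleGraph α) (u : α) :
    ∃ T : SpanningForest F, ∀ s, F.Reachable u s → T.rank s = F.dist u s := by
  classical
  obtain ⟨T, hT⟩ := SpanningForest.exists_of_section F
    (Function.update (fun c => c.exists_rep.choose) (F.connectedComponentMk u) u) (by
      intro c
      by_cases h : c = F.connectedComponentMk u
      · rw [h, Function.update_self]
      · rw [Function.update_of_ne h]
        exact c.exists_rep.choose_spec)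
  refine ⟨T, fun s hs => ?_⟩
  rw [hT, ← SimpleGraph.ConnectedComponent.sound hs, Function.update_self]

/-- The maps that send every edge joining an element of `S` to its parent to an edge of `G`. -/
noncomputable def parentHoms {α β : Type*} [Fintype α] [Fintype β] (G : SimpleGraph β)
    (p : α → α) (S : Finset α) : Finset (α → β) := by
  classical exact Finset.univ.filter fun f => ∀ s ∈ S, G.Adj (f (p s)) (f s)

theorem mem_parentHoms {α β : Type*} [Fintype α] [Fintype β] {G : SimpleGraph β}
    {p : α → α} {S : Finset α} {f : α → β} :
    f ∈ parentHoms G p S ↔ ∀ s ∈ S, G.Adj (f (p s)) (f s) := by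
  simp [parentHoms]

theorem card_mul_card_parentHoms_insert {α β : Type*} [DecidableEq α] [Fintype α] [Fintype β]
    (G : SimpleGraph β) (p : α → α) (S : Finset α) (a : α) (ha : a ∉ S) (hpa : p a ≠ a)
    (hpS : ∀ s ∈ S, p s ≠ a) :
    Fintype.card β * (parentHoms G p (insert a S)).card =
      ∑ f ∈ parentHoms G p S, vdegree G (f (p a)) := by
  classical
  have hdeg : ∀ x, vdegree G x = (G.neighborFinset x).card := by
    intro x
    rw [vdegree, Nat.card_eq_fintype_card, SimpleGraph.card_neighborSet_eq_degree]
    rfl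
  simp only [hdeg]
  have hupd : ∀ (f : α → β) (b : β), f ∈ parentHoms G p S →
      Function.update f a b ∈ parentHoms G p S := by
    intro f b hf
    rw [mem_parentHoms] at hf ⊢
    intro s hs
    rw [Function.update_of_ne (hpS s hs), Function.update_of_ne (fun h : s = a => ha (h ▸ hs))]
    exact hf s hs
  have hins : ∀ f : α → β, f ∈ parentHoms G p (insert a S) ↔
      f ∈ parentHoms G p S ∧ G.Adj (f (p a)) (f a) := by
    intro f
    simp only [mem_parentHoms, Finset.forall_mem_insert]
    exact and_comm
  rw [← Finset.card_sigma, mul_comm, ← Finset.card_univ, ← Finset.card_product]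
  refine Finset.card_bij' (fun x _ => ⟨Function.update x.1 a x.2, x.1 a⟩)
    (fun x _ => (Function.update x.1 a x.2, x.1 a)) ?_ ?_ ?_ ?_
  · rintro ⟨f, b⟩ h
    have h := (hins f).1 (Finset.mem_product.1 h).1
    rw [Finset.mem_sigma, SimpleGraph.mem_neighborFinset]
    exact ⟨hupd f b h.1, by simpa [Function.update_of_ne hpa] using h.2⟩
  · rintro ⟨f, b⟩ h
    rw [Finset.mem_sigma, SimpleGraph.mem_neighborFinset] at h
    refine Finset.mem_product.2 ⟨(hins _).2 ⟨hupd f b h.1, ?_⟩, Finset.mem_univ _⟩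
    simpa [Function.update_of_ne hpa] using h.2
  · rintro ⟨f, b⟩ _
    simp
  · rintro ⟨f, b⟩ _
    simp

theorem card_parentHoms_le {α β : Type*} [Fintype α] [Fintype β]
    {G : SimpleGraph β} {d : ℝ} (hd : Admissible G d) (p : α → α) (rank : α → ℕ) (S : Finset α)
    (hS : ∀ s ∈ S, rank (p s) < rank s) :
    ((parentHoms G p S).card : ℝ) * (Fintype.card β : ℝ) ^ S.card ≤
        (Fintype.card β : ℝ) ^ Fintype.card α * d ^ S.card ∧
      (((parentHoms G p S).card : ℝ) * (Fintype.card β : ℝ) ^ S.card =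
          (Fintype.card β : ℝ) ^ Fintype.card α * d ^ S.card →
        S.Nonempty → ∀ x, (vdegree G x : ℝ) = d) ∧
      ((∀ x, (vdegree G x : ℝ) = d) →
        ((parentHoms G p S).card : ℝ) * (Fintype.card β : ℝ) ^ S.card =
          (Fintype.card β : ℝ) ^ Fintype.card α * d ^ S.card) := by
  classical
  have hempty : parentHoms G p ∅ = (Finset.univ : Finset (α → β)) := by
    ext f; simp [mem_parentHoms]
  induction S using Finset.induction_on_max_value rank with
  | empty => simp [hempty]
  | insert a S ha hmax ih =>
    obtain ⟨ih1, ih2, ih3⟩ := ih fun s hs => hS s (Finset.mem_insert_of_mem hs)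
    have hra := hS a (Finset.mem_insert_self a S)
    have key := card_mul_card_parentHoms_insert G p S a ha (fun h => by rw [h] at hra; omega)
      (fun s hs h => by
        have h1 := hS s (Finset.mem_insert_of_mem hs)
        have h2 := hmax s hs
        rw [h] at h1
        omega)
    have key' : (Fintype.card β : ℝ) * ((parentHoms G p (insert a S)).card : ℝ) =
        ∑ f ∈ parentHoms G p S, (vdegree G (f (p a)) : ℝ) := by exact_mod_cast key
    have hd0 : 0 < d := lt_of_lt_of_le one_pos hd.1
    have hle : ∑ f ∈ parentHoms G p S, (vdegree G (f (p a)) : ℝ) ≤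
        ((parentHoms G p S).card : ℝ) * d := by
      rw [← nsmul_eq_mul]
      exact Finset.sum_le_card_nsmul _ _ _ fun f _ => hd.2 _
    have hv : (0 : ℝ) ≤ (Fintype.card β : ℝ) ^ S.card := by positivity
    rw [Finset.card_insert_of_notMem ha, pow_succ, pow_succ]
    have hL : ((parentHoms G p (insert a S)).card : ℝ) *
        ((Fintype.card β : ℝ) ^ S.card * (Fintype.card β : ℝ)) =
        (∑ f ∈ parentHoms G p S, (vdegree G (f (p a)) : ℝ)) * (Fintype.card β : ℝ) ^ S.card := by
      rw [← key']; ring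
    rw [hL]
    have h1 := mul_le_mul_of_nonneg_right hle hv
    have h2 := mul_le_mul_of_nonneg_right ih1 hd0.le
    refine ⟨by linarith, fun heq _ => ?_, fun hreg => ?_⟩
    · rcases S.eq_empty_or_nonempty with rfl | hne
      · have hsum : ∑ f : α → β, (vdegree G (f (p a)) : ℝ) = ∑ f : α → β, d := by
          simpa [hempty] using heq
        have := (Finset.sum_eq_sum_iff_of_le fun (f : α → β) _ => hd.2 (f (p a))).1 hsum
        exact fun x => this (fun _ => x) (Finset.mem_univ _)
      · refine ih2 (le_antisymm ih1 ?_) hne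
        refine le_of_mul_le_mul_right ?_ hd0
        linarith
    · have := ih3 hreg
      simp only [hreg, Finset.sum_const, nsmul_eq_mul]
      linear_combination d * this

namespace SpanningForest

variable {α β : Type*} {F : SimpleGraph α}

/-- The non-root vertices of a spanning forest. -/
noncomputable def nonroots [Fintype α] (T : SpanningForest F) : Finset α := by
  classical exact Finset.univ.filter fun s => T.rank s ≠ 0

theorem mem_nonroots [Fintype α] {T : SpanningForest F} {s : α} :
    s ∈ T.nonroots ↔ T.rank s ≠ 0 := by
  simp [nonroots]

theorem card_nonroots_add [Fintype α] (T : SpanningForest F) :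
    T.nonroots.card + numComponents F = Fintype.card α := by
  classical
  rw [← T.card_roots, Nat.card_eq_fintype_card, Fintype.card_subtype, add_comm, nonroots,
    Finset.card_filter_add_card_filter_not, Finset.card_univ]

theorem rank_parent_lt (T : SpanningForest F) {s : α} (hs : T.rank s ≠ 0) :
    T.rank (T.parent s) < T.rank s := by
  have := T.rank_parent s hs
  omega

theorem induction (T : SpanningForest F) {P : α → Prop} (h0 : ∀ s, T.rank s = 0 → P s)
    (h1 : ∀ s, T.rank s ≠ 0 → P (T.parent s) → P s) (s : α) : P s := by
  induction hn : T.rank s using Nat.strong_induction_on generalizing s with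
  | _ n ih =>
    by_cases hs : T.rank s = 0
    · exact h0 s hs
    · exact h1 s hs (ih _ (hn ▸ T.rank_parent_lt hs) _ rfl)

theorem exists_rank_ne_zero (T : SpanningForest F) {s t : α} (h : F.Adj s t) :
    ∃ x, T.rank x ≠ 0 := by
  by_contra! h0
  refine h.ne ?_
  rw [← T.root_eq s (h0 s), ← T.root_eq t (h0 t), T.root_adj s t h]

theorem homDensity_eq_one_iff [Fintype α] [Fintype β] [Nonempty β] (T : SpanningForest F)
    (G : SimpleGraph β) {d : ℝ} (hd : 1 ≤ d) :
    homDensity F G d = 1 ↔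
      (homCount F G : ℝ) * (Fintype.card β : ℝ) ^ T.nonroots.card =
        (Fintype.card β : ℝ) ^ Fintype.card α * d ^ T.nonroots.card := by
  have hv : (0 : ℝ) < Fintype.card β := by exact_mod_cast Fintype.card_pos
  have hd0 : 0 < d := by linarith
  have hc := T.card_nonroots_add
  have hsub : Fintype.card α - numComponents F = T.nonroots.card := by omega
  rw [homDensity, Nat.card_eq_fintype_card, Nat.card_eq_fintype_card, hsub, ← hc, pow_add,
    div_eq_one_iff_eq (by positivity)]
  have hpos : (0 : ℝ) < (Fintype.card β : ℝ) ^ T.nonroots.card := by positivity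
  rw [← mul_left_inj' hpos.ne']
  constructor <;> intro h <;> rw [h] <;> ring

end SpanningForest

theorem homCount_eq_card {α β : Type*} [Fintype α] [Fintype β] (F : SimpleGraph α)
    (G : SimpleGraph β) :
    homCount F G = Nat.card {f : α → β // ∀ s t, F.Adj s t → G.Adj (f s) (f t)} :=
  Nat.card_congr ⟨fun f => ⟨f, fun _ _ h => f.map_adj h⟩, fun f => ⟨f.1, fun h => f.2 _ _ h⟩,
    fun _ => rfl, fun _ => rfl⟩

theorem numComponents_congr {α : Type*} {F H : SimpleGraph α}
    (h : ∀ s t, H.Reachable s t ↔ F.Reachable s t) : numComponents H = numComponents F :=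
  Nat.card_congr (Quot.congrRight h)

/-- Extremality of `F` forces every homomorphism of a spanning forest of a spanning subgraph `H`
with the same components to be a homomorphism of `F`. -/
theorem adj_of_homDensity_eq_one {α β : Type*} [Fintype α] [Fintype β] [Nonempty β]
    {F H : SimpleGraph α} {G : SimpleGraph β} {d : ℝ} (hadm : Admissible G d)
    (hHF : H ≤ F) (hreach : ∀ s t, H.Reachable s t ↔ F.Reachable s t)
    (T : SpanningForest H) (h : homDensity F G d = 1) :
    (∀ f : α → β, (∀ s, T.rank s ≠ 0 → G.Adj (f (T.parent s)) (f s)) →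
      ∀ s t, F.Adj s t → G.Adj (f s) (f t)) ∧
    ((∃ s, T.rank s ≠ 0) → ∀ x, (vdegree G x : ℝ) = d) := by
  classical
  obtain ⟨T'⟩ := SpanningForest.nonempty F
  rw [T'.homDensity_eq_one_iff G hadm.1] at h
  have hcard : T'.nonroots.card = T.nonroots.card := by
    have h1 := T.card_nonroots_add
    have h2 := T'.card_nonroots_add
    rw [numComponents_congr hreach] at h1
    omega
  rw [hcard] at h
  obtain ⟨h1, h2, -⟩ := card_parentHoms_le hadm T.parent T.rank T.nonroots
    fun s hs => T.rank_parent_lt (SpanningForest.mem_nonroots.1 hs)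
  have hhom : homCount F G =
      (Finset.univ.filter fun f : α → β => ∀ s t, F.Adj s t → G.Adj (f s) (f t)).card := by
    rw [homCount_eq_card, Nat.card_eq_fintype_card, Fintype.card_subtype]
  have hsub : (Finset.univ.filter fun f : α → β => ∀ s t, F.Adj s t → G.Adj (f s) (f t)) ⊆
      parentHoms G T.parent T.nonroots := by
    intro f hf
    rw [mem_parentHoms]
    intro s hs
    exact (Finset.mem_filter.1 hf).2 _ _
      (hHF (T.adj_parent s (SpanningForest.mem_nonroots.1 hs)))
  have hv : (0 : ℝ) < (Fintype.card β : ℝ) ^ T.nonroots.card := by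
    have : (0 : ℝ) < Fintype.card β := by exact_mod_cast Fintype.card_pos
    positivity
  have hle : (parentHoms G T.parent T.nonroots).card ≤ homCount F G := by
    have : ((parentHoms G T.parent T.nonroots).card : ℝ) ≤ homCount F G :=
      le_of_mul_le_mul_right (h1.trans h.ge) hv
    exact_mod_cast this
  have heq := Finset.eq_of_subset_of_card_le hsub (hhom ▸ hle)
  constructor
  · intro f hf
    have : f ∈ parentHoms G T.parent T.nonroots :=
      mem_parentHoms.2 fun s hs => hf s (SpanningForest.mem_nonroots.1 hs)
    rw [← heq] at this
    exact (Finset.mem_filter.1 this).2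
  · rintro ⟨s, hs⟩
    refine h2 ?_ ⟨s, SpanningForest.mem_nonroots.2 hs⟩
    rw [← heq, ← hhom, h]

theorem homDensity_eq_one_of_regular {α β : Type*} [Fintype α] [Fintype β] [Nonempty β]
    {F : SimpleGraph α} {G : SimpleGraph β} {d : ℝ} (hadm : Admissible G d)
    (hreg : ∀ x, (vdegree G x : ℝ) = d) (T : SpanningForest F)
    (h : ∀ f : α → β, (∀ s, T.rank s ≠ 0 → G.Adj (f (T.parent s)) (f s)) →
      ∀ s t, F.Adj s t → G.Adj (f s) (f t)) :
    homDensity F G d = 1 := by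
  classical
  rw [T.homDensity_eq_one_iff G hadm.1]
  rw [← (card_parentHoms_le hadm T.parent T.rank T.nonroots
    fun s hs => T.rank_parent_lt (SpanningForest.mem_nonroots.1 hs)).2.2 hreg, homCount_eq_card,
    Nat.card_eq_fintype_card, Fintype.card_subtype]
  congr 3
  ext f
  rw [mem_parentHoms, Finset.mem_filter]
  simp only [SpanningForest.mem_nonroots, Finset.mem_univ, true_and]
  exact ⟨fun hf s hs => hf _ _ (T.adj_parent s hs), h f⟩

/-- In an acyclic graph every edge joins a vertex to its parent in a spanning forest. -/
theorem SpanningForest.parent_eq_of_isAcyclic {α : Type*} {F : SimpleGraph α}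
    (T : SpanningForest F) (hF : F.IsAcyclic) {s t : α} (hst : F.Adj s t) :
    (T.rank s ≠ 0 ∧ T.parent s = t) ∨ (T.rank t ≠ 0 ∧ T.parent t = s) := by
  by_contra! hcon
  have hb : F.IsBridge s(s, t) := SimpleGraph.isAcyclic_iff_forall_isBridge.1 hF
    ((SimpleGraph.mem_edgeSet F).2 hst)
  rw [SimpleGraph.isBridge_iff] at hb
  have key : ∀ x, (F.deleteEdges {s(s, t)}).Reachable (T.root x) x := by
    refine T.induction (fun x hx => by rw [T.root_eq x hx]) fun x hx ih => ?_
    rw [T.root_parent x hx] at ih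
    refine ih.trans (SimpleGraph.Adj.reachable ?_)
    rw [SimpleGraph.deleteEdges_adj]
    refine ⟨T.adj_parent x hx, fun h => ?_⟩
    rw [Set.mem_singleton_iff, Sym2.eq_iff] at h
    rcases h with ⟨h1, rfl⟩ | ⟨h1, rfl⟩
    · exact hcon.2 hx h1
    · exact hcon.1 hx h1
  exact hb ((key s).symm.trans (T.root_adj s t hst ▸ key t))

/-- If walks of length three in `G` have adjacent ends, then a homomorphism of a spanning forest
of a bipartite graph is a homomorphism of the whole graph. -/
theorem SpanningForest.adj_of_colorable {α β : Type*} {F : SimpleGraph α} {G : SimpleGraph β}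
    (T : SpanningForest F) (c : F.Coloring Bool)
    (hG : ∀ w x y z, G.Adj w x → G.Adj x y → G.Adj y z → G.Adj w z)
    (f : α → β) (hf : ∀ s, T.rank s ≠ 0 → G.Adj (f (T.parent s)) (f s)) {s t : α}
    (hst : F.Adj s t) : G.Adj (f s) (f t) := by
  have key : ∀ x, (c (T.root x) = c x → ∀ z, G.Adj (f (T.root x)) z ↔ G.Adj (f x) z) ∧
      (c (T.root x) ≠ c x → G.Adj (f (T.root x)) (f x)) := by
    refine T.induction (fun x hx => ?_) fun x hx ih => ?_
    · rw [T.root_eq x hx]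
      exact ⟨fun _ _ => Iff.rfl, fun h => absurd rfl h⟩
    · rw [T.root_parent x hx] at ih
      have hc : c (T.parent x) ≠ c x := c.valid (T.adj_parent x hx)
      have ha := hf x hx
      by_cases h : c (T.root x) = c (T.parent x)
      · refine ⟨fun h' => absurd (h.symm.trans h') hc, fun _ => (ih.1 h _).2 ha⟩
      · have hr := ih.2 h
        refine ⟨fun _ z => ⟨fun hz => ?_, fun hz => ?_⟩, fun h' => ?_⟩
        · exact hG _ _ _ _ ha.symm hr.symm hz
        · exact hG _ _ _ _ hr ha hz
        · exact absurd ((Bool.eq_not_of_ne h).trans (Bool.eq_not_of_ne hc.symm).symm) h'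
  have hc : c s ≠ c t := c.valid hst
  have hs := key s
  have ht := key t
  rw [T.root_adj s t hst] at hs
  by_cases h : c (T.root t) = c s
  · exact (hs.1 h _).1 (ht.2 fun h' => hc (h.symm.trans h'))
  · refine ((ht.1 ?_ _).1 (hs.2 h)).symm
    exact (Bool.eq_not_of_ne h).trans (Bool.eq_not_of_ne hc.symm).symm

theorem nonempty_iso_completeBipartiteGraph {β : Type*} [Fintype β] {G : SimpleGraph β} {m : ℕ}
    (hm : 0 < m) (hreg : ∀ x, vdegree G x = m)
    (hG : ∀ w x y z, G.Adj w x → G.Adj x y → G.Adj y z → G.Adj w z) (c : G.ConnectedComponent) :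
    Nonempty (G.induce c.supp ≃g completeBipartiteGraph (Fin m) (Fin m)) := by
  obtain ⟨x, rfl⟩ := c.exists_rep
  have hN : ∀ x, Nat.card (G.neighborSet x) = m := hreg
  have : Nonempty (G.neighborSet x) := by
    by_contra h
    rw [not_nonempty_iff] at h
    have := hN x
    rw [Nat.card_of_isEmpty] at this
    omega
  obtain ⟨y, hxy⟩ := this
  have hxy : G.Adj x y := hxy
  have e : ∀ z, Nonempty (Fin m ≃ G.neighborSet z) := fun z =>
    ⟨(finCongr (hN z).symm).trans (Finite.equivFin _).symm⟩
  obtain ⟨ex⟩ := e x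
  obtain ⟨ey⟩ := e y
  have hex : ∀ i, G.Adj x (ex i) := fun i => (ex i).2
  have hey : ∀ i, G.Adj y (ey i) := fun i => (ey i).2
  have hcover : ∀ z, G.Reachable x z → G.Adj x z ∨ G.Adj y z := by
    intro z hz
    rw [SimpleGraph.reachable_iff_reflTransGen] at hz
    induction hz with
    | refl => exact Or.inr hxy.symm
    | tail _ hbc ih =>
      rcases ih with h | h
      · exact Or.inr (hG _ _ _ _ hxy.symm h hbc)
      · exact Or.inl (hG _ _ _ _ hxy h hbc)
  have hnot : ∀ a u v, G.Adj a u → G.Adj a v → ¬ G.Adj u v := fun a u v hu hv huv =>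
    G.irrefl (hG _ _ _ _ hu huv hv.symm)
  have hexy : ∀ i j, G.Adj (ex i) (ey j) := fun i j =>
    hG _ _ _ _ (hex i).symm hxy (hey j)
  let g : Fin m ⊕ Fin m → (G.connectedComponentMk x).supp := Sum.elim
    (fun i => ⟨ex i, SimpleGraph.ConnectedComponent.sound (hex i).reachable.symm⟩)
    (fun i => ⟨ey i, SimpleGraph.ConnectedComponent.sound
      (hxy.reachable.trans (hey i).reachable).symm⟩)
  have hg : Function.Bijective g := by
    constructor
    · rintro (i | i) (j | j) h
      · have h' := congrArg Subtype.val h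
        exact congrArg _ (ex.injective (Subtype.ext h'))
      · exact absurd (congrArg Subtype.val h) (hexy i j).ne
      · exact absurd (congrArg Subtype.val h) (hexy j i).ne'
      · have h' := congrArg Subtype.val h
        exact congrArg _ (ey.injective (Subtype.ext h'))
    · rintro ⟨z, hz⟩
      rcases hcover z (SimpleGraph.ConnectedComponent.exact hz).symm with h | h
      · exact ⟨Sum.inl (ex.symm ⟨z, h⟩), Subtype.ext (by simp [g])⟩
      · exact ⟨Sum.inr (ey.symm ⟨z, h⟩), Subtype.ext (by simp [g])⟩
  refine ⟨(⟨Equiv.ofBijective g hg, ?_⟩ :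
    completeBipartiteGraph (Fin m) (Fin m) ≃g G.induce _).symm⟩
  rintro (i | i) (j | j)
  · simpa [g] using hnot _ _ _ (hex i) (hex j)
  · simpa [g] using hexy i j
  · simpa [g] using (hexy j i).symm
  · simpa [g] using hnot _ _ _ (hey i) (hey j)

theorem vdegree_eq_of_iso_completeBipartiteGraph {β : Type*} {G : SimpleGraph β} {m : ℕ}
    (h : ∀ c : G.ConnectedComponent,
      Nonempty (G.induce c.supp ≃g completeBipartiteGraph (Fin m) (Fin m))) (x : β) :
    vdegree G x = m := by
  obtain ⟨e⟩ := h (G.connectedComponentMk x)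
  have hx : x ∈ (G.connectedComponentMk x).supp := rfl
  have h1 : Nat.card (G.neighborSet x) =
      Nat.card ((G.induce (G.connectedComponentMk x).supp).neighborSet ⟨x, hx⟩) :=
    Nat.card_congr ⟨fun y => ⟨⟨y.1, SimpleGraph.ConnectedComponent.sound
      (SimpleGraph.Adj.reachable y.2).symm⟩, y.2⟩, fun y => ⟨y.1.1, y.2⟩,
      fun _ => rfl, fun _ => rfl⟩
  rw [vdegree, h1, Nat.card_congr (e.mapNeighborSet _)]
  rcases e ⟨x, hx⟩ with i | i
  · refine (Nat.card_congr (β := Fin m) ⟨fun y => y.1.elim id id, fun j => ⟨Sum.inr j, by simp⟩,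
      ?_, fun _ => rfl⟩).trans (by simp)
    rintro ⟨j | j, hj⟩
    · simp at hj
    · rfl
  · refine (Nat.card_congr (β := Fin m) ⟨fun y => y.1.elim id id, fun j => ⟨Sum.inl j, by simp⟩,
      ?_, fun _ => rfl⟩).trans (by simp)
    rintro ⟨j | j, hj⟩
    · rfl
    · simp at hj

theorem adj_of_iso_completeBipartiteGraph {β : Type*} {G : SimpleGraph β} {m : ℕ}
    (h : ∀ c : G.ConnectedComponent,
      Nonempty (G.induce c.supp ≃g completeBipartiteGraph (Fin m) (Fin m)))
    (w x y z : β) (hwx : G.Adj w x) (hxy : G.Adj x y) (hyz : G.Adj y z) : G.Adj w z := by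
  obtain ⟨e⟩ := h (G.connectedComponentMk w)
  have hw : w ∈ (G.connectedComponentMk w).supp := rfl
  have hx : x ∈ (G.connectedComponentMk w).supp :=
    SimpleGraph.ConnectedComponent.sound hwx.reachable.symm
  have hy : y ∈ (G.connectedComponentMk w).supp :=
    SimpleGraph.ConnectedComponent.sound (hwx.reachable.trans hxy.reachable).symm
  have hz : z ∈ (G.connectedComponentMk w).supp :=
    SimpleGraph.ConnectedComponent.sound
      ((hwx.reachable.trans hxy.reachable).trans hyz.reachable).symm
  have h1 := (e.map_adj_iff (v := ⟨w, hw⟩) (w := ⟨x, hx⟩)).2 hwx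
  have h2 := (e.map_adj_iff (v := ⟨x, hx⟩) (w := ⟨y, hy⟩)).2 hxy
  have h3 := (e.map_adj_iff (v := ⟨y, hy⟩) (w := ⟨z, hz⟩)).2 hyz
  have h4 := (e.map_adj_iff (v := ⟨w, hw⟩) (w := ⟨z, hz⟩)).1
  refine h4 ?_
  revert h1 h2 h3
  rcases e ⟨w, hw⟩ with _ | _ <;> rcases e ⟨x, hx⟩ with _ | _ <;>
    rcases e ⟨y, hy⟩ with _ | _ <;> rcases e ⟨z, hz⟩ with _ | _ <;> simp

/-- Extremality of a graph `F` with a cycle forces `F` to be bipartite and the ends of walks of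
length three in `G` to be adjacent. -/
theorem colorable_and_adj_of_homDensity_eq_one {α β : Type*} [Fintype α] [Fintype β] [Nonempty β]
    {F : SimpleGraph α} {G : SimpleGraph β} {d : ℝ} (hadm : Admissible G d)
    (h : homDensity F G d = 1) (hF : ¬ F.IsAcyclic) (hreg : ∀ x, (vdegree G x : ℝ) = d) :
    F.Colorable 2 ∧ ∀ w x y z, G.Adj w x → G.Adj x y → G.Adj y z → G.Adj w z := by
  obtain ⟨u, v, huv, hbr⟩ : ∃ u v, F.Adj u v ∧ (F.deleteEdges {s(u, v)}).Reachable u v := by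
    by_contra! hcon
    refine hF (SimpleGraph.isAcyclic_iff_forall_isBridge.2 ?_)
    intro e
    induction e with
    | h u v => exact fun he => SimpleGraph.isBridge_iff.2 (hcon u v he)
  set H := F.deleteEdges {s(u, v)} with hH
  have hHF : H ≤ F := SimpleGraph.deleteEdges_le _
  have hadj : ∀ s t, F.Adj s t → H.Reachable s t := by
    intro s t hst
    by_cases he : s(s, t) = s(u, v)
    · rcases Sym2.eq_iff.1 he with ⟨rfl, rfl⟩ | ⟨rfl, rfl⟩
      · exact hbr
      · exact hbr.symm
    · exact SimpleGraph.Adj.reachable ((SimpleGraph.deleteEdges_adj).2 ⟨hst, he⟩)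
  have hreach : ∀ s t, H.Reachable s t ↔ F.Reachable s t := by
    refine fun s t => ⟨fun hr => hr.mono hHF, fun hr => ?_⟩
    rw [SimpleGraph.reachable_iff_reflTransGen] at hr
    induction hr with
    | refl => rfl
    | tail _ hbc ih => exact ih.trans (hadj _ _ hbc)
  obtain ⟨T, hT⟩ := SpanningForest.exists_of_vertex H u
  have hTu : T.rank u = 0 := by rw [hT u (SimpleGraph.Reachable.refl u), SimpleGraph.dist_self]
  have hTv : 1 < T.rank v := by
    rw [hT v hbr]
    refine hbr.one_lt_dist_of_ne_of_not_adj huv.ne fun hc => ?_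
    simp [hH] at hc
  have key : ∀ W : ℕ → β, (∀ n, G.Adj (W n) (W (n + 1))) →
      ∀ s t, F.Adj s t → G.Adj (W (T.rank s)) (W (T.rank t)) := by
    intro W hW
    refine (adj_of_homDensity_eq_one hadm hHF hreach T h).1 (fun s => W (T.rank s)) fun s hs => ?_
    rw [← T.rank_parent s hs]
    exact hW _
  have hpar : ∀ x y, G.Adj x y → ∀ s t, F.Adj s t → ¬ (Even (T.rank s) ↔ Even (T.rank t)) := by
    intro x y hxy s t hst heq
    have := key (fun n => if Even n then x else y) (fun n => by
      by_cases hn : Even n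
      · simpa [hn, Nat.even_add_one] using hxy
      · simpa [hn, Nat.even_add_one] using hxy.symm) s t hst
    simp only [heq] at this
    exact G.irrefl this
  obtain ⟨x, y, hxy⟩ : ∃ x y, G.Adj x y := by
    by_contra! hcon
    obtain ⟨x⟩ := ‹Nonempty β›
    have : IsEmpty (G.neighborSet x) := ⟨fun y => hcon x y y.2⟩
    have h0 := hreg x
    rw [vdegree, Nat.card_of_isEmpty, Nat.cast_zero] at h0
    linarith [hadm.1]
  refine ⟨?_, fun w x y z hwx hxy hyz => ?_⟩
  · let c : F.Coloring Bool := SimpleGraph.Coloring.mk (fun s => decide (Even (T.rank s)))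
      fun {s t} hst heq => hpar x y hxy s t hst (by simpa using heq)
    simpa using c.colorable
  · have hodd : ¬ Even (T.rank v) := fun he => hpar x y hxy u v huv (by simp [hTu, he])
    have := key (fun n => if n = 0 then w else if n = 1 then x else if Even n then y else z)
      (fun n => by
        rcases n with _ | _ | n
        · simpa using hwx
        · simpa using hxy
        · by_cases hn : Even n
          · simpa [hn, Nat.even_add_one] using hyz
          · simpa [hn, Nat.even_add_one] using hyz.symm) u v huv
    simpa [hTu, hodd, show T.rank v ≠ 0 by omega, show T.rank v ≠ 1 by omega] using this

/-- For an admissible pair `(G, d)` with `G` nonempty and any graph `F`,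
the homomorphism density `t(F,G,d)` equals `1` iff (a) `F` is edgeless, or (b) `F` is a
forest and `G` is `d`-regular, or (c) `F` is bipartite and every connected component of
`G` is isomorphic to `K_{d,d}` (with `d` a positive integer). -/
theorem stmt0 {α β : Type*} [Fintype α] [Fintype β] [Nonempty β]
    (F : SimpleGraph α) (G : SimpleGraph β) (d : ℝ) (hadm : Admissible G d) :
    homDensity F G d = 1 ↔
      (edgeCount F = 0) ∨
      (F.IsAcyclic ∧ ∀ x : β, (vdegree G x : ℝ) = d) ∨
      (F.Colorable 2 ∧ ∃ m : ℕ, 0 < m ∧ (m : ℝ) = d ∧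
        ∀ c : G.ConnectedComponent,
          Nonempty (G.induce c.supp ≃g completeBipartiteGraph (Fin m) (Fin m))) := by
  constructor
  · intro h
    by_cases hE : edgeCount F = 0
    · exact Or.inl hE
    obtain ⟨s, t, hst⟩ : ∃ s t, F.Adj s t := by
      by_contra! hcon
      have : IsEmpty F.edgeSet := ⟨fun e => by
        obtain ⟨e, he⟩ := e
        induction e with
        | h s t => exact hcon s t he⟩
      exact hE Nat.card_of_isEmpty
    obtain ⟨T⟩ := SpanningForest.nonempty F
    have hreg := (adj_of_homDensity_eq_one hadm le_rfl (fun _ _ => Iff.rfl) T h).2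
      (T.exists_rank_ne_zero hst)
    by_cases hF : F.IsAcyclic
    · exact Or.inr (Or.inl ⟨hF, hreg⟩)
    obtain ⟨hcol, hG⟩ := colorable_and_adj_of_homDensity_eq_one hadm h hF hreg
    have hm := hreg (Classical.arbitrary β)
    have hpos : 0 < vdegree G (Classical.arbitrary β) := by
      have : (0 : ℝ) < vdegree G (Classical.arbitrary β) := by linarith [hadm.1]
      exact_mod_cast this
    refine Or.inr (Or.inr ⟨hcol, _, hpos, hm, nonempty_iso_completeBipartiteGraph hpos ?_ hG⟩)
    intro x
    exact_mod_cast (hreg x).trans hm.symm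
  · obtain ⟨T⟩ := SpanningForest.nonempty F
    rintro (hE | ⟨hF, hreg⟩ | ⟨hcol, m, -, rfl, hiso⟩)
    · have hno : ∀ s t, ¬ F.Adj s t := by
        intro s t hst
        rcases Nat.card_eq_zero.1 hE with he | he
        · exact he.false ⟨s(s, t), hst⟩
        · exact not_finite_iff_infinite.2 he inferInstance
      have hroots : T.nonroots = ∅ := by
        rw [Finset.eq_empty_iff_forall_notMem]
        exact fun s hs => hno _ _ (T.adj_parent s (SpanningForest.mem_nonroots.1 hs))
      rw [T.homDensity_eq_one_iff G hadm.1, hroots, homCount_eq_card]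
      simp [hno, Nat.card_fun]
    · refine homDensity_eq_one_of_regular hadm hreg T fun f hf s t hst => ?_
      rcases T.parent_eq_of_isAcyclic hF hst with ⟨hr, rfl⟩ | ⟨hr, rfl⟩
      · exact (hf _ hr).symm
      · exact hf _ hr
    · refine homDensity_eq_one_of_regular hadm (fun x => by
        rw [vdegree_eq_of_iso_completeBipartiteGraph hiso x]) T fun f hf s t hst => ?_
      exact T.adj_of_colorable (hcol.toColoring (by simp))
        (adj_of_iso_completeBipartiteGraph hiso) f hf hst
end

section
/- Let F be a graph with connected components F_1, …, F_m. Then there exists a constant C = C(F) > 0 such that for every admissible pair (G,d) with d > 1 and v(G) ≥ 1: 0 ≤ (∏_{i=1}^m t_inj(F_i,G,d)) − t_inj(F,G,d) ≤ C/v(G). -/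
open Filter Topology

open Classical in
/-- Injective partial homomorphisms from `H` to `G` with domain `S` that send `y` to `w`, extended
by the constant `w` outside `S`. -/
noncomputable def rootedPartialEmbeddings {β V : Type*} [Fintype β] [Fintype V]
    (H : SimpleGraph β) (G : SimpleGraph V) (y : β) (w : V) (S : Finset β) : Finset (β → V) :=
  Finset.univ.filter fun f =>
    f y = w ∧ Set.InjOn f S ∧ (∀ a ∈ S, ∀ b ∈ S, H.Adj a b → G.Adj (f a) (f b)) ∧
      ∀ a ∉ S, f a = w

/-- The maximal number of embeddings of a rooted tree on `h` vertices into a graph of maximum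
degree `D`, with prescribed image of the root. -/
def rootedBound (D h : ℕ) : ℕ := if 2 ≤ h then D * (D - 1) ^ (h - 2) else 1

open Classical in
theorem card_rootedPartialEmbeddings_insert_le {β V : Type*} [Fintype β] [Fintype V]
    (H : SimpleGraph β) (G : SimpleGraph V) (y : β) (w : V) {S : Finset β} (hy : y ∈ S)
    {u p : β} (hu : u ∉ S) (hp : p ∈ S) (hpu : H.Adj p u) (K : ℕ)
    (hK : ∀ g ∈ rootedPartialEmbeddings H G y w S,
      (Finset.univ.filter fun z => G.Adj (g p) z ∧ ∀ q ∈ S, z ≠ g q).card ≤ K) :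
    (rootedPartialEmbeddings H G y w (insert u S)).card ≤
      K * (rootedPartialEmbeddings H G y w S).card := by
  refine Finset.card_le_mul_card_image_of_maps_to (f := fun f => Function.update f u w) ?_ K ?_
  · intro f hf
    simp only [rootedPartialEmbeddings, Finset.mem_filter, Finset.mem_univ, true_and] at hf ⊢
    obtain ⟨h1, h2, h3, h4⟩ := hf
    have hne : ∀ a ∈ S, a ≠ u := fun a ha h => hu (h ▸ ha)
    refine ⟨by simp [Function.update_of_ne (hne y hy), h1], ?_, ?_, ?_⟩
    · intro a ha b hb hab
      simp only [Finset.mem_coe] at ha hb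
      simp only [Function.update_of_ne (hne a ha), Function.update_of_ne (hne b hb)] at hab
      exact h2 (by simp [ha]) (by simp [hb]) hab
    · intro a ha b hb hab
      rw [Function.update_of_ne (hne a ha), Function.update_of_ne (hne b hb)]
      exact h3 a (by simp [ha]) b (by simp [hb]) hab
    · intro a ha
      by_cases hau : a = u
      · subst hau; simp
      · rw [Function.update_of_ne hau]
        exact h4 a (by simp [ha, hau])
  · intro g hg
    refine le_trans ?_ (hK g hg)
    refine Finset.card_le_card_of_injOn (fun f => f u) ?_ ?_
    · intro f hf
      simp only [Finset.coe_filter, Set.mem_ofPred_eq, rootedPartialEmbeddings, Finset.mem_filter,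
        Finset.mem_univ, true_and] at hf ⊢
      obtain ⟨⟨h1, h2, h3, h4⟩, rfl⟩ := hf
      have hne : ∀ a ∈ S, a ≠ u := fun a ha h => hu (h ▸ ha)
      refine ⟨?_, ?_⟩
      · rw [Function.update_of_ne (hne p hp)]
        exact h3 p (by simp [hp]) u (by simp) hpu
      · intro q hq
        rw [Function.update_of_ne (hne q hq)]
        intro h
        exact hne q hq (h2 (by simp) (by simp [hq]) h).symm
    · intro f hf f' hf' hff
      simp only [Finset.coe_filter, Set.mem_ofPred_eq] at hf hf'
      funext a
      by_cases hau : a = u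
      · subst hau; exact hff
      · have := congrFun (hf.2.trans hf'.2.symm) a
        simpa [Function.update_of_ne hau] using this

theorem exists_adj_of_connected {β : Type*} {H : SimpleGraph β} (hH : H.Connected)
    {S : Finset β} {y z : β} (hy : y ∈ S) (hz : z ∉ S) : ∃ p ∈ S, ∃ u ∉ S, H.Adj p u := by
  obtain ⟨W⟩ := hH.preconnected y z
  obtain ⟨e, -, h1, h2⟩ := W.exists_boundary_dart (S : Set β) hy hz
  exact ⟨e.fst, h1, e.snd, h2, e.adj⟩

open Classical in
theorem exists_card_rootedPartialEmbeddings_le {β V : Type*} [Fintype β] [Fintype V]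
    {H : SimpleGraph β} (hH : H.Connected) (G : SimpleGraph V) (D : ℕ)
    (hD : ∀ x, Nat.card (G.neighborSet x) ≤ D) (y : β) (w : V) (k : ℕ)
    (hk : k + 1 ≤ Fintype.card β) :
    ∃ S : Finset β, y ∈ S ∧ S.card = k + 1 ∧ (1 ≤ k → ∀ p ∈ S, ∃ q ∈ S, H.Adj p q) ∧
      (rootedPartialEmbeddings H G y w S).card ≤ rootedBound D (k + 1) := by
  have hdeg : ∀ x, (Finset.univ.filter fun z => G.Adj x z).card ≤ D := by
    intro x
    refine le_trans (le_of_eq ?_) (hD x)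
    rw [Nat.card_eq_fintype_card, Fintype.card_subtype]
    rfl
  induction k with
  | zero =>
    refine ⟨{y}, by simp, by simp, by simp, ?_⟩
    rw [rootedBound, if_neg (by norm_num), Finset.card_le_one]
    intro f hf g hg
    simp only [rootedPartialEmbeddings, Finset.mem_filter, Finset.mem_univ, true_and,
      Finset.mem_singleton] at hf hg
    funext a
    by_cases ha : a = y
    · subst ha; rw [hf.1, hg.1]
    · rw [hf.2.2.2 a ha, hg.2.2.2 a ha]
  | succ k ih =>
    obtain ⟨S, hy, hS, hnb, hcard⟩ := ih (by omega)
    obtain ⟨z, hz⟩ : ∃ z, z ∉ S := by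
      by_contra! h
      have : S = Finset.univ := Finset.eq_univ_iff_forall.2 h
      rw [this, Finset.card_univ] at hS
      omega
    obtain ⟨p, hp, u, hu, hpu⟩ := exists_adj_of_connected hH hy hz
    refine ⟨insert u S, by simp [hy], by rw [Finset.card_insert_of_notMem hu, hS], ?_, ?_⟩
    · intro _ r hr
      rcases Finset.mem_insert.1 hr with rfl | hr
      · exact ⟨p, by simp [hp], hpu.symm⟩
      · rcases Nat.eq_zero_or_pos k with rfl | hk0
        · have hrp : r = p := by
            obtain ⟨s, rfl⟩ := Finset.card_eq_one.1 hS
            rw [Finset.mem_singleton.1 hr, Finset.mem_singleton.1 hp]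
          exact ⟨u, by simp, hrp ▸ hpu⟩
        · obtain ⟨q, hq, hrq⟩ := hnb hk0 r hr
          exact ⟨q, by simp [hq], hrq⟩
    · rcases Nat.eq_zero_or_pos k with rfl | hk0
      · refine (card_rootedPartialEmbeddings_insert_le H G y w hy hu hp hpu D ?_).trans ?_
        · intro g _
          refine le_trans (Finset.card_le_card ?_) (hdeg (g p))
          intro z hz
          simp only [Finset.mem_filter, Finset.mem_univ, true_and] at hz ⊢
          exact hz.1
        · simp only [rootedBound] at hcard ⊢
          norm_num at hcard ⊢
          exact (Nat.mul_le_mul_left D hcard).trans (by simp)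
      · refine (card_rootedPartialEmbeddings_insert_le H G y w hy hu hp hpu (D - 1) ?_).trans ?_
        · intro g hg
          obtain ⟨q, hq, hpq⟩ := hnb hk0 p hp
          simp only [rootedPartialEmbeddings, Finset.mem_filter, Finset.mem_univ,
            true_and] at hg
          have hmem : g q ∈ Finset.univ.filter fun z => G.Adj (g p) z := by
            simpa using hg.2.2.1 p hp q hq hpq
          refine le_trans (Finset.card_le_card (t := (Finset.univ.filter
            fun z => G.Adj (g p) z).erase (g q)) ?_) ?_
          · intro z hz
            simp only [Finset.mem_filter, Finset.mem_univ, true_and, Finset.mem_erase] at hz ⊢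
            exact ⟨hz.2 q hq, hz.1⟩
          · rw [Finset.card_erase_of_mem hmem]
            exact Nat.sub_le_sub_right (hdeg (g p)) 1
        · refine (Nat.mul_le_mul_left _ hcard).trans (le_of_eq ?_)
          obtain ⟨j, rfl⟩ : ∃ j, k = j + 1 := ⟨k - 1, by omega⟩
          simp only [rootedBound]
          rw [if_pos (by omega), if_pos (by omega)]
          rw [show j + 1 + 1 - 2 = j by omega, show j + 1 + 1 + 1 - 2 = j + 1 by omega, pow_succ]
          ring

theorem card_rooted_embeddings_le {β V : Type*} [Finite β] [Finite V]
    {H : SimpleGraph β} (hH : H.Connected) (G : SimpleGraph V) (D : ℕ)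
    (hD : ∀ x, Nat.card (G.neighborSet x) ≤ D) (y : β) (w : V) :
    Nat.card {f : {f : H →g G // Function.Injective f} // f.1 y = w} ≤
      rootedBound D (Nat.card β) := by
  have := Fintype.ofFinite β
  have := Fintype.ofFinite V
  have hpos : 0 < Fintype.card β := Fintype.card_pos_iff.2 ⟨y⟩
  obtain ⟨S, -, hS, -, hcard⟩ := exists_card_rootedPartialEmbeddings_le hH G D hD y w
    (Fintype.card β - 1) (by omega)
  rw [Nat.sub_add_cancel hpos] at hS hcard
  have hSu : S = Finset.univ := Finset.eq_univ_of_card S hS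
  subst hSu
  rw [Nat.card_eq_fintype_card (α := β)]
  refine le_trans ?_ hcard
  rw [← Nat.card_eq_finsetCard]
  refine Nat.card_le_card_of_injective (fun f => ⟨f.1.1, ?_⟩) ?_
  · simp only [rootedPartialEmbeddings, Finset.mem_filter, Finset.mem_univ, true_and]
    exact ⟨f.2, f.1.2.injOn, fun a _ b _ hab => f.1.1.map_adj hab, by simp⟩
  · intro f g hfg
    exact Subtype.ext (Subtype.ext (DFunLike.coe_injective (Subtype.ext_iff.1 hfg)))

/-- The normalisation of the injective density contributed by a component on `h` vertices. -/
noncomputable def componentWeight (d : ℝ) (h : ℕ) : ℝ :=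
  d ^ (if 2 ≤ h then 1 else 0) * (d - 1) ^ (h - 1 - if 2 ≤ h then 1 else 0)

theorem componentWeight_pos {d : ℝ} (hd : 1 < d) (h : ℕ) : 0 < componentWeight d h :=
  mul_pos (pow_pos (by linarith) _) (pow_pos (by linarith) _)

theorem rootedBound_floor_le {d : ℝ} (hd : 1 < d) (h : ℕ) :
    (rootedBound ⌊d⌋₊ h : ℝ) ≤ componentWeight d h := by
  have h0 : (⌊d⌋₊ : ℝ) ≤ d := Nat.floor_le (by linarith)
  have h1 : 1 ≤ ⌊d⌋₊ := Nat.le_floor (by simpa using hd.le)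
  unfold rootedBound componentWeight
  split_ifs with h2
  · push_cast [Nat.cast_sub h1]
    rw [pow_one, show h - 1 - 1 = h - 2 by omega]
    have : (0 : ℝ) ≤ (⌊d⌋₊ : ℝ) - 1 := by
      have : (1 : ℝ) ≤ ⌊d⌋₊ := by exact_mod_cast h1
      linarith
    gcongr
  · rw [show h - 1 - 0 = 0 by omega]
    simp

theorem injCount_le_of_connected {β V : Type*} [Finite β] [Finite V]
    {H : SimpleGraph β} (hH : H.Connected) (G : SimpleGraph V) (D : ℕ)
    (hD : ∀ x, Nat.card (G.neighborSet x) ≤ D) :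
    injCount H G ≤ Nat.card V * rootedBound D (Nat.card β) := by
  obtain ⟨y⟩ := hH.nonempty
  have := Fintype.ofFinite V
  rw [injCount, ← Nat.card_congr (Equiv.sigmaFiberEquiv
    fun f : {f : H →g G // Function.Injective f} => f.1 y), Nat.card_sigma]
  refine (Finset.sum_le_card_nsmul _ _ _ fun w _ =>
    card_rooted_embeddings_le hH G D hD y w).trans ?_
  simp [Nat.card_eq_fintype_card]

theorem injDensity_of_connected {β V : Type*} [Finite β]
    {H : SimpleGraph β} (hH : H.Connected) (G : SimpleGraph V) (d : ℝ) :
    injDensity H G d = injCount H G / (Nat.card V * componentWeight d (Nat.card β)) := by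
  have hs := hH.preconnected.subsingleton_connectedComponent
  obtain ⟨y⟩ := hH.nonempty
  let c₀ := H.connectedComponentMk y
  have h1 : numComponents H = 1 := by
    rw [numComponents, Nat.card_eq_one_iff_unique]
    exact ⟨hs, ⟨c₀⟩⟩
  have hsupp : ∀ c : H.ConnectedComponent, c.supp = Set.univ := by
    intro c
    ext x
    simp [SimpleGraph.ConnectedComponent.mem_supp_iff, Subsingleton.elim _ c]
  have h2 : numBigComponents H = if 2 ≤ Nat.card β then 1 else 0 := by
    rw [numBigComponents]
    simp only [hsupp, Nat.card_univ]
    split_ifs with h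
    · rw [Nat.card_eq_one_iff_unique]
      exact ⟨inferInstance, ⟨⟨c₀, h⟩⟩⟩
    · simp [h]
  rw [injDensity, h1, h2, componentWeight, pow_one, mul_assoc]

open Classical in
theorem injDensity_eq_prod_componentWeight {α V : Type*} [Fintype α] (F : SimpleGraph α)
    [Fintype F.ConnectedComponent] (G : SimpleGraph V) (d : ℝ) :
    injDensity F G d = injCount F G /
      ∏ c : F.ConnectedComponent, (Nat.card V * componentWeight d (Nat.card c.supp)) := by
  have hb : numBigComponents F =
      ∑ c : F.ConnectedComponent, if 2 ≤ Nat.card c.supp then 1 else 0 := by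
    rw [numBigComponents, Nat.card_eq_fintype_card, Fintype.card_subtype, Finset.card_filter]
  have hk : numComponents F = ∑ c : F.ConnectedComponent, 1 := by
    simp [numComponents, Nat.card_eq_fintype_card]
  have hv : Nat.card α = ∑ c : F.ConnectedComponent, Nat.card c.supp := by
    rw [← Nat.card_congr (Equiv.sigmaFiberEquiv F.connectedComponentMk), Nat.card_sigma]
    rfl
  have hpos : ∀ c : F.ConnectedComponent, 0 < Nat.card c.supp := by
    intro c
    have : Nonempty c.supp := c.nonempty_supp.to_subtype
    exact Nat.card_pos
  have he : Nat.card α - numComponents F - numBigComponents F = ∑ c : F.ConnectedComponent,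
      (Nat.card c.supp - 1 - if 2 ≤ Nat.card c.supp then 1 else 0) := by
    rw [Nat.sub_sub, hv, hk, hb, ← Finset.sum_add_distrib, ← Finset.sum_tsub_distrib]
    · simp only [Nat.sub_sub]
    · intro c _
      have := hpos c
      split_ifs <;> omega
  rw [injDensity, he, hb, hk]
  simp only [componentWeight, Finset.prod_mul_distrib, Finset.prod_pow_eq_pow_sum]
  simp [mul_assoc]

/-- The restriction of an embedding of `F` to the components of `F`. -/
def restrictComponents {α V : Type*} (F : SimpleGraph α) (G : SimpleGraph V)
    (f : {f : F →g G // Function.Injective f}) (c : F.ConnectedComponent) :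
    {f : F.induce c.supp →g G // Function.Injective f} :=
  ⟨f.1.comp (SimpleGraph.Embedding.induce (G := F) c.supp).toHom,
    f.2.comp Subtype.val_injective⟩

theorem restrictComponents_injective {α V : Type*} (F : SimpleGraph α) (G : SimpleGraph V) :
    Function.Injective (restrictComponents F G) := by
  intro f g hfg
  refine Subtype.ext (DFunLike.ext _ _ fun x => ?_)
  have h : (restrictComponents F G f (F.connectedComponentMk x)).1 =
      (restrictComponents F G g (F.connectedComponentMk x)).1 := by rw [hfg]
  exact DFunLike.congr_fun h ⟨x, rfl⟩

/-- A vertex as an element of its connected component. -/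
def toComponent {α : Type*} (F : SimpleGraph α) (x : α) : (F.connectedComponentMk x).supp :=
  ⟨x, rfl⟩

theorem exists_collision {α V : Type*} (F : SimpleGraph α) (G : SimpleGraph V)
    (t : ∀ c : F.ConnectedComponent, {f : F.induce c.supp →g G // Function.Injective f})
    (ht : t ∉ Set.range (restrictComponents F G)) :
    ∃ x y : α, F.connectedComponentMk x ≠ F.connectedComponentMk y ∧
      (t (F.connectedComponentMk x)).1 (toComponent F x) =
        (t (F.connectedComponentMk y)).1 (toComponent F y) := by
  by_contra! h
  have key : ∀ (c : F.ConnectedComponent) (x : c.supp),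
      (t (F.connectedComponentMk x)).1 (toComponent F x) = (t c).1 x := by
    rintro c ⟨x, hx⟩
    obtain rfl : F.connectedComponentMk x = c := hx
    rfl
  refine ht ⟨⟨⟨fun x => (t (F.connectedComponentMk x)).1 (toComponent F x), ?_⟩, ?_⟩, ?_⟩
  · intro a b hab
    have hc : F.connectedComponentMk b = F.connectedComponentMk a :=
      SimpleGraph.ConnectedComponent.sound hab.symm.reachable
    rw [key (F.connectedComponentMk a) ⟨b, hc⟩]
    have hab' : (F.induce (F.connectedComponentMk a).supp).Adj (toComponent F a) ⟨b, hc⟩ := hab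
    exact (t (F.connectedComponentMk a)).1.map_adj hab'
  · intro a b hab
    have hc : F.connectedComponentMk b = F.connectedComponentMk a := by
      by_contra hne
      exact h a b (Ne.symm hne) hab
    have hab' : (t (F.connectedComponentMk a)).1 (toComponent F a) =
        (t (F.connectedComponentMk a)).1 ⟨b, hc⟩ :=
      Eq.trans hab (key (F.connectedComponentMk a) ⟨b, hc⟩)
    exact congrArg Subtype.val ((t (F.connectedComponentMk a)).2 hab')
  · funext c
    exact Subtype.ext (DFunLike.ext _ _ fun x => key c x)

open Classical in
theorem card_collision_le {α V : Type*} [Fintype α] [Finite V] (F : SimpleGraph α)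
    [Fintype F.ConnectedComponent] (G : SimpleGraph V) (D : ℕ)
    (hD : ∀ x, Nat.card (G.neighborSet x) ≤ D) {x y : α}
    (hxy : F.connectedComponentMk x ≠ F.connectedComponentMk y) :
    Nat.card {t : ∀ c : F.ConnectedComponent,
        {f : F.induce c.supp →g G // Function.Injective f} //
      (t (F.connectedComponentMk x)).1 (toComponent F x) =
        (t (F.connectedComponentMk y)).1 (toComponent F y)} * Nat.card V ≤
      ∏ c : F.ConnectedComponent, (Nat.card V * rootedBound D (Nat.card c.supp)) := by
  set c₀ := F.connectedComponentMk y with hc₀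
  let T (c : F.ConnectedComponent) := {f : F.induce c.supp →g G // Function.Injective f}
  have hconn : ∀ c : F.ConnectedComponent, (F.induce c.supp).Connected :=
    fun c => c.connected_toSimpleGraph
  have hfin : ∀ c, Finite (T c) := fun c => by
    have : Finite (F.induce c.supp →g G) := DFunLike.finite _
    infer_instance
  have hT : ∀ c, Nat.card (T c) ≤ Nat.card V * rootedBound D (Nat.card c.supp) :=
    fun c => injCount_le_of_connected (hconn c) G D hD
  let P (t : ∀ c, T c) : Prop :=
    (t (F.connectedComponentMk x)).1 (toComponent F x) = (t c₀).1 (toComponent F y)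
  let S := Σ s : ∀ c : {c // c ≠ c₀}, T c, {f : T c₀ // f.1 (toComponent F y) =
        (s ⟨F.connectedComponentMk x, hxy⟩).1 (toComponent F x)}
  let split : {t : ∀ c, T c // P t} → S := fun t => ⟨fun c => t.1 c, ⟨t.1 c₀, t.2.symm⟩⟩
  let glue : S → ∀ c, T c := fun s => (Equiv.piSplitAt c₀ T).symm (s.2.1, s.1)
  have hsplit : Function.Injective split := fun t t' h => Subtype.ext <| by
    have := congrArg glue h
    exact ((Equiv.piSplitAt c₀ T).symm_apply_apply t.1).symm.trans
      (this.trans ((Equiv.piSplitAt c₀ T).symm_apply_apply t'.1))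
  have := fun c => Fintype.ofFinite (T c)
  have hS : Nat.card S ≤ (∏ c : {c // c ≠ c₀}, Nat.card (T c)) *
      rootedBound D (Nat.card c₀.supp) := by
    rw [Nat.card_sigma]
    refine (Finset.sum_le_card_nsmul _ _ _ fun s _ =>
      card_rooted_embeddings_le (hconn c₀) G D hD _ _).trans (le_of_eq ?_)
    rw [smul_eq_mul, Finset.card_univ, ← Nat.card_eq_fintype_card, Nat.card_pi]
  calc Nat.card {t : ∀ c, T c // P t} * Nat.card V
      ≤ ((∏ c : {c // c ≠ c₀}, Nat.card (T c)) * rootedBound D (Nat.card c₀.supp)) *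
          Nat.card V := Nat.mul_le_mul_right _
            ((Nat.card_le_card_of_injective split hsplit).trans hS)
    _ ≤ ((∏ c : {c // c ≠ c₀}, Nat.card V * rootedBound D (Nat.card c.1.supp)) *
          rootedBound D (Nat.card c₀.supp)) * Nat.card V := by
        gcongr with c
        exact hT c
    _ = ∏ c : F.ConnectedComponent, (Nat.card V * rootedBound D (Nat.card c.supp)) := by
        rw [Fintype.prod_eq_mul_prod_subtype_ne _ c₀]
        ring

open Classical in
theorem injCount_le_prod {α V : Type*} [Fintype α] [Finite V] (F : SimpleGraph α)
    [Fintype F.ConnectedComponent] (G : SimpleGraph V) :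
    injCount F G ≤ ∏ c : F.ConnectedComponent, injCount (F.induce c.supp) G := by
  have hfin : ∀ c : F.ConnectedComponent, Finite (F.induce c.supp →g G) :=
    fun c => DFunLike.finite _
  refine (Nat.card_le_card_of_injective _ (restrictComponents_injective F G)).trans ?_
  rw [Nat.card_pi]
  rfl

open Classical in
theorem prod_injCount_sub_le {α V : Type*} [Fintype α] [Finite V] (F : SimpleGraph α)
    [Fintype F.ConnectedComponent] (G : SimpleGraph V) (D : ℕ)
    (hD : ∀ x, Nat.card (G.neighborSet x) ≤ D) :
    (∏ c : F.ConnectedComponent, injCount (F.induce c.supp) G) * Nat.card V ≤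
      injCount F G * Nat.card V + Fintype.card α ^ 2 *
        ∏ c : F.ConnectedComponent, (Nat.card V * rootedBound D (Nat.card c.supp)) := by
  let T (c : F.ConnectedComponent) := {f : F.induce c.supp →g G // Function.Injective f}
  have hfin : ∀ c, Finite (T c) := fun c => by
    have : Finite (F.induce c.supp →g G) := DFunLike.finite _
    infer_instance
  have := fun c => Fintype.ofFinite (T c)
  have hfinF : Finite (F →g G) := DFunLike.finite _
  have := Fintype.ofFinite {f : F →g G // Function.Injective f}
  let coll (p : α × α) : Finset (∀ c, T c) := Finset.univ.filter fun t =>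
    (t (F.connectedComponentMk p.1)).1 (toComponent F p.1) =
      (t (F.connectedComponentMk p.2)).1 (toComponent F p.2)
  let pairs : Finset (α × α) := Finset.univ.filter fun p =>
    F.connectedComponentMk p.1 ≠ F.connectedComponentMk p.2
  have hcover : (Finset.univ : Finset (∀ c, T c)) ⊆
      Finset.univ.image (restrictComponents F G) ∪ pairs.biUnion coll := by
    intro t _
    by_cases ht : t ∈ Set.range (restrictComponents F G)
    · obtain ⟨f, rfl⟩ := ht
      simp
    · obtain ⟨x, y, hxy, h⟩ := exists_collision F G t ht
      refine Finset.mem_union_right _ (Finset.mem_biUnion.2 ⟨(x, y), ?_, ?_⟩)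
      · simpa [pairs] using hxy
      · simpa [coll] using h
  have hprod : ∏ c : F.ConnectedComponent, injCount (F.induce c.supp) G =
      (Finset.univ : Finset (∀ c, T c)).card := by
    rw [Finset.card_univ, ← Nat.card_eq_fintype_card, Nat.card_pi]
    rfl
  have hinj : (Finset.univ.image (restrictComponents F G)).card ≤ injCount F G := by
    refine Finset.card_image_le.trans (le_of_eq ?_)
    rw [Finset.card_univ, ← Nat.card_eq_fintype_card]
    rfl
  have hpairs : pairs.card ≤ Fintype.card α ^ 2 := by
    refine (Finset.card_le_univ _).trans (le_of_eq ?_)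
    rw [Fintype.card_prod, sq]
  rw [hprod]
  calc (Finset.univ : Finset (∀ c, T c)).card * Nat.card V
      ≤ (injCount F G + ∑ p ∈ pairs, (coll p).card) * Nat.card V := by
        refine Nat.mul_le_mul_right _ ((Finset.card_le_card hcover).trans ?_)
        exact (Finset.card_union_le _ _).trans (add_le_add hinj Finset.card_biUnion_le)
    _ = injCount F G * Nat.card V + ∑ p ∈ pairs, (coll p).card * Nat.card V := by
        rw [add_mul, Finset.sum_mul]
    _ ≤ _ := by
        refine Nat.add_le_add_left ((Finset.sum_le_card_nsmul _ _ _ fun p hp => ?_).trans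
          (Nat.mul_le_mul_right _ hpairs)) _
        refine le_trans (le_of_eq ?_) (card_collision_le F G D hD (Finset.mem_filter.1 hp).2)
        rw [Nat.card_eq_fintype_card (α := Subtype _), Fintype.card_subtype]

/-- For a graph `F` with connected components `F₁, …, F_m`, there is a
constant `C > 0` such that for every admissible pair `(G,d)` with `d > 1` and `v(G) ≥ 1`,
`0 ≤ ∏ᵢ t_inj(Fᵢ,G,d) − t_inj(F,G,d) ≤ C / v(G)`. -/
theorem stmt3 {α : Type*} [Fintype α] (F : SimpleGraph α) [Fintype F.ConnectedComponent] :
    ∃ C : ℝ, 0 < C ∧ ∀ (m : ℕ) (G : SimpleGraph (Fin m)) (d : ℝ),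
      Admissible G d → 1 < d → 1 ≤ m →
      0 ≤ (∏ c : F.ConnectedComponent, injDensity (F.induce c.supp) G d) -
          injDensity F G d ∧
      (∏ c : F.ConnectedComponent, injDensity (F.induce c.supp) G d) -
          injDensity F G d ≤ C / m := by
  classical
  refine ⟨(Fintype.card α : ℝ) ^ 2 + 1, by positivity, fun m G d hG hd hm => ?_⟩
  have hD : ∀ x, Nat.card (G.neighborSet x) ≤ ⌊d⌋₊ := fun x => Nat.le_floor (hG.2 x)
  have hm0 : (0 : ℝ) < m := by exact_mod_cast hm
  have hprod : ∏ c : F.ConnectedComponent, injDensity (F.induce c.supp) G d =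
      (∏ c : F.ConnectedComponent, (injCount (F.induce c.supp) G : ℝ)) /
        ∏ c : F.ConnectedComponent, (m * componentWeight d (Nat.card c.supp)) := by
    rw [← Finset.prod_div_distrib]
    refine Finset.prod_congr rfl fun c _ => ?_
    have hc : (F.induce c.supp).Connected := c.connected_toSimpleGraph
    rw [injDensity_of_connected hc, Nat.card_fin]
  rw [hprod, injDensity_eq_prod_componentWeight, Nat.card_fin, ← sub_div]
  set W := ∏ c : F.ConnectedComponent, ((m : ℝ) * componentWeight d (Nat.card c.supp))
  have hW : 0 < W := Finset.prod_pos fun c _ => mul_pos hm0 (componentWeight_pos hd _)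
  have hlow : (injCount F G : ℝ) ≤
      ∏ c : F.ConnectedComponent, (injCount (F.induce c.supp) G : ℝ) := by
    exact_mod_cast injCount_le_prod F G
  have hup : (∏ c : F.ConnectedComponent, (injCount (F.induce c.supp) G : ℝ)) * m ≤
      injCount F G * m + (Fintype.card α : ℝ) ^ 2 *
        ∏ c : F.ConnectedComponent, ((m : ℝ) * rootedBound ⌊d⌋₊ (Nat.card c.supp)) := by
    have := prod_injCount_sub_le F G ⌊d⌋₊ hD
    rw [Nat.card_fin] at this
    exact_mod_cast this
  have hRW : ∏ c : F.ConnectedComponent, ((m : ℝ) * rootedBound ⌊d⌋₊ (Nat.card c.supp)) ≤ W :=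
    Finset.prod_le_prod (fun c _ => by positivity) fun c _ =>
      mul_le_mul_of_nonneg_left (rootedBound_floor_le hd _) hm0.le
  refine ⟨div_nonneg (sub_nonneg.2 hlow) hW.le, ?_⟩
  rw [div_le_div_iff₀ hW hm0]
  have := mul_le_mul_of_nonneg_left hRW (sq_nonneg (Fintype.card α : ℝ))
  linarith
end

section
/- Let 0 ≤ α ≤ 1 and let (G_n,d_n) be a sequence of admissible pairs with v(G_n) ≥ 1 for all n. The following are equivalent: (a) the sequence (G_n,d_n) is α-regular; (b) t(K_2, G_n, d_n) → α and t(P_3, G_n, d_n) → α² as n → ∞, where K_2 is a single edge and P_3 is the path with 3 vertices and 2 edges; (c) for every forest F, t(F, G_n, d_n) → α^{e(F)} as n → ∞. -/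
open Filter Topology

/-- A sequence of admissible pairs `(Gₙ, dₙ)` is `α`-regular: for every `ε > 0`, the
proportion of vertices whose normalized degree differs from `α` by at least `ε` tends to 0. -/
def AlphaRegular (V : ℕ → Type) [∀ n, Fintype (V n)] (G : ∀ n, SimpleGraph (V n))
    (d : ℕ → ℝ) (α : ℝ) : Prop :=
  ∀ ε : ℝ, 0 < ε →
    Tendsto (fun n =>
        (Nat.card {x : V n // ε ≤ |(vdegree (G n) x : ℝ) / d n - α|} : ℝ) /
          (Nat.card (V n) : ℝ))
      atTop (𝓝 0)

namespace SimpleGraph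

variable {α β : Type} {F : SimpleGraph α} {G : SimpleGraph β}

/-- A homomorphism out of a graph with a leaf `u` attached at `w` is a homomorphism out of the
graph without `u`, together with a neighbor of the image of `w`. -/
noncomputable def homLeafEquiv {u w : α} (huw : F.Adj u w) (hleaf : ∀ x, F.Adj u x → x = w) :
    (F →g G) ≃ Σ φ : F.induce {u}ᶜ →g G, G.neighborSet (φ ⟨w, huw.ne'⟩) where
  toFun f := ⟨f.comp (Embedding.induce _).toHom, ⟨f u, f.map_adj huw.symm⟩⟩
  invFun p := by
    classical
    exact
      { toFun := fun x => if h : x = u then p.2 else p.1 ⟨x, h⟩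
        map_rel' := by
          intro a b hab
          by_cases ha : a = u
          · subst ha
            obtain rfl := hleaf b hab
            simpa only [dif_pos, dif_neg hab.ne'] using p.2.2.symm
          · by_cases hb : b = u
            · subst hb
              obtain rfl := hleaf a hab.symm
              simpa only [dif_pos, dif_neg hab.ne, mem_neighborSet] using p.2.2
            · have h : (F.induce {u}ᶜ).Adj ⟨a, ha⟩ ⟨b, hb⟩ := hab
              simpa only [dif_neg ha, dif_neg hb] using p.1.map_adj h }
  left_inv f := by
    ext x
    by_cases h : x = u
    · simp [h]
    · simp [h, Embedding.induce]
  right_inv p := by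
    obtain ⟨φ, y, hy⟩ := p
    have h1 : ∀ x : ({u}ᶜ : Set α), (x : α) ≠ u := fun x => x.2
    refine Sigma.ext ?_ ?_
    · ext x
      simp [Embedding.induce, h1 x]
    · refine (Subtype.heq_iff_coe_eq ?_).2 ?_
      · intro z
        simp [Embedding.induce, huw.ne']
      · simp

/-- A finite acyclic graph with at least one edge has a leaf different from any given vertex. -/
theorem IsAcyclic.exists_leaf_ne [Finite α] (hF : F.IsAcyclic) (r : α) {a b : α}
    (hab : F.Adj a b) : ∃ u w, u ≠ r ∧ F.Adj u w ∧ ∀ x, F.Adj u x → x = w := by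
  classical
  have := Fintype.ofFinite α
  set C := F.connectedComponentMk a
  have hT := hF.isTree_connectedComponent C
  have hb : b ∈ C.supp := ConnectedComponent.sound hab.symm.reachable
  have : Nontrivial C := ⟨⟨a, rfl⟩, ⟨b, hb⟩, fun h => hab.ne (congrArg Subtype.val h)⟩
  obtain ⟨x, hx⟩ : ∃ x : C, x.1 ≠ r ∧ C.toSimpleGraph.degree x = 1 := by
    obtain ⟨x, y, hxy, hx, hy⟩ := hT.exists_ne_and_degree_eq_one
    by_cases h : x.1 = r
    · exact ⟨y, fun h' => hxy (Subtype.ext (h.trans h'.symm)), hy⟩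
    · exact ⟨x, h, hx⟩
  obtain ⟨y, hy, huniq⟩ := degree_eq_one_iff_existsUnique_adj.1 hx.2
  refine ⟨x, y, hx.1, hy, fun z hz => ?_⟩
  have hzC : z ∈ C.supp := by
    have : F.connectedComponentMk z = F.connectedComponentMk x :=
      ConnectedComponent.sound hz.symm.reachable
    exact this.trans x.2
  exact congrArg Subtype.val (huniq ⟨z, hzC⟩ hz)

theorem numComponents_induce_compl_leaf {u w : α} (huw : F.Adj u w)
    (hleaf : ∀ x, F.Adj u x → x = w) : numComponents (F.induce {u}ᶜ) = numComponents F := by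
  classical
  have hw : w ≠ u := huw.ne'
  let ρ : α → ({u}ᶜ : Set α) := fun x => if h : x = u then ⟨w, hw⟩ else ⟨x, h⟩
  have hρ : ∀ x : ({u}ᶜ : Set α), ρ x = x := fun x => dif_neg x.2
  have hρu : ρ u = ⟨w, hw⟩ := dif_pos rfl
  have key : ∀ x y, F.Reachable x y → (F.induce {u}ᶜ).Reachable (ρ x) (ρ y) := by
    rintro x y ⟨p⟩
    induction p with
    | nil => exact Reachable.refl _
    | @cons a b c hab p ih =>
      refine Reachable.trans ?_ ih
      by_cases ha : a = u
      · subst ha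
        obtain rfl := hleaf b hab
        rw [hρu, hρ ⟨b, hw⟩]
      · by_cases hb : b = u
        · subst hb
          obtain rfl := hleaf a hab.symm
          rw [hρu, hρ ⟨a, hw⟩]
        · rw [hρ ⟨a, ha⟩, hρ ⟨b, hb⟩]
          exact Adj.reachable hab
  refine Nat.card_eq_of_bijective
    (ConnectedComponent.map (Embedding.induce (G := F) {u}ᶜ).toHom) ⟨?_, ?_⟩
  · intro c c'
    induction c using ConnectedComponent.ind with | h x
    induction c' using ConnectedComponent.ind with | h y
    intro h
    have := key _ _ (ConnectedComponent.exact h)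
    exact ConnectedComponent.sound (by rwa [← hρ x, ← hρ y])
  · intro c
    induction c using ConnectedComponent.ind with | h x
    by_cases h : x = u
    · refine ⟨connectedComponentMk _ ⟨w, hw⟩, ?_⟩
      subst h
      exact ConnectedComponent.sound huw.symm.reachable
    · exact ⟨connectedComponentMk _ ⟨x, h⟩, rfl⟩

theorem edgeCount_induce_compl_leaf [Finite α] {u w : α} (huw : F.Adj u w)
    (hleaf : ∀ x, F.Adj u x → x = w) : edgeCount F = edgeCount (F.induce {u}ᶜ) + 1 := by
  have hset : F.edgeSet =
      insert s(u, w) (Sym2.map Subtype.val '' (F.induce {u}ᶜ).edgeSet) := by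
    ext e
    induction e using Sym2.ind with | h a b
    simp only [mem_edgeSet, Set.mem_insert_iff, Set.mem_image]
    constructor
    · intro hab
      by_cases ha : a = u
      · subst ha
        obtain rfl := hleaf b hab
        exact Or.inl rfl
      · by_cases hb : b = u
        · subst hb
          obtain rfl := hleaf a hab.symm
          exact Or.inl Sym2.eq_swap
        · exact Or.inr ⟨s(⟨a, ha⟩, ⟨b, hb⟩), hab, rfl⟩
    · rintro (h | ⟨e, he, h⟩)
      · rw [← mem_edgeSet, h]
        exact huw
      · induction e using Sym2.ind with | h x y
        rw [← mem_edgeSet, ← h]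
        exact he
  have hnot : s(u, w) ∉ Sym2.map Subtype.val '' (F.induce {u}ᶜ).edgeSet := by
    rintro ⟨e, -, h⟩
    have hu : u ∈ Sym2.map Subtype.val e := h ▸ Sym2.mem_mk_left u w
    obtain ⟨x, -, hx⟩ := Sym2.mem_map.1 hu
    exact x.2 hx
  unfold edgeCount
  rw [Nat.card_coe_set_eq, Nat.card_coe_set_eq, hset, Set.ncard_insert_of_notMem hnot,
    Set.ncard_image_of_injective _ (Sym2.map.injective Subtype.val_injective)]

theorem edgeCount_bot : edgeCount (⊥ : SimpleGraph α) = 0 := by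
  simp [edgeCount]

theorem numComponents_bot : numComponents (⊥ : SimpleGraph α) = Nat.card α := by
  refine (Nat.card_eq_of_bijective (⊥ : SimpleGraph α).connectedComponentMk ⟨?_, ?_⟩).symm
  · intro x y h
    exact reachable_bot.1 (ConnectedComponent.exact h)
  · intro c
    exact c.exists_rep

theorem card_compl_singleton_add_one [Finite α] (u : α) :
    Nat.card ({u}ᶜ : Set α) + 1 = Nat.card α := by
  rw [Nat.card_coe_set_eq, ← Set.ncard_singleton u, add_comm, Set.ncard_add_ncard_compl]

/-- Induction on finite acyclic graphs: it suffices to treat edgeless graphs and to add leaves,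
which can be taken different from a given root. -/
theorem IsAcyclic.leaf_induction {P : ∀ {α : Type}, SimpleGraph α → α → Prop}
    (bot : ∀ (α : Type) [Finite α] (r : α), P (⊥ : SimpleGraph α) r)
    (leaf : ∀ (α : Type) [Finite α] (F : SimpleGraph α) (r u w : α), F.IsAcyclic →
      (hr : r ≠ u) → F.Adj u w → (∀ x, F.Adj u x → x = w) → P (F.induce {u}ᶜ) ⟨r, hr⟩ → P F r)
    [Finite α] (hF : F.IsAcyclic) (r : α) : P F r := by
  obtain ⟨n, hn⟩ : ∃ n, Nat.card α = n := ⟨_, rfl⟩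
  induction n generalizing α with
  | zero =>
    have := Nat.card_pos_iff.2 ⟨⟨r⟩, ‹Finite α›⟩
    lia
  | succ n ih =>
    by_cases h : ∃ a b, F.Adj a b
    · obtain ⟨a, b, hab⟩ := h
      obtain ⟨u, w, hur, huw, hleaf⟩ := hF.exists_leaf_ne r hab
      refine leaf α F r u w hF hur.symm huw hleaf (ih (hF.induce _) _ ?_)
      have := card_compl_singleton_add_one u
      lia
    · obtain rfl : F = ⊥ := by
        ext a b
        simpa using fun hab => h ⟨a, b, hab⟩
      exact bot α r

theorem IsAcyclic.edgeCount_add_numComponents [Finite α] (hF : F.IsAcyclic) :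
    edgeCount F + numComponents F = Nat.card α := by
  cases isEmpty_or_nonempty α with
  | inl h =>
    obtain rfl : F = ⊥ := Subsingleton.elim _ _
    rw [edgeCount_bot, numComponents_bot, zero_add]
  | inr h =>
    refine hF.leaf_induction
      (P := fun {α} F _ => edgeCount F + numComponents F = Nat.card α) ?_ ?_ h.some
    · intro α _ _
      rw [edgeCount_bot, numComponents_bot, zero_add]
    · intro α _ F r u w _ hr huw hleaf ih
      have h1 := numComponents_induce_compl_leaf huw hleaf
      have h2 := edgeCount_induce_compl_leaf huw hleaf
      have h3 := card_compl_singleton_add_one u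
      lia

theorem IsAcyclic.homDensity_eq [Finite α] (hF : F.IsAcyclic) (d : ℝ) :
    homDensity F G d =
      (homCount F G : ℝ) / ((Nat.card β : ℝ) ^ numComponents F * d ^ edgeCount F) := by
  rw [homDensity, ← hF.edgeCount_add_numComponents, Nat.add_sub_cancel]

theorem mul_card_rooted_hom_bot_le [Finite α] [Finite β] (r : α) (x : β) :
    Nat.card β * Nat.card {f : (⊥ : SimpleGraph α) →g G // f r = x} ≤
      Nat.card β ^ Nat.card α := by
  classical
  rw [← Nat.card_fun, ← Nat.card_prod]
  refine Nat.card_le_card_of_injective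
    (fun p : β × {f : (⊥ : SimpleGraph α) →g G // f r = x} => Function.update p.2.1 r p.1) ?_
  rintro ⟨y, f, hf⟩ ⟨z, g, hg⟩ h
  have hval : ∀ a, Function.update f r y a = Function.update g r z a := congrFun h
  have hyz : y = z := by simpa using hval r
  have hfg : f = g := by
    ext a
    by_cases ha : a = r
    · rw [ha, hf, hg]
    · simpa [ha] using hval a
  subst hyz hfg
  rfl

/-- A bound on the number of homomorphisms from a forest mapping a given root to a given
vertex. -/
theorem IsAcyclic.mul_card_rooted_hom_le [Finite α] [Finite β] {d : ℝ} (hF : F.IsAcyclic)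
    (hG : Admissible G d) (r : α) (x : β) :
    (Nat.card β : ℝ) * Nat.card {f : F →g G // f r = x} ≤
      (Nat.card β : ℝ) ^ numComponents F * d ^ edgeCount F := by
  have := Fintype.ofFinite β
  refine hF.leaf_induction (P := fun {α} F r =>
    (Nat.card β : ℝ) * Nat.card {f : F →g G // f r = x} ≤
      (Nat.card β : ℝ) ^ numComponents F * d ^ edgeCount F) ?_ ?_ r
  · intro α _ r
    rw [edgeCount_bot, numComponents_bot, pow_zero, mul_one]
    exact_mod_cast mul_card_rooted_hom_bot_le (G := G) r x
  · intro α _ F r u w _ hr huw hleaf ih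
    have hd : 0 ≤ d := zero_le_one.trans hG.1
    have := Fintype.ofFinite {φ : F.induce {u}ᶜ →g G // φ ⟨r, hr⟩ = x}
    have e : {f : F →g G // f r = x} ≃
        Σ φ : {φ : F.induce {u}ᶜ →g G // φ ⟨r, hr⟩ = x}, G.neighborSet (φ.1 ⟨w, huw.ne'⟩) :=
      ((homLeafEquiv huw hleaf).subtypeEquiv fun _ => Iff.rfl).trans
        (Equiv.subtypeSigmaEquiv (fun φ : F.induce {u}ᶜ →g G => G.neighborSet (φ ⟨w, huw.ne'⟩))
          fun φ => φ ⟨r, hr⟩ = x)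
    have hle : (Nat.card {f : F →g G // f r = x} : ℝ) ≤
        Nat.card {φ : F.induce {u}ᶜ →g G // φ ⟨r, hr⟩ = x} * d := by
      rw [Nat.card_congr e, Nat.card_sigma, Nat.cast_sum]
      refine (Finset.sum_le_card_nsmul _ _ d fun φ _ => hG.2 _).trans_eq ?_
      rw [nsmul_eq_mul, Finset.card_univ, Nat.card_eq_fintype_card]
    rw [← numComponents_induce_compl_leaf huw hleaf, edgeCount_induce_compl_leaf huw hleaf,
      pow_succ, ← mul_assoc]
    calc _ ≤ (Nat.card β : ℝ) * (Nat.card {φ : F.induce {u}ᶜ →g G // φ ⟨r, hr⟩ = x} * d) := by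
          gcongr
      _ ≤ _ := by
          rw [← mul_assoc]
          gcongr

/-- The average distance of the normalized degree from `a`. -/
noncomputable def meanDegreeDeviation [Fintype β] (G : SimpleGraph β) (d a : ℝ) : ℝ :=
  (∑ x, |(vdegree G x : ℝ) / d - a|) / Nat.card β

theorem homCount_bot [Finite α] [Finite β] :
    homCount (⊥ : SimpleGraph α) G = Nat.card β ^ Nat.card α := by
  rw [homCount, ← Nat.card_fun]
  exact Nat.card_congr ⟨fun f => f, fun f => ⟨f, fun h => h.elim⟩, fun _ => rfl, fun _ => rfl⟩

/-- Adding a leaf to a forest multiplies the homomorphism density by approximately `a`. -/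
theorem IsAcyclic.abs_homDensity_sub_le [Finite α] [Fintype β] [Nonempty β] {d : ℝ}
    (hF : F.IsAcyclic) (hG : Admissible G d) (a : ℝ) {u w : α} (huw : F.Adj u w)
    (hleaf : ∀ x, F.Adj u x → x = w) :
    |homDensity F G d - a * homDensity (F.induce {u}ᶜ) G d| ≤ meanDegreeDeviation G d a := by
  classical
  set F' := F.induce {u}ᶜ with hF'_def
  have hF' : F'.IsAcyclic := hF.induce _
  set w' : ({u}ᶜ : Set α) := ⟨w, huw.ne'⟩
  have hd : 0 < d := zero_lt_one.trans_le hG.1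
  have hv : (0 : ℝ) < Nat.card β := by exact_mod_cast Nat.card_pos
  have := Fintype.ofFinite (F' →g G)
  have hcount : (homCount F G : ℝ) = ∑ φ : F' →g G, (vdegree G (φ w') : ℝ) := by
    rw [homCount, Nat.card_congr (homLeafEquiv huw hleaf), Nat.card_sigma, Nat.cast_sum]
    rfl
  have hcount' : (homCount F' G : ℝ) = ∑ φ : F' →g G, (1 : ℝ) := by
    simp [homCount, Nat.card_eq_fintype_card]
  rw [hF.homDensity_eq, hF'.homDensity_eq, edgeCount_induce_compl_leaf huw hleaf,
    ← numComponents_induce_compl_leaf huw hleaf, ← hF'_def]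
  set D : ℝ := (Nat.card β : ℝ) ^ numComponents F' * d ^ edgeCount F'
  have hD : 0 < D := by positivity
  have hrw : (homCount F G : ℝ) / ((Nat.card β : ℝ) ^ numComponents F' * d ^ (edgeCount F' + 1)) -
      a * ((homCount F' G : ℝ) / D) = (∑ φ : F' →g G, ((vdegree G (φ w') : ℝ) / d - a)) / D := by
    rw [Finset.sum_sub_distrib, ← Finset.sum_div, ← hcount]
    have : ∑ φ : F' →g G, a = a * homCount F' G := by rw [hcount', Finset.mul_sum, mul_one]
    rw [this, pow_succ, ← mul_assoc]
    change _ / (D * d) - _ = _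
    field_simp
  rw [hrw, abs_div, abs_of_pos hD, meanDegreeDeviation, div_le_div_iff₀ hD hv]
  calc |∑ φ : F' →g G, ((vdegree G (φ w') : ℝ) / d - a)| * Nat.card β
      ≤ (∑ φ : F' →g G, |(vdegree G (φ w') : ℝ) / d - a|) * Nat.card β := by
        gcongr
        exact Finset.abs_sum_le_sum_abs _ _
    _ = ∑ x, Nat.card β * Nat.card {φ : F' →g G // φ w' = x} *
          |(vdegree G x : ℝ) / d - a| := by
        rw [← Finset.sum_fiberwise Finset.univ (fun φ : F' →g G => φ w'), Finset.sum_mul]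
        refine Finset.sum_congr rfl fun x _ => ?_
        rw [Finset.sum_congr rfl (g := fun _ => |(vdegree G x : ℝ) / d - a|), Finset.sum_const,
          nsmul_eq_mul, Nat.subtype_card (Finset.univ.filter fun φ : F' →g G => φ w' = x)
            fun φ => by rw [Finset.mem_filter_univ]]
        · ring
        · intro φ hφ
          rw [(Finset.mem_filter.1 hφ).2]
    _ ≤ ∑ x, D * |(vdegree G x : ℝ) / d - a| := by
        gcongr with x
        exact hF'.mul_card_rooted_hom_le hG w' x
    _ = _ := by rw [← Finset.mul_sum, mul_comm]

theorem homDensity_bot [Finite α] [Finite β] [Nonempty β] (d : ℝ) :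
    homDensity (⊥ : SimpleGraph α) G d = 1 := by
  have hv : (Nat.card β : ℝ) ≠ 0 := by exact_mod_cast Nat.card_pos.ne'
  rw [homDensity, homCount_bot, numComponents_bot, Nat.sub_self, pow_zero, mul_one, Nat.cast_pow,
    div_self (pow_ne_zero _ hv)]

theorem homCount_top_fin_two [Fintype β] :
    homCount (⊤ : SimpleGraph (Fin 2)) G = ∑ x, vdegree G x := by
  have e : ((⊤ : SimpleGraph (Fin 2)) →g G) ≃ Σ x, G.neighborSet x :=
    { toFun := fun f => ⟨f 0, f 1, f.map_adj (by simp)⟩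
      invFun := fun p =>
        { toFun := ![p.1, p.2]
          map_rel' := by
            intro a b hab
            have h : G.Adj p.1 p.2 := p.2.2
            fin_cases a <;> fin_cases b
            exacts [(hab.ne rfl).elim, h, h.symm, (hab.ne rfl).elim] }
      left_inv := fun f => by
        ext x
        fin_cases x <;> rfl
      right_inv := fun p => rfl }
  rw [homCount, Nat.card_congr e, Nat.card_sigma]
  rfl

theorem homCount_pathGraph_three [Fintype β] :
    homCount (pathGraph 3) G = ∑ x, vdegree G x ^ 2 := by
  have e : (pathGraph 3 →g G) ≃ Σ x, G.neighborSet x × G.neighborSet x :=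
    { toFun := fun f => ⟨f 1, ⟨f 0, f.map_adj (by simp [pathGraph_adj])⟩,
        ⟨f 2, f.map_adj (by simp [pathGraph_adj])⟩⟩
      invFun := fun p =>
        { toFun := ![p.2.1, p.1, p.2.2]
          map_rel' := by
            intro a b hab
            have h1 : G.Adj p.1 p.2.1 := p.2.1.2
            have h2 : G.Adj p.1 p.2.2 := p.2.2.2
            rw [pathGraph_adj] at hab
            fin_cases a <;> fin_cases b <;> simp at hab
            exacts [h1.symm, h1, h2, h2.symm] }
      left_inv := fun f => by
        ext x
        fin_cases x <;> rfl
      right_inv := fun p => rfl }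
  rw [homCount, Nat.card_congr e, Nat.card_sigma]
  refine Finset.sum_congr rfl fun x _ => ?_
  rw [Nat.card_prod, sq]
  rfl

theorem Connected.numComponents_eq_one (hF : F.Connected) : numComponents F = 1 := by
  have := hF.preconnected.subsingleton_connectedComponent
  have := hF.nonempty
  exact Nat.card_eq_one_iff_unique.2 ⟨inferInstance, inferInstance⟩

theorem homDensity_top_fin_two [Fintype β] (d : ℝ) :
    homDensity (⊤ : SimpleGraph (Fin 2)) G d = (∑ x, (vdegree G x : ℝ) / d) / Nat.card β := by
  rw [homDensity, connected_top.numComponents_eq_one, homCount_top_fin_two, Nat.card_fin,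
    ← Finset.sum_div, div_div]
  push_cast
  ring_nf

theorem homDensity_pathGraph_three [Fintype β] (d : ℝ) :
    homDensity (pathGraph 3) G d = (∑ x, ((vdegree G x : ℝ) / d) ^ 2) / Nat.card β := by
  simp_rw [div_pow]
  rw [homDensity, (pathGraph_connected 2).numComponents_eq_one, homCount_pathGraph_three,
    Nat.card_fin, ← Finset.sum_div, div_div]
  push_cast
  ring_nf

theorem isAcyclic_pathGraph_three : (pathGraph 3).IsAcyclic := by
  have h : pathGraph 3 = starGraph 1 := by
    ext a b
    rw [pathGraph_adj]
    fin_cases a <;> fin_cases b <;> simp [starGraph_adj]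
  rw [h]
  exact isAcyclic_starGraph _

theorem edgeCount_pathGraph_three : edgeCount (pathGraph 3) = 2 := by
  have := isAcyclic_pathGraph_three.edgeCount_add_numComponents
  rw [(pathGraph_connected 2).numComponents_eq_one, Nat.card_fin] at this
  lia

theorem isAcyclic_top_fin_two : (⊤ : SimpleGraph (Fin 2)).IsAcyclic :=
  .of_card_le_two (by simp)

theorem edgeCount_top_fin_two : edgeCount (⊤ : SimpleGraph (Fin 2)) = 1 := by
  have := isAcyclic_top_fin_two.edgeCount_add_numComponents
  rw [connected_top.numComponents_eq_one, Nat.card_fin] at this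
  lia

/-- Splitting the vertices according to whether their normalized degree is within `ε` of `a`. -/
theorem meanDegreeDeviation_le [Fintype β] [Nonempty β] {d a ε : ℝ} (hG : Admissible G d)
    (ha0 : 0 ≤ a) (ha1 : a ≤ 1) (hε : 0 ≤ ε) :
    meanDegreeDeviation G d a ≤
      ε + (Nat.card {x : β // ε ≤ |(vdegree G x : ℝ) / d - a|} : ℝ) / Nat.card β := by
  classical
  have hv : (0 : ℝ) < Nat.card β := by exact_mod_cast Nat.card_pos
  have hd : 0 < d := zero_lt_one.trans_le hG.1
  rw [meanDegreeDeviation, div_le_iff₀ hv, add_mul, div_mul_cancel₀ _ hv.ne',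
    Nat.subtype_card (Finset.univ.filter fun x => ε ≤ |(vdegree G x : ℝ) / d - a|)
      fun x => by rw [Finset.mem_filter_univ], Finset.card_filter]
  have hpt : ∀ x, |(vdegree G x : ℝ) / d - a| ≤
      ε + ((if ε ≤ |(vdegree G x : ℝ) / d - a| then 1 else 0 : ℕ) : ℝ) := by
    intro x
    have h0 : 0 ≤ (vdegree G x : ℝ) / d := by positivity
    have h1 : (vdegree G x : ℝ) / d ≤ 1 := (div_le_one hd).2 (hG.2 x)
    split_ifs with h
    · have : |(vdegree G x : ℝ) / d - a| ≤ 1 := abs_le.2 ⟨by linarith, by linarith⟩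
      push_cast
      linarith
    · push_cast
      linarith
  refine (Finset.sum_le_sum fun x _ => hpt x).trans_eq ?_
  rw [Finset.sum_add_distrib, Finset.sum_const, Finset.card_univ, nsmul_eq_mul,
    Nat.card_eq_fintype_card, mul_comm]
  push_cast
  rfl

/-- Chebyshev's inequality for the normalized degrees, in terms of the densities of the edge and
of the path with two edges. -/
theorem card_degree_deviation_div_le [Fintype β] [Nonempty β] {d a ε : ℝ} (hε : 0 < ε) :
    (Nat.card {x : β // ε ≤ |(vdegree G x : ℝ) / d - a|} : ℝ) / Nat.card β ≤
      (homDensity (pathGraph 3) G d - 2 * a * homDensity (⊤ : SimpleGraph (Fin 2)) G d + a ^ 2) /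
        ε ^ 2 := by
  classical
  have hv : (0 : ℝ) < Nat.card β := by exact_mod_cast Nat.card_pos
  have hvar : homDensity (pathGraph 3) G d - 2 * a * homDensity (⊤ : SimpleGraph (Fin 2)) G d +
      a ^ 2 = (∑ x, ((vdegree G x : ℝ) / d - a) ^ 2) / Nat.card β := by
    have hconst : ∑ _x : β, a ^ 2 = Nat.card β * a ^ 2 := by
      rw [Finset.sum_const, Finset.card_univ, nsmul_eq_mul, Nat.card_eq_fintype_card]
    have hcross : ∑ x, 2 * ((vdegree G x : ℝ) / d) * a = 2 * a * ∑ x, (vdegree G x : ℝ) / d := by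
      rw [Finset.mul_sum]
      exact Finset.sum_congr rfl fun x _ => by ring
    simp_rw [homDensity_pathGraph_three, homDensity_top_fin_two, sub_sq]
    rw [Finset.sum_add_distrib, Finset.sum_sub_distrib, hconst, hcross]
    field_simp
  rw [hvar, div_div, mul_comm, ← div_div]
  gcongr
  rw [le_div_iff₀ (by positivity),
    Nat.subtype_card (Finset.univ.filter fun x => ε ≤ |(vdegree G x : ℝ) / d - a|)
      fun x => by rw [Finset.mem_filter_univ], ← nsmul_eq_mul]
  refine (Finset.card_nsmul_le_sum _ (fun x => ((vdegree G x : ℝ) / d - a) ^ 2) _ ?_).trans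
    (Finset.sum_le_sum_of_subset_of_nonneg (Finset.filter_subset _ _) fun x _ _ => sq_nonneg _)
  intro x hx
  rw [← sq_abs ((vdegree G x : ℝ) / d - a)]
  have := (Finset.mem_filter.1 hx).2
  gcongr

end SimpleGraph

section AlphaRegular

open SimpleGraph

variable {V : ℕ → Type} [∀ n, Fintype (V n)] [∀ n, Nonempty (V n)] {G : ∀ n, SimpleGraph (V n)}
  {d : ℕ → ℝ} {α : ℝ}

theorem AlphaRegular.tendsto_meanDegreeDeviation (h : AlphaRegular V G d α) (hα0 : 0 ≤ α)
    (hα1 : α ≤ 1) (hadm : ∀ n, Admissible (G n) (d n)) :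
    Tendsto (fun n => meanDegreeDeviation (G n) (d n) α) atTop (𝓝 0) := by
  rw [Metric.tendsto_atTop']
  intro ε hε
  obtain ⟨N, hN⟩ := Metric.tendsto_atTop'.1 (h (ε / 2) (half_pos hε)) (ε / 2) (half_pos hε)
  refine ⟨N, fun n hn => ?_⟩
  have h0 : 0 ≤ meanDegreeDeviation (G n) (d n) α := by
    unfold meanDegreeDeviation
    positivity
  have h1 := meanDegreeDeviation_le (hadm n) hα0 hα1 (half_pos hε).le
  have h2 := (le_abs_self _).trans_lt ((Real.dist_0_eq_abs _).symm.trans_lt (hN n hn))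
  rw [Real.dist_0_eq_abs, abs_of_nonneg h0]
  linarith

theorem AlphaRegular.tendsto_homDensity (h : AlphaRegular V G d α) (hα0 : 0 ≤ α) (hα1 : α ≤ 1)
    (hadm : ∀ n, Admissible (G n) (d n)) {β : Type} [Finite β] {F : SimpleGraph β}
    (hF : F.IsAcyclic) :
    Tendsto (fun n => homDensity F (G n) (d n)) atTop (𝓝 (α ^ edgeCount F)) := by
  cases isEmpty_or_nonempty β with
  | inl hβ =>
    obtain rfl : F = ⊥ := Subsingleton.elim _ _
    simp [homDensity_bot, edgeCount_bot]
  | inr hβ =>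
    refine hF.leaf_induction (P := fun {β} F _ =>
      Tendsto (fun n => homDensity F (G n) (d n)) atTop (𝓝 (α ^ edgeCount F))) ?_ ?_ hβ.some
    · intro β _ _
      simp [homDensity_bot, edgeCount_bot]
    · intro β _ F r u w hF hr huw hleaf ih
      have hdiff : Tendsto (fun n => homDensity F (G n) (d n) -
          α * homDensity (F.induce {u}ᶜ) (G n) (d n)) atTop (𝓝 0) := squeeze_zero_norm
        (fun n => hF.abs_homDensity_sub_le (hadm n) α huw hleaf)
        (h.tendsto_meanDegreeDeviation hα0 hα1 hadm)
      have := hdiff.add (ih.const_mul α)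
      rw [edgeCount_induce_compl_leaf huw hleaf, pow_succ']
      simpa using this

theorem alphaRegular_of_tendsto_homDensity
    (h2 : Tendsto (fun n => homDensity (⊤ : SimpleGraph (Fin 2)) (G n) (d n)) atTop (𝓝 α))
    (h3 : Tendsto (fun n => homDensity (pathGraph 3) (G n) (d n)) atTop (𝓝 (α ^ 2))) :
    AlphaRegular V G d α := by
  intro ε hε
  refine squeeze_zero (fun n => by positivity) (fun n => card_degree_deviation_div_le hε) ?_
  have := ((h3.sub (h2.const_mul (2 * α))).add_const (α ^ 2)).div_const (ε ^ 2)
  convert this using 2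
  ring

end AlphaRegular

/-- For `0 ≤ α ≤ 1` and a sequence of admissible pairs `(Gₙ,dₙ)`,
the following are equivalent: (a) the sequence is `α`-regular; (b) `t(K₂,Gₙ,dₙ) → α` and
`t(P₃,Gₙ,dₙ) → α²`; (c) `t(F,Gₙ,dₙ) → α^{e(F)}` for every forest `F`. -/
theorem stmt5 (V : ℕ → Type) [∀ n, Fintype (V n)] [∀ n, Nonempty (V n)]
    (G : ∀ n, SimpleGraph (V n)) (d : ℕ → ℝ) (α : ℝ) (hα0 : 0 ≤ α) (hα1 : α ≤ 1)
    (hadm : ∀ n, Admissible (G n) (d n)) :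
    (AlphaRegular V G d α ↔
      (Tendsto (fun n => homDensity (⊤ : SimpleGraph (Fin 2)) (G n) (d n)) atTop (𝓝 α) ∧
        Tendsto (fun n => homDensity (SimpleGraph.pathGraph 3) (G n) (d n)) atTop (𝓝 (α ^ 2)))) ∧
    (AlphaRegular V G d α ↔
      ∀ (k : ℕ) (F : SimpleGraph (Fin k)), F.IsAcyclic →
        Tendsto (fun n => homDensity F (G n) (d n)) atTop (𝓝 (α ^ edgeCount F))) := by
  have hac := fun (h : AlphaRegular V G d α) (k : ℕ) (F : SimpleGraph (Fin k))
    (hF : F.IsAcyclic) => h.tendsto_homDensity hα0 hα1 hadm hF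
  have hcb : (∀ (k : ℕ) (F : SimpleGraph (Fin k)), F.IsAcyclic →
      Tendsto (fun n => homDensity F (G n) (d n)) atTop (𝓝 (α ^ edgeCount F))) →
      Tendsto (fun n => homDensity (⊤ : SimpleGraph (Fin 2)) (G n) (d n)) atTop (𝓝 α) ∧
        Tendsto (fun n => homDensity (SimpleGraph.pathGraph 3) (G n) (d n)) atTop
          (𝓝 (α ^ 2)) := by
    intro h
    have h2 := h 2 _ SimpleGraph.isAcyclic_top_fin_two
    have h3 := h 3 _ SimpleGraph.isAcyclic_pathGraph_three
    rw [SimpleGraph.edgeCount_top_fin_two, pow_one] at h2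
    rw [SimpleGraph.edgeCount_pathGraph_three] at h3
    exact ⟨h2, h3⟩
  have hba := fun h : Tendsto (fun n => homDensity (⊤ : SimpleGraph (Fin 2)) (G n) (d n)) atTop
      (𝓝 α) ∧ Tendsto (fun n => homDensity (SimpleGraph.pathGraph 3) (G n) (d n)) atTop
        (𝓝 (α ^ 2)) => alphaRegular_of_tendsto_homDensity h.1 h.2
  exact ⟨⟨fun h => hcb (hac h), hba⟩, ⟨hac, fun h => hba (hcb h)⟩⟩
end

section
/- Let (G_n,d_n) be a sequence of admissible pairs with v(G_n) ≥ 1 for all n. The following are equivalent: (a) the sequence (G_n,d_n) is 1-regular; (b) the average degree in G_n is asymptotically d_n, i.e., 2e(G_n)/(v(G_n)·d_n) → 1; (c) t(K_2, G_n, d_n) → 1 as n → ∞, where K_2 is a single edge; (d) for every forest F, t(F, G_n, d_n) → 1 as n → ∞. -/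
open Filter Topology

section Forest

variable {α : Type*}

/-- Graphs obtained from the empty graph by successively attaching `e` edges, each of which
has an endpoint that was isolated before. -/
inductive ForestBuild : ℕ → SimpleGraph α → Prop
  | bot : ForestBuild 0 ⊥
  | leaf {e : ℕ} {F : SimpleGraph α} {u v : α} (hF : ForestBuild e F) (huv : u ≠ v)
      (hv : ∀ w, ¬ F.Adj v w) : ForestBuild (e + 1) (F ⊔ SimpleGraph.edge u v)

theorem SimpleGraph.IsAcyclic.exists_leaf [Finite α] {F : SimpleGraph α} (hF : F.IsAcyclic)
    (hne : F ≠ ⊥) : ∃ u v, F.Adj v u ∧ ∀ w, F.Adj v w → w = u := by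
  obtain ⟨a, b, hab⟩ := SimpleGraph.ne_bot_iff_exists_adj.1 hne
  have : Nonempty α := ⟨a⟩
  obtain ⟨u, v, p, hp, hmax⟩ := SimpleGraph.Walk.exists_isPath_forall_isPath_length_le_length F
  have hlen : 1 ≤ p.length := by
    simpa using hmax a b hab.toWalk (by simp [hab.ne])
  have hnil : ¬ p.Nil := by
    intro h
    have := SimpleGraph.Walk.length_eq_zero_iff.2 h
    omega
  refine ⟨_, v, (p.adj_penultimate hnil).symm, fun w hadj ↦ ?_⟩
  apply hF.eq_penultimate_of_adj_end hp hadj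
  by_contra hw
  have := hmax _ _ _ (hp.concat hw hadj)
  simp at this

theorem SimpleGraph.IsAcyclic.exists_forestBuild [Finite α] {F : SimpleGraph α}
    (hF : F.IsAcyclic) : ∃ e, ForestBuild e F := by
  induction F using WellFoundedLT.induction with
  | ind F ih =>
    by_cases hne : F = ⊥
    · exact ⟨0, hne ▸ .bot⟩
    obtain ⟨u, v, huv, hleaf⟩ := hF.exists_leaf hne
    have hlt : F.deleteIncidenceSet v < F := by
      refine lt_of_le_of_ne (F.deleteIncidenceSet_le v) fun h => ?_
      rw [← h, SimpleGraph.deleteIncidenceSet_adj] at huv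
      exact huv.2.1 rfl
    obtain ⟨e, he⟩ := ih _ hlt (hF.anti hlt.le)
    have hEq : F.deleteIncidenceSet v ⊔ SimpleGraph.edge u v = F := by
      ext a b
      simp only [SimpleGraph.sup_adj, SimpleGraph.deleteIncidenceSet_adj, SimpleGraph.edge_adj]
      constructor
      · rintro (h | ⟨⟨rfl, rfl⟩ | ⟨rfl, rfl⟩, -⟩)
        exacts [h.1, huv.symm, huv]
      · intro h
        by_cases ha : a = v
        · subst ha
          exact .inr ⟨.inr ⟨rfl, hleaf _ h⟩, h.ne⟩
        by_cases hb : b = v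
        · subst hb
          exact .inr ⟨.inl ⟨hleaf _ h.symm, rfl⟩, h.ne⟩
        exact .inl ⟨h, ha, hb⟩
    exact ⟨e + 1, hEq ▸ he.leaf huv.ne' fun w hw => (SimpleGraph.deleteIncidenceSet_adj.1 hw).2.1 rfl⟩

theorem numComponents_sup_edge [Finite α] {F : SimpleGraph α} {u v : α} (huv : u ≠ v)
    (hv : ∀ w, ¬ F.Adj v w) :
    numComponents (F ⊔ SimpleGraph.edge u v) + 1 = numComponents F := by
  classical
  set F' := F ⊔ SimpleGraph.edge u v
  have hiso : ∀ w, F.Reachable v w → v = w := by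
    rintro w ⟨p⟩
    cases p with
    | nil => rfl
    | cons h _ => exact (hv _ h).elim
  have huv' : F'.Reachable u v := by
    refine SimpleGraph.Adj.reachable (.inr ?_)
    simp [SimpleGraph.edge_adj, huv]
  let r : α → F.ConnectedComponent := fun w =>
    if w = v then F.connectedComponentMk u else F.connectedComponentMk w
  have hr_adj : ∀ a b, F'.Adj a b → r a = r b := by
    rintro a b (h | h)
    · have ha : a ≠ v := by rintro rfl; exact hv _ h
      have hb : b ≠ v := by rintro rfl; exact hv _ h.symm
      simpa [r, ha, hb] using h.reachable
    · rcases (SimpleGraph.edge_adj ..).1 h with ⟨⟨rfl, rfl⟩ | ⟨rfl, rfl⟩, -⟩ <;> simp [r]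
  have hr_walk : ∀ a b, F'.Walk a b → r a = r b := by
    intro a b p
    induction p with
    | nil => rfl
    | cons h _ ih => exact (hr_adj _ _ h).trans ih
  let ρ : F'.ConnectedComponent → F.ConnectedComponent :=
    SimpleGraph.ConnectedComponent.lift r fun a b p _ => hr_walk a b p
  have hinj : Function.Injective ρ := by
    intro c c'
    refine SimpleGraph.ConnectedComponent.ind₂ (fun a b h => ?_) c c'
    have key : ∀ a, ∃ a', r a = F.connectedComponentMk a' ∧ F'.Reachable a a' := by
      intro a
      by_cases ha : a = v
      · exact ⟨u, by simp [r, ha], ha ▸ huv'.symm⟩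
      · exact ⟨a, by simp [r, ha], .rfl⟩
    obtain ⟨a', ha, ha'⟩ := key a
    obtain ⟨b', hb, hb'⟩ := key b
    have hab : F.connectedComponentMk a' = F.connectedComponentMk b' := ha ▸ hb ▸ h
    have hab' := (SimpleGraph.ConnectedComponent.exact hab).mono (le_sup_left : F ≤ F')
    exact SimpleGraph.ConnectedComponent.sound ((ha'.trans hab').trans hb'.symm)
  have hrange : Set.range ρ = {F.connectedComponentMk v}ᶜ := by
    ext c
    refine SimpleGraph.ConnectedComponent.ind (fun w => ?_) c
    simp only [Set.mem_range, Set.mem_compl_iff, Set.mem_singleton_iff]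
    constructor
    · rintro ⟨c', hc'⟩ h
      rw [h] at hc'
      revert hc'
      refine SimpleGraph.ConnectedComponent.ind (fun a => ?_) c'
      intro hc'
      change r a = _ at hc'
      by_cases ha : a = v
      · simp only [r, ha, if_true] at hc'
        exact huv (hiso _ (SimpleGraph.ConnectedComponent.exact hc').symm).symm
      · simp only [r, ha, if_false] at hc'
        exact ha (hiso _ (SimpleGraph.ConnectedComponent.exact hc').symm).symm
    · intro h
      have hw : w ≠ v := by rintro rfl; exact h rfl
      exact ⟨F'.connectedComponentMk w, by simp [ρ, r, hw]⟩
  have hcard := Set.ncard_range_of_injective hinj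
  rw [hrange] at hcard
  have hcompl := Set.ncard_add_ncard_compl ({F.connectedComponentMk v} : Set _)
  rw [Set.ncard_singleton, hcard] at hcompl
  unfold numComponents
  omega

theorem ForestBuild.add_numComponents [Finite α] {e : ℕ} {F : SimpleGraph α}
    (h : ForestBuild e F) : e + numComponents F = Nat.card α := by
  induction h with
  | bot =>
    rw [zero_add]
    refine (Nat.card_eq_of_bijective (⊥ : SimpleGraph α).connectedComponentMk ⟨fun a b h => ?_,
      fun c => c.exists_rep⟩).symm
    simpa using SimpleGraph.ConnectedComponent.exact h
  | leaf hF huv hv ih =>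
    have := numComponents_sup_edge huv hv
    omega

end Forest

theorem card_mul_sum_eq_sum_sum_update {α β : Type*} [Fintype β] [DecidableEq α]
    {H : Finset (α → β)} {v : α}
    (hH : ∀ φ ∈ H, ∀ y, Function.update φ v y ∈ H) (f : (α → β) → ℝ) :
    (Fintype.card β : ℝ) * ∑ φ ∈ H, f φ = ∑ φ ∈ H, ∑ y, f (Function.update φ v y) := by
  have : ∑ φ ∈ H, ∑ y, f (Function.update φ v y) = ∑ φ ∈ H, ∑ _y : β, f φ := by
    rw [← Finset.sum_product', ← Finset.sum_product']
    refine Finset.sum_nbij' (fun p => (Function.update p.1 v p.2, p.1 v))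
      (fun p => (Function.update p.1 v p.2, p.1 v)) ?_ ?_ ?_ ?_ ?_
    all_goals simp +contextual [hH]
  rw [this]
  simp [Finset.mul_sum]

section HomSums

variable {α β : Type*} [Fintype α] [Fintype β]

open Classical in
/-- The homomorphisms from `F` to `G`, as a finite set of maps. -/
noncomputable def homFinset (F : SimpleGraph α) (G : SimpleGraph β) : Finset (α → β) :=
  {φ | ∀ a b, F.Adj a b → G.Adj (φ a) (φ b)}

theorem mem_homFinset {F : SimpleGraph α} {G : SimpleGraph β} {φ : α → β} :
    φ ∈ homFinset F G ↔ ∀ a b, F.Adj a b → G.Adj (φ a) (φ b) := by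
  simp [homFinset]

theorem homCount_eq_card_homFinset (F : SimpleGraph α) (G : SimpleGraph β) :
    homCount F G = (homFinset F G).card := by
  rw [homCount, ← Nat.card_eq_finsetCard]
  exact Nat.card_congr
    { toFun := fun φ => ⟨φ, mem_homFinset.2 fun _ _ h => φ.map_rel h⟩
      invFun := fun φ => ⟨φ.1, fun {_ _} h => mem_homFinset.1 φ.2 _ _ h⟩
      left_inv := fun _ => rfl
      right_inv := fun _ => rfl }

theorem vdegree_eq_sum [DecidableEq β] (G : SimpleGraph β) [DecidableRel G.Adj] (x : β) :
    (vdegree G x : ℝ) = ∑ y, if G.Adj x y then (1 : ℝ) else 0 := by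
  rw [vdegree, Nat.card_eq_fintype_card, SimpleGraph.card_neighborSet_eq_degree,
    Finset.sum_boole, ← SimpleGraph.card_neighborFinset_eq_degree, SimpleGraph.neighborFinset_eq_filter]

theorem card_mul_sum_homFinset_sup_edge [DecidableEq α] [DecidableEq β] {F : SimpleGraph α}
    (G : SimpleGraph β) [DecidableRel G.Adj] {u v : α} (huv : u ≠ v) (hv : ∀ w, ¬ F.Adj v w)
    (g : (α → β) → ℝ) :
    (Fintype.card β : ℝ) * ∑ φ ∈ homFinset (F ⊔ SimpleGraph.edge u v) G, g φ =
      ∑ φ ∈ homFinset F G, ∑ y, if G.Adj (φ u) y then g (Function.update φ v y) else 0 := by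
  have hfilter : homFinset (F ⊔ SimpleGraph.edge u v) G =
      (homFinset F G).filter fun φ => G.Adj (φ u) (φ v) := by
    ext φ
    simp only [mem_homFinset, Finset.mem_filter, SimpleGraph.sup_adj, SimpleGraph.edge_adj]
    constructor
    · exact fun h => ⟨fun a b hab => h a b (.inl hab), h u v (.inr ⟨.inl ⟨rfl, rfl⟩, huv⟩)⟩
    · rintro ⟨h, h'⟩ a b (hab | ⟨⟨rfl, rfl⟩ | ⟨rfl, rfl⟩, -⟩)
      exacts [h a b hab, h', h'.symm]
  rw [hfilter, Finset.sum_filter, card_mul_sum_eq_sum_sum_update (v := v)]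
  · simp [Function.update_of_ne huv]
  · intro φ hφ y
    rw [mem_homFinset] at hφ ⊢
    intro a b hab
    have ha : a ≠ v := by rintro rfl; exact hv _ hab
    have hb : b ≠ v := by rintro rfl; exact hv _ hab.symm
    simpa [ha, hb] using hφ a b hab

theorem homFinset_bot [DecidableEq α] (G : SimpleGraph β) : homFinset (⊥ : SimpleGraph α) G = Finset.univ := by
  ext; simp [mem_homFinset]

open Classical in
/-- Few homomorphisms from a forest send a prescribed vertex to a prescribed vertex. -/
theorem ForestBuild.sum_rooted_le {e : ℕ} {F : SimpleGraph α} (h : ForestBuild e F)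
    {G : SimpleGraph β} {d : ℝ} (hG : Admissible G d) (w : α) (x : β) :
    (∑ φ ∈ homFinset F G, if φ w = x then (1 : ℝ) else 0) * (Fintype.card β : ℝ) ^ (e + 1) ≤
      (Fintype.card β : ℝ) ^ Fintype.card α * d ^ e := by
  have hd : 0 ≤ d := zero_le_one.trans hG.1
  induction h generalizing w x with
  | bot =>
    rw [homFinset_bot, zero_add, pow_one, mul_comm,
      card_mul_sum_eq_sum_sum_update (v := w) (by simp)]
    simp
  | @leaf e F u v hF huv hv ih =>
    set N : ℝ := (Fintype.card β : ℝ)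
    suffices H : N * (∑ φ ∈ homFinset (F ⊔ SimpleGraph.edge u v) G,
        if φ w = x then (1 : ℝ) else 0) * N ^ (e + 1) ≤ d * (N ^ Fintype.card α * d ^ e) by
      calc _ = _ := ?_
        _ ≤ _ := H
        _ = _ := ?_
      all_goals ring
    rw [card_mul_sum_homFinset_sup_edge G huv hv]
    by_cases hw : w = v
    · subst hw
      simp only [Function.update_self]
      have hsum : (∑ φ ∈ homFinset F G, ∑ y, if G.Adj (φ u) y then (if y = x then (1 : ℝ) else 0)
          else 0) = ∑ y, if G.Adj x y then
            (∑ φ ∈ homFinset F G, if φ u = y then (1 : ℝ) else 0) else 0 := by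
        calc _ = ∑ φ ∈ homFinset F G, if G.Adj x (φ u) then (1 : ℝ) else 0 := by
              refine Finset.sum_congr rfl fun φ _ => ?_
              rw [Finset.sum_eq_single x] <;> simp +contextual [G.adj_comm]
          _ = ∑ φ ∈ homFinset F G, ∑ y, if φ u = y then (if G.Adj x y then (1 : ℝ) else 0)
                else 0 := by simp
          _ = _ := by
              rw [Finset.sum_comm]
              refine Finset.sum_congr rfl fun y _ => ?_
              split_ifs <;> simp
      rw [hsum, Finset.sum_mul]
      calc _ ≤ ∑ y, (if G.Adj x y then (1 : ℝ) else 0) * (N ^ Fintype.card α * d ^ e) := by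
            refine Finset.sum_le_sum fun y _ => ?_
            split_ifs
            · simpa using ih u y
            · simp
        _ = (vdegree G x : ℝ) * (N ^ Fintype.card α * d ^ e) := by
            rw [vdegree_eq_sum, Finset.sum_mul]
        _ ≤ _ := by gcongr; exact hG.2 x
    · simp only [Function.update_of_ne hw]
      have hsum : (∑ φ ∈ homFinset F G, ∑ y, if G.Adj (φ u) y then
          (if φ w = x then (1 : ℝ) else 0) else 0) ≤
          d * ∑ φ ∈ homFinset F G, if φ w = x then (1 : ℝ) else 0 := by
        rw [Finset.mul_sum]
        refine Finset.sum_le_sum fun φ _ => ?_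
        split_ifs
        · rw [← vdegree_eq_sum, mul_one]
          exact hG.2 _
        · simp
      calc _ ≤ (d * ∑ φ ∈ homFinset F G, if φ w = x then (1 : ℝ) else 0) * N ^ (e + 1) := by
            gcongr
        _ = d * ((∑ φ ∈ homFinset F G, if φ w = x then (1 : ℝ) else 0) * N ^ (e + 1)) := by ring
        _ ≤ _ := mul_le_mul_of_nonneg_left (ih w x) hd

theorem card_mul_card_homFinset_sup_edge {F : SimpleGraph α}
    (G : SimpleGraph β) {u v : α} (huv : u ≠ v) (hv : ∀ w, ¬ F.Adj v w) :
    (Fintype.card β : ℝ) * (homFinset (F ⊔ SimpleGraph.edge u v) G).card =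
      ∑ φ ∈ homFinset F G, (vdegree G (φ u) : ℝ) := by
  classical
  have := card_mul_sum_homFinset_sup_edge G huv hv (fun _ => 1)
  simpa [vdegree_eq_sum] using this

theorem ForestBuild.card_homFinset_le {e : ℕ} {F : SimpleGraph α} (h : ForestBuild e F)
    {G : SimpleGraph β} {d : ℝ} (hG : Admissible G d) :
    ((homFinset F G).card : ℝ) * (Fintype.card β : ℝ) ^ e ≤
      (Fintype.card β : ℝ) ^ Fintype.card α * d ^ e := by
  have hd : 0 ≤ d := zero_le_one.trans hG.1
  induction h with
  | bot =>
    classical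
    simp [homFinset_bot]
  | @leaf e F u v hF huv hv ih =>
    calc _ = (Fintype.card β * ((homFinset (F ⊔ SimpleGraph.edge u v) G).card : ℝ)) *
            (Fintype.card β : ℝ) ^ e := by ring
      _ ≤ (d * (homFinset F G).card) * (Fintype.card β : ℝ) ^ e := by
          refine mul_le_mul_of_nonneg_right ?_ (by positivity)
          rw [card_mul_card_homFinset_sup_edge G huv hv]
          refine (Finset.sum_le_card_nsmul _ _ d fun φ _ => hG.2 _).trans_eq ?_
          rw [nsmul_eq_mul, mul_comm]
      _ = d * ((homFinset F G).card * (Fintype.card β : ℝ) ^ e) := by ring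
      _ ≤ d * ((Fintype.card β : ℝ) ^ Fintype.card α * d ^ e) := by gcongr
      _ = _ := by ring

theorem ForestBuild.le_card_homFinset {e : ℕ} {F : SimpleGraph α} (h : ForestBuild e F)
    {G : SimpleGraph β} {d : ℝ} (hG : Admissible G d) {η : ℝ}
    (hη : ∑ x, (d - vdegree G x) ≤ Fintype.card β * d * η) [Nonempty β] :
    (Fintype.card β : ℝ) ^ Fintype.card α * d ^ e * (1 - e * η) ≤
      ((homFinset F G).card : ℝ) * (Fintype.card β : ℝ) ^ e := by
  classical
  have hd : 0 ≤ d := zero_le_one.trans hG.1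
  induction h with
  | bot => simp [homFinset_bot]
  | @leaf e F u v hF huv hv ih =>
    set N : ℝ := (Fintype.card β : ℝ)
    have hN : 0 < N := by simp [N, Fintype.card_pos]
    have hdef : ∑ φ ∈ homFinset F G, (d - vdegree G (φ u)) = ∑ x, (d - vdegree G x) *
        ∑ φ ∈ homFinset F G, if φ u = x then (1 : ℝ) else 0 := by
      simp only [Finset.mul_sum]
      rw [Finset.sum_comm]
      simp
    have hdef_le : (∑ φ ∈ homFinset F G, (d - vdegree G (φ u))) * N ^ e ≤
        d * (N ^ Fintype.card α * d ^ e) * η := by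
      refine le_of_mul_le_mul_right ?_ hN
      calc _ = ∑ x, (d - vdegree G x) *
            ((∑ φ ∈ homFinset F G, if φ u = x then (1 : ℝ) else 0) * N ^ (e + 1)) := by
            rw [hdef, mul_assoc, ← pow_succ, Finset.sum_mul]
            simp only [mul_assoc]
        _ ≤ ∑ x, (d - vdegree G x) * (N ^ Fintype.card α * d ^ e) := by
            refine Finset.sum_le_sum fun x _ => ?_
            exact mul_le_mul_of_nonneg_left (hF.sum_rooted_le hG u x) (sub_nonneg.2 (hG.2 x))
        _ = (∑ x, (d - vdegree G x)) * (N ^ Fintype.card α * d ^ e) := by rw [Finset.sum_mul]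
        _ ≤ (N * d * η) * (N ^ Fintype.card α * d ^ e) := by gcongr
        _ = _ := by ring
    have hstep := card_mul_card_homFinset_sup_edge G huv hv
    rw [Finset.sum_sub_distrib, Finset.sum_const, nsmul_eq_mul, ← hstep] at hdef_le
    have := mul_le_mul_of_nonneg_left ih hd
    push_cast
    calc _ = d * (N ^ Fintype.card α * d ^ e * (1 - e * η)) -
          d * (N ^ Fintype.card α * d ^ e) * η := by ring
      _ ≤ d * ((homFinset F G).card * N ^ e) - ((homFinset F G).card * d -
          N * (homFinset (F ⊔ SimpleGraph.edge u v) G).card) * N ^ e := by gcongr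
      _ = _ := by ring

/-- The average degree of `G`, divided by `d`. -/
noncomputable def normalizedDegree (G : SimpleGraph β) (d : ℝ) : ℝ :=
  (∑ x, (vdegree G x : ℝ)) / (Fintype.card β * d)

theorem homDensity_bounds [Nonempty β] {e : ℕ} {F : SimpleGraph α} (h : ForestBuild e F)
    {G : SimpleGraph β} {d : ℝ} (hG : Admissible G d) :
    1 - e * (1 - normalizedDegree G d) ≤ homDensity F G d ∧ homDensity F G d ≤ 1 := by
  have hd : 0 < d := zero_lt_one.trans_le hG.1
  have hN : (0 : ℝ) < Fintype.card β := by simp [Fintype.card_pos]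
  have hcomp := h.add_numComponents
  have hsub : Nat.card α - numComponents F = e := by omega
  rw [Nat.card_eq_fintype_card] at hcomp
  have hle := h.card_homFinset_le hG
  have hge := h.le_card_homFinset hG (η := 1 - normalizedDegree G d) (by
    rw [Finset.sum_sub_distrib, normalizedDegree]
    simp only [Finset.sum_const, Finset.card_univ, nsmul_eq_mul]
    field_simp
    exact le_rfl)
  rw [← hcomp, pow_add] at hle hge
  rw [homDensity, hsub, homCount_eq_card_homFinset, Nat.card_eq_fintype_card]
  have hNe : (0 : ℝ) < (Fintype.card β : ℝ) ^ e := pow_pos hN e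
  constructor
  · rw [le_div_iff₀ (by positivity)]
    refine le_of_mul_le_mul_right (le_of_eq_of_le ?_ hge) hNe
    ring
  · rw [div_le_one (by positivity)]
    refine le_of_mul_le_mul_right (hle.trans_eq ?_) hNe
    ring

theorem homDensity_top_fin_two [Nonempty β] (G : SimpleGraph β) (d : ℝ) :
    homDensity (⊤ : SimpleGraph (Fin 2)) G d = normalizedDegree G d := by
  have hN : (0 : ℝ) < Fintype.card β := by simp [Fintype.card_pos]
  have hedge : (⊥ ⊔ SimpleGraph.edge 0 1 : SimpleGraph (Fin 2)) = ⊤ := by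
    ext a b
    fin_cases a <;> fin_cases b <;> simp [SimpleGraph.edge_adj]
  have hbuild : ForestBuild 1 (⊤ : SimpleGraph (Fin 2)) :=
    hedge ▸ ForestBuild.bot.leaf (by decide) (by simp)
  have hcomp := hbuild.add_numComponents
  rw [Nat.card_eq_fintype_card, Fintype.card_fin] at hcomp
  have hnum : numComponents (⊤ : SimpleGraph (Fin 2)) = 1 := by omega
  have hstep := card_mul_card_homFinset_sup_edge G (F := (⊥ : SimpleGraph (Fin 2)))
    (u := 0) (v := 1) (by decide) (by simp)
  have hsum := card_mul_sum_eq_sum_sum_update (H := (Finset.univ : Finset (Fin 2 → β)))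
    (v := 0) (by simp) fun φ => (vdegree G (φ 0) : ℝ)
  rw [homFinset_bot, hedge] at hstep
  rw [← hstep] at hsum
  simp only [Function.update_self, Finset.sum_const, Finset.card_univ, Fintype.card_fun,
    Fintype.card_fin, nsmul_eq_mul, Nat.cast_pow] at hsum
  have hcard : ((homFinset (⊤ : SimpleGraph (Fin 2)) G).card : ℝ) = ∑ x, (vdegree G x : ℝ) := by
    refine mul_left_cancel₀ (pow_pos hN 2).ne' ?_
    rw [← hsum]
    ring
  simp [homDensity, hnum, homCount_eq_card_homFinset, hcard, normalizedDegree]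

theorem two_mul_edgeCount_div (G : SimpleGraph β) (d : ℝ) :
    2 * (edgeCount G : ℝ) / ((Nat.card β : ℝ) * d) = normalizedDegree G d := by
  classical
  have hdeg : ∀ x, vdegree G x = G.degree x := fun x => by
    rw [vdegree, Nat.card_eq_fintype_card, SimpleGraph.card_neighborSet_eq_degree]
  have hedge : edgeCount G = G.edgeFinset.card := by
    rw [edgeCount, Nat.card_eq_fintype_card, SimpleGraph.edgeFinset_card]
  have := G.sum_degrees_eq_twice_card_edges
  simp only [normalizedDegree, hdeg, hedge, Nat.card_eq_fintype_card]
  rw [← Nat.cast_sum, this]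
  push_cast
  rfl

theorem one_sub_normalizedDegree [Nonempty β] {G : SimpleGraph β} {d : ℝ}
    (hG : Admissible G d) :
    1 - normalizedDegree G d = (∑ x, |(vdegree G x : ℝ) / d - 1|) / Nat.card β := by
  have hd : 0 < d := zero_lt_one.trans_le hG.1
  have hN : (0 : ℝ) < Fintype.card β := by simp [Fintype.card_pos]
  have habs : ∀ x, |(vdegree G x : ℝ) / d - 1| = 1 - vdegree G x / d := fun x => by
    rw [abs_sub_comm, abs_of_nonneg (sub_nonneg.2 ((div_le_one hd).2 (hG.2 x)))]
  simp only [habs, Finset.sum_sub_distrib, ← Finset.sum_div, normalizedDegree,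
    Nat.card_eq_fintype_card, Finset.sum_const, Finset.card_univ, nsmul_eq_mul, mul_one]
  field_simp

theorem normalizedDegree_le_one [Nonempty β] {G : SimpleGraph β} {d : ℝ}
    (hG : Admissible G d) : normalizedDegree G d ≤ 1 := by
  have : 0 ≤ 1 - normalizedDegree G d := by
    rw [one_sub_normalizedDegree hG]
    positivity
  linarith

theorem card_irregular_div_le [Nonempty β] {G : SimpleGraph β} {d ε : ℝ}
    (hG : Admissible G d) (hε : 0 < ε) :
    (Nat.card {x : β // ε ≤ |(vdegree G x : ℝ) / d - 1|} : ℝ) / Nat.card β ≤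
      (1 - normalizedDegree G d) / ε := by
  classical
  rw [one_sub_normalizedDegree hG, div_right_comm]
  gcongr
  rw [le_div_iff₀ hε, Nat.card_eq_fintype_card, Fintype.card_subtype, ← nsmul_eq_mul]
  exact (Finset.card_nsmul_le_sum _ _ _ fun x hx => (Finset.mem_filter.1 hx).2).trans
    (Finset.sum_le_sum_of_subset_of_nonneg (Finset.filter_subset _ _) fun _ _ _ => abs_nonneg _)

theorem one_sub_normalizedDegree_le [Nonempty β] {G : SimpleGraph β} {d ε : ℝ}
    (hG : Admissible G d) (hε : 0 < ε) :
    1 - normalizedDegree G d ≤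
      ε + (Nat.card {x : β // ε ≤ |(vdegree G x : ℝ) / d - 1|} : ℝ) / Nat.card β := by
  classical
  have hd : 0 < d := zero_lt_one.trans_le hG.1
  have hN : (0 : ℝ) < Fintype.card β := by simp [Fintype.card_pos]
  rw [one_sub_normalizedDegree hG, Nat.card_eq_fintype_card (α := β), div_le_iff₀ hN, add_mul,
    div_mul_cancel₀ _ hN.ne', Nat.card_eq_fintype_card, Fintype.card_subtype, Finset.card_filter]
  push_cast
  calc _ ≤ ∑ x, (ε + if ε ≤ |(vdegree G x : ℝ) / d - 1| then (1 : ℝ) else 0) := by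
        refine Finset.sum_le_sum fun x _ => ?_
        split_ifs with h
        · have : (0 : ℝ) ≤ vdegree G x / d := by positivity
          have : |(vdegree G x : ℝ) / d - 1| ≤ 1 := by
            rw [abs_le]
            constructor <;> linarith [(div_le_one hd).2 (hG.2 x)]
          linarith
        · linarith
    _ = _ := by simp [Finset.sum_add_distrib, mul_comm]

end HomSums

theorem alphaRegular_one_iff_tendsto_normalizedDegree {V : ℕ → Type} [∀ n, Fintype (V n)]
    [∀ n, Nonempty (V n)] {G : ∀ n, SimpleGraph (V n)} {d : ℕ → ℝ}
    (hadm : ∀ n, Admissible (G n) (d n)) :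
    AlphaRegular V G d 1 ↔ Tendsto (fun n => normalizedDegree (G n) (d n)) atTop (𝓝 1) := by
  constructor
  · intro h
    rw [Metric.tendsto_atTop]
    intro ε hε
    obtain ⟨n₀, hn₀⟩ := Metric.tendsto_atTop.1 (h (ε / 2) (half_pos hε)) (ε / 2) (half_pos hε)
    refine ⟨n₀, fun n hn => ?_⟩
    have h₁ := (le_abs_self _).trans_lt (by simpa only [Real.dist_eq, sub_zero] using hn₀ n hn)
    have h₂ := one_sub_normalizedDegree_le (hadm n) (half_pos hε)
    rw [Real.dist_eq, abs_sub_comm,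
      abs_of_nonneg (sub_nonneg.2 (normalizedDegree_le_one (hadm n)))]
    linarith
  · intro h ε hε
    have h' : Tendsto (fun n => (1 - normalizedDegree (G n) (d n)) / ε) atTop (𝓝 0) := by
      simpa using (h.const_sub 1).div_const ε
    exact squeeze_zero (fun n => by positivity) (fun n => card_irregular_div_le (hadm n) hε) h'

theorem tendsto_homDensity_of_isAcyclic {V : ℕ → Type} [∀ n, Fintype (V n)]
    [∀ n, Nonempty (V n)] {G : ∀ n, SimpleGraph (V n)} {d : ℕ → ℝ}
    (hadm : ∀ n, Admissible (G n) (d n))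
    (h : Tendsto (fun n => normalizedDegree (G n) (d n)) atTop (𝓝 1))
    {α : Type*} [Fintype α] {F : SimpleGraph α} (hF : F.IsAcyclic) :
    Tendsto (fun n => homDensity F (G n) (d n)) atTop (𝓝 1) := by
  obtain ⟨e, he⟩ := hF.exists_forestBuild
  have hlow : Tendsto (fun n => 1 - e * (1 - normalizedDegree (G n) (d n))) atTop (𝓝 1) := by
    simpa using ((h.const_sub 1).const_mul (e : ℝ)).const_sub 1
  exact tendsto_of_tendsto_of_tendsto_of_le_of_le hlow tendsto_const_nhds
    (fun n => (homDensity_bounds he (hadm n)).1) (fun n => (homDensity_bounds he (hadm n)).2)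

/-- For a sequence of admissible pairs `(Gₙ,dₙ)`, the following are
equivalent: (a) the sequence is 1-regular; (b) the average degree of `Gₙ` is asymptotically
`dₙ`; (c) `t(K₂,Gₙ,dₙ) → 1`; (d) `t(F,Gₙ,dₙ) → 1` for every forest `F`. -/
theorem stmt6 (V : ℕ → Type) [∀ n, Fintype (V n)] [∀ n, Nonempty (V n)]
    (G : ∀ n, SimpleGraph (V n)) (d : ℕ → ℝ)
    (hadm : ∀ n, Admissible (G n) (d n)) :
    (AlphaRegular V G d 1 ↔
      Tendsto (fun n => 2 * (edgeCount (G n) : ℝ) / ((Nat.card (V n) : ℝ) * d n))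
        atTop (𝓝 1)) ∧
    (AlphaRegular V G d 1 ↔
      Tendsto (fun n => homDensity (⊤ : SimpleGraph (Fin 2)) (G n) (d n)) atTop (𝓝 1)) ∧
    (AlphaRegular V G d 1 ↔
      ∀ (k : ℕ) (F : SimpleGraph (Fin k)), F.IsAcyclic →
        Tendsto (fun n => homDensity F (G n) (d n)) atTop (𝓝 1)) := by
  have hreg := alphaRegular_one_iff_tendsto_normalizedDegree hadm
  simp only [two_mul_edgeCount_div, homDensity_top_fin_two]
  refine ⟨hreg, hreg, fun h k F hF => tendsto_homDensity_of_isAcyclic hadm (hreg.1 h) hF,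
    fun h => hreg.2 ?_⟩
  have htop := h 2 ⊤ (.of_card_le_two (by simp))
  simpa only [homDensity_top_fin_two] using htop
end

section
/- Let 0 ≤ α ≤ 1 and let (G_n,d_n) be a sequence of admissible pairs with v(G_n) ≥ 1, d_n > 1, and d_n → ∞, which is α-regular and has large essential girth. Then for every tree F, both t(F,G_n,d_n) → α^{e(F)} and t_inj(F,G_n,d_n) → α^{e(F)} as n → ∞, and for every connected graph F that contains a cycle, both t(F,G_n,d_n) → 0 and t_inj(F,G_n,d_n) → 0 as n → ∞. -/
open Filter Topology

/-- A sequence of admissible pairs `(Gₙ, dₙ)` has large essential girth. -/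
def LargeEssentialGirth (V : ℕ → Type) (G : ∀ n, SimpleGraph (V n)) (d : ℕ → ℝ) : Prop :=
  ∀ k : ℕ, 3 ≤ k →
    Tendsto (fun n => injDensity (SimpleGraph.cycleGraph k) (G n) (d n)) atTop (𝓝 0)

section Counting

variable {V W : Type} {G : SimpleGraph V} {F : SimpleGraph W} {d : ℝ}

theorem Nat.card_le_card_mul_of_fiber_card_le {A B : Type*} [Finite A] [Finite B] (f : A → B)
    {c : ℝ} (hc : ∀ b, (Nat.card {a // f a = b} : ℝ) ≤ c) :
    (Nat.card A : ℝ) ≤ Nat.card B * c := by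
  have := Fintype.ofFinite B
  rw [← Nat.card_congr (Equiv.sigmaFiberEquiv f), Nat.card_sigma, Nat.cast_sum]
  refine (Finset.sum_le_card_nsmul _ _ c fun b _ => hc b).trans ?_
  simp

instance SimpleGraph.Hom.finite_of_finite [Finite V] [Finite W] : Finite (F →g G) :=
  Finite.of_injective (fun φ : F →g G => (φ : W → V)) DFunLike.coe_injective

theorem SimpleGraph.Connected.exists_adj_mem_notMem (hF : F.Connected) {S : Set W}
    (hS : S.Nonempty) (hS' : S ≠ Set.univ) : ∃ a ∈ S, ∃ b ∉ S, F.Adj a b := by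
  obtain ⟨u, hu⟩ := hS
  obtain ⟨v, hv⟩ := (Set.ne_univ_iff_exists_notMem S).1 hS'
  obtain ⟨p⟩ := hF.preconnected u v
  obtain ⟨e, -, h1, h2⟩ := p.exists_boundary_dart S hu hv
  exact ⟨e.fst, h1, e.snd, h2, e.adj⟩

/-- In a graph of maximum degree at most `d`, a partial map defined on a nonempty set `S` of
vertices of a connected graph extends to at most `d ^ n` homomorphisms, where `n` is the number of
remaining vertices. -/
theorem card_hom_extending_le [Finite V] [Fintype W] (hF : F.Connected) (hd : Admissible G d)
    (n : ℕ) (S : Finset W) (hS : S.Nonempty) (hn : S.card + n = Fintype.card W) (ψ : W → V) :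
    (Nat.card {φ : F →g G // ∀ s ∈ S, φ s = ψ s} : ℝ) ≤ d ^ n := by
  classical
  have hd0 : 0 ≤ d := zero_le_one.trans hd.1
  induction n generalizing S ψ with
  | zero =>
    have hu : S = Finset.univ := (Finset.card_eq_iff_eq_univ S).1 hn
    have : Subsingleton {φ : F →g G // ∀ s ∈ S, φ s = ψ s} := by
      refine ⟨fun φ χ => Subtype.ext (DFunLike.ext _ _ fun w => ?_)⟩
      rw [φ.2 w (by simp [hu]), χ.2 w (by simp [hu])]
    simpa using Finite.card_le_one_iff_subsingleton.2 this
  | succ n ih =>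
    obtain ⟨a, ha, b, hb, hab⟩ := hF.exists_adj_mem_notMem (S := (S : Set W)) hS (by
      intro h
      have : S = Finset.univ := by simpa using h
      rw [this, Finset.card_univ] at hn
      omega)
    let f : {φ : F →g G // ∀ s ∈ S, φ s = ψ s} → G.neighborSet (ψ a) := fun φ =>
      ⟨φ.1 b, by
        rw [SimpleGraph.mem_neighborSet, ← φ.2 a ha]
        exact φ.1.map_adj hab⟩
    refine (Nat.card_le_card_mul_of_fiber_card_le f (c := d ^ n) fun y => ?_).trans ?_
    · refine le_trans ?_ (ih (insert b S) (Finset.insert_nonempty _ _) ?_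
        (Function.update ψ b y))
      · refine Nat.cast_le.2 (Nat.card_le_card_of_injective (fun φ => ⟨φ.1.1, ?_⟩) ?_)
        · intro s hs
          rcases Finset.mem_insert.1 hs with rfl | hs
          · rw [Function.update_self]; exact congrArg Subtype.val φ.2
          · rw [Function.update_of_ne (ne_of_mem_of_not_mem (Finset.mem_coe.2 hs) hb)]
            exact φ.1.2 s hs
        · intro φ χ h
          exact Subtype.ext (Subtype.ext (Subtype.mk.inj h))
      · rw [Finset.card_insert_of_notMem (by simpa using hb)]
        omega
    · rw [pow_succ']
      exact mul_le_mul_of_nonneg_right (hd.2 (ψ a)) (pow_nonneg hd0 n)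

theorem card_hom_apply_eq_le [Finite V] [Fintype W] (hF : F.Connected) (hd : Admissible G d)
    (w : W) (x : V) :
    (Nat.card {φ : F →g G // φ w = x} : ℝ) ≤ d ^ (Nat.card W - 1) := by
  have := hF.nonempty
  have h := card_hom_extending_le hF hd (Fintype.card W - 1) {w} (by simp)
    (by have := Fintype.card_pos (α := W); simp; omega) (fun _ => x)
  simpa using h

theorem homCount_le [Finite V] [Fintype W] (hF : F.Connected) (hd : Admissible G d) :
    (homCount F G : ℝ) ≤ Nat.card V * d ^ (Nat.card W - 1) := by
  obtain ⟨w⟩ := hF.nonempty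
  exact Nat.card_le_card_mul_of_fiber_card_le (fun φ : F →g G => φ w)
    fun x => card_hom_apply_eq_le hF hd w x

/-- The injective homomorphisms from `F` are at most those from a graph contained in `F`, times
the number of ways to place the remaining vertices. -/
theorem injCount_le_of_isContained [Finite V] [Fintype W] {U : Type} [Fintype U] [Nonempty U]
    {C : SimpleGraph U} (hF : F.Connected) (hd : Admissible G d) (i : C →g F)
    (hi : Function.Injective i) :
    (injCount F G : ℝ) ≤ injCount C G * d ^ (Nat.card W - Nat.card U) := by
  classical
  refine Nat.card_le_card_mul_of_fiber_card_le
    (A := {f : F →g G // Function.Injective f}) (B := {f : C →g G // Function.Injective f})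
    (fun φ => ⟨φ.1.comp i, by simpa using φ.2.comp hi⟩) fun χ => ?_
  have hcard : (Finset.univ.image i).card = Fintype.card U := by
    rw [Finset.card_image_of_injective _ hi, Finset.card_univ]
  refine le_trans ?_ (card_hom_extending_le hF hd (Nat.card W - Nat.card U) (Finset.univ.image i)
    (by simp) ?_ (fun w => χ.1 (Function.invFun i w)))
  · refine Nat.cast_le.2 (Nat.card_le_card_of_injective (fun φ => ⟨φ.1.1, ?_⟩) ?_)
    · intro s hs
      obtain ⟨u, -, rfl⟩ := Finset.mem_image.1 hs
      rw [Function.leftInverse_invFun hi u]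
      exact DFunLike.congr_fun (congrArg Subtype.val φ.2) u
    · intro φ χ h
      exact Subtype.ext (Subtype.ext (Subtype.mk.inj h))
  · have := Fintype.card_le_of_injective i hi
    rw [hcard, Nat.card_eq_fintype_card, Nat.card_eq_fintype_card]
    omega

theorem SimpleGraph.Connected.map_of_surjective {W' : Type} (hF : F.Connected) {r : W → W'}
    (hr : Function.Surjective r) : (F.map r).Connected := by
  have := hF.nonempty
  have : Nonempty W' := this.map r
  refine ⟨fun a b => ?_⟩
  obtain ⟨a, rfl⟩ := hr a
  obtain ⟨b, rfl⟩ := hr b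
  obtain ⟨p⟩ := hF.preconnected a b
  induction p with
  | nil => rfl
  | cons h p ih =>
    rename_i u v w
    refine SimpleGraph.Reachable.trans ?_ ih
    by_cases e : r u = r v
    · rw [e]
    · exact SimpleGraph.Adj.reachable ⟨e, u, v, h, rfl, rfl⟩

theorem mul_card_hom_apply_eq_apply_le [Finite V] [Fintype W] (hF : F.Connected)
    (hd : Admissible G d) {u v : W} (huv : u ≠ v) :
    d * (Nat.card {φ : F →g G // φ u = φ v} : ℝ) ≤ Nat.card V * d ^ (Nat.card W - 1) := by
  classical
  have hd0 : 0 ≤ d := zero_le_one.trans hd.1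
  let r : W → {w // w ≠ v} := fun w => if h : w = v then ⟨u, huv⟩ else ⟨w, h⟩
  have hr : Function.Surjective r := fun w => ⟨w, by simp [r, w.2]⟩
  have hr' : ∀ φ : F →g G, φ u = φ v → ∀ w, φ (r w) = φ w := by
    intro φ h w
    by_cases hw : w = v
    · simp [r, hw, h]
    · simp [r, hw]
  have h1 : Nat.card {φ : F →g G // φ u = φ v} ≤ homCount (F.map r) G := by
    refine Nat.card_le_card_of_injective
      (fun φ => ⟨fun w => φ.1 w, ?_⟩) ?_
    · rintro _ _ ⟨-, x, y, hxy, rfl, rfl⟩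
      rw [hr' φ.1 φ.2, hr' φ.1 φ.2]
      exact φ.1.map_adj hxy
    · intro φ χ h
      refine Subtype.ext (DFunLike.ext _ _ fun w => ?_)
      rw [← hr' φ.1 φ.2, ← hr' χ.1 χ.2]
      exact congrArg (fun f : F.map r →g G => f (r w)) h
  have h2 := homCount_le (hF.map_of_surjective hr) hd
  have hc : Nat.card {w // w ≠ v} = Nat.card W - 1 := by
    simp [Nat.card_eq_fintype_card, Fintype.card_subtype_compl]
  have hpos : 2 ≤ Nat.card W := by
    rw [Nat.card_eq_fintype_card]
    exact Fintype.one_lt_card_iff.2 ⟨u, v, huv⟩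
  obtain ⟨m, hm⟩ := Nat.exists_eq_add_of_le hpos
  rw [hc, hm, show 2 + m - 1 - 1 = m by omega] at h2
  rw [hm, show 2 + m - 1 = m + 1 by omega, pow_succ]
  calc d * (Nat.card {φ : F →g G // φ u = φ v} : ℝ) ≤ d * (Nat.card V * d ^ m) :=
        mul_le_mul_of_nonneg_left ((Nat.cast_le.2 h1).trans h2) hd0
    _ = _ := by ring

theorem injCount_le_homCount [Finite V] [Finite W] : injCount F G ≤ homCount F G :=
  Nat.card_le_card_of_injective _ Subtype.val_injective

theorem mul_homCount_le [Finite V] [Fintype W] (hF : F.Connected) (hd : Admissible G d) :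
    d * (homCount F G : ℝ) ≤
      d * injCount F G + (Nat.card W : ℝ) ^ 2 * (Nat.card V * d ^ (Nat.card W - 1)) := by
  classical
  have hd0 : 0 < d := zero_lt_one.trans_le hd.1
  have hsplit : homCount F G =
      injCount F G + Nat.card {φ : F →g G // ¬ Function.Injective φ} := by
    rw [homCount, injCount, ← Nat.card_sum]
    exact Nat.card_congr (Equiv.sumCompl _).symm
  have hne : ∀ φ : {φ : F →g G // ¬ Function.Injective φ},
      ∃ p : {p : W × W // p.1 ≠ p.2}, φ.1 p.1.1 = φ.1 p.1.2 := by
    intro φ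
    obtain ⟨u, v, h, huv⟩ := Function.not_injective_iff.1 φ.2
    exact ⟨⟨(u, v), huv⟩, h⟩
  choose f hf using hne
  have hbound := Nat.card_le_card_mul_of_fiber_card_le f
    (c := Nat.card V * d ^ (Nat.card W - 1) / d) fun p => by
      rw [le_div_iff₀' hd0]
      refine le_trans (mul_le_mul_of_nonneg_left ?_ hd0.le)
        (mul_card_hom_apply_eq_apply_le hF hd p.2)
      refine Nat.cast_le.2 (Nat.card_le_card_of_injective
        (fun φ => ⟨φ.1.1, by have := hf φ.1; rwa [φ.2] at this⟩) ?_)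
      intro φ χ h
      exact Subtype.ext (Subtype.ext (Subtype.mk.inj h))
  have hpairs : (Nat.card {p : W × W // p.1 ≠ p.2} : ℝ) ≤ (Nat.card W : ℝ) ^ 2 := by
    rw [sq, ← Nat.cast_mul, ← Nat.card_prod]
    exact Nat.cast_le.2 (Nat.card_le_card_of_injective _ Subtype.val_injective)
  rw [hsplit, Nat.cast_add, mul_add]
  refine add_le_add_right ?_ _
  calc _ ≤ d * ((Nat.card W : ℝ) ^ 2 * (Nat.card V * d ^ (Nat.card W - 1) / d)) := by
        refine mul_le_mul_of_nonneg_left (hbound.trans ?_) hd0.le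
        gcongr
    _ = _ := by field_simp

end Counting

section Densities

variable {V W : Type} {G : SimpleGraph V} {F : SimpleGraph W} {d : ℝ}

theorem numComponents_of_connected (hF : F.Connected) : numComponents F = 1 := by
  have := hF.preconnected.subsingleton_connectedComponent
  have := hF.nonempty
  exact Nat.card_eq_one_iff_unique.2 ⟨inferInstance, inferInstance⟩

theorem numBigComponents_le [Finite W] (hF : F.Connected) :
    numBigComponents F ≤ Nat.card W - 1 := by
  have h1 : numBigComponents F ≤ 1 := by
    rw [← numComponents_of_connected hF]
    exact Nat.card_le_card_of_injective _ Subtype.val_injective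
  by_cases hW : 2 ≤ Nat.card W
  · omega
  · have : IsEmpty {c : F.ConnectedComponent // 2 ≤ Nat.card c.supp} :=
      ⟨fun c => hW (c.2.trans (Nat.card_le_card_of_injective _ Subtype.val_injective))⟩
    exact (Nat.card_of_isEmpty (α := {c : F.ConnectedComponent // 2 ≤ Nat.card c.supp})).trans_le
      (Nat.zero_le _)

theorem homDensity_of_connected (hF : F.Connected) :
    homDensity F G d = homCount F G / (Nat.card V * d ^ (Nat.card W - 1)) := by
  rw [homDensity, numComponents_of_connected hF, pow_one]

theorem injDensity_of_connected_s9 [Finite W] (hF : F.Connected) (hd : 1 < d) :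
    injDensity F G d = injCount F G / (Nat.card V * d ^ (Nat.card W - 1)) *
      (d / (d - 1)) ^ (Nat.card W - 1 - numBigComponents F) := by
  have hd0 : d ≠ 0 := by positivity
  have hd1 : d - 1 ≠ 0 := sub_ne_zero.2 hd.ne'
  obtain ⟨c, hc⟩ := Nat.exists_eq_add_of_le (numBigComponents_le hF)
  rw [injDensity, numComponents_of_connected hF, hc, pow_one, Nat.add_sub_cancel_left, div_pow,
    pow_add]
  field_simp

end Densities

section Limits

variable {V : ℕ → Type} {G : ∀ n, SimpleGraph (V n)} {d : ℕ → ℝ} {W : Type} {F : SimpleGraph W}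

theorem tendsto_div_sub_one_pow (hdtop : Tendsto d atTop atTop) (c : ℕ) :
    Tendsto (fun n => (d n / (d n - 1)) ^ c) atTop (𝓝 1) := by
  have h : Tendsto (fun n => 1 + (d n - 1)⁻¹) atTop (𝓝 (1 + 0)) :=
    tendsto_const_nhds.add
      (tendsto_inv_atTop_zero.comp (tendsto_atTop_add_const_right _ (-1) hdtop))
  have h' : Tendsto (fun n => d n / (d n - 1)) atTop (𝓝 1) := by
    rw [add_zero] at h
    refine h.congr' ?_
    filter_upwards [hdtop.eventually_gt_atTop 1] with n hn
    have : d n - 1 ≠ 0 := sub_ne_zero.2 hn.ne'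
    field_simp
    ring
  simpa using h'.pow c

theorem tendsto_injDensity_iff [Finite W] (hF : F.Connected) (hd : ∀ n, 1 < d n)
    (hdtop : Tendsto d atTop atTop) {L : ℝ} :
    Tendsto (fun n => injDensity F (G n) (d n)) atTop (𝓝 L) ↔
      Tendsto (fun n => (injCount F (G n) : ℝ) / (Nat.card (V n) * d n ^ (Nat.card W - 1)))
        atTop (𝓝 L) := by
  have hc := tendsto_div_sub_one_pow hdtop (Nat.card W - 1 - numBigComponents F)
  simp only [fun n => injDensity_of_connected_s9 (G := G n) hF (hd n)]
  refine ⟨fun h => ?_, fun h => by simpa using h.mul hc⟩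
  have := h.div hc one_ne_zero
  rw [div_one] at this
  refine this.congr fun n => mul_div_cancel_right₀ _ (pow_ne_zero _ (div_ne_zero ?_ ?_))
  · linarith [hd n]
  · linarith [hd n]

theorem tendsto_injDensity_iff_homDensity [∀ n, Finite (V n)] [∀ n, Nonempty (V n)] [Fintype W]
    (hF : F.Connected) (hadm : ∀ n, Admissible (G n) (d n)) (hd : ∀ n, 1 < d n)
    (hdtop : Tendsto d atTop atTop) {L : ℝ} :
    Tendsto (fun n => injDensity F (G n) (d n)) atTop (𝓝 L) ↔
      Tendsto (fun n => homDensity F (G n) (d n)) atTop (𝓝 L) := by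
  rw [tendsto_injDensity_iff hF hd hdtop]
  simp only [homDensity_of_connected hF]
  have hdiff : Tendsto (fun n =>
      (homCount F (G n) : ℝ) / (Nat.card (V n) * d n ^ (Nat.card W - 1)) -
        (injCount F (G n) : ℝ) / (Nat.card (V n) * d n ^ (Nat.card W - 1))) atTop (𝓝 0) := by
    refine squeeze_zero (g := fun n => (Nat.card W : ℝ) ^ 2 / d n) (fun n => ?_) (fun n => ?_)
      (hdtop.const_div_atTop _)
    · have : 0 < d n := zero_lt_one.trans (hd n)
      have := (Nat.cast_le (α := ℝ)).2 (injCount_le_homCount (F := F) (G := G n))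
      rw [← sub_div]
      exact div_nonneg (sub_nonneg.2 this) (by positivity)
    · have h0 : 0 < d n := zero_lt_one.trans (hd n)
      have hV : (0 : ℝ) < Nat.card (V n) := Nat.cast_pos.2 Nat.card_pos
      have := mul_homCount_le (G := G n) hF (hadm n)
      rw [← sub_div, div_le_div_iff₀ (by positivity) h0]
      linarith
  constructor <;> intro h
  · simpa using h.add hdiff
  · simpa using h.sub hdiff

theorem tendsto_homDensity_of_not_isAcyclic [∀ n, Finite (V n)] [∀ n, Nonempty (V n)] [Fintype W]
    (hF : F.Connected) (hF' : ¬ F.IsAcyclic) (hadm : ∀ n, Admissible (G n) (d n))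
    (hd : ∀ n, 1 < d n) (hdtop : Tendsto d atTop atTop) (hgirth : LargeEssentialGirth V G d) :
    Tendsto (fun n => homDensity F (G n) (d n)) atTop (𝓝 0) := by
  rw [← tendsto_injDensity_iff_homDensity hF hadm hd hdtop, tendsto_injDensity_iff hF hd hdtop]
  rw [SimpleGraph.isAcyclic_iff_free_cycleGraph] at hF'
  push Not at hF'
  obtain ⟨m, hm, ⟨i⟩⟩ := hF'
  obtain ⟨m, rfl⟩ := Nat.exists_eq_add_of_le' hm
  have hcyc := (tendsto_injDensity_iff SimpleGraph.cycleGraph_connected hd hdtop).1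
    (hgirth (m + 3) hm)
  refine squeeze_zero (fun n => ?_) (fun n => ?_) hcyc
  · have : 0 < d n := zero_lt_one.trans (hd n)
    positivity
  · have h0 : 0 < d n := zero_lt_one.trans (hd n)
    have hV : (0 : ℝ) < Nat.card (V n) := Nat.cast_pos.2 Nat.card_pos
    have hle : m + 3 ≤ Nat.card W := by
      simpa using Nat.card_le_card_of_injective i.toHom i.injective
    have h := injCount_le_of_isContained (G := G n) hF (hadm n) i.toHom i.injective
    obtain ⟨c, hc⟩ := Nat.exists_eq_add_of_le hle
    rw [Nat.card_fin, hc, Nat.add_sub_cancel_left] at h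
    rw [Nat.card_fin, hc, div_le_div_iff₀ (by positivity) (by positivity),
      show m + 3 + c - 1 = m + 3 - 1 + c by omega, pow_add]
    calc _ ≤ _ := mul_le_mul_of_nonneg_right h (by positivity)
      _ = _ := by ring

end Limits

section Trees

variable {V W : Type} {G : SimpleGraph V} {F : SimpleGraph W} {d : ℝ}

theorem abs_vdegree_div_sub_le_one {α : ℝ} (hα0 : 0 ≤ α) (hα1 : α ≤ 1) (hd : Admissible G d)
    (x : V) : |(vdegree G x : ℝ) / d - α| ≤ 1 := by
  have hd0 : 0 < d := zero_lt_one.trans_le hd.1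
  have h0 : 0 ≤ (vdegree G x : ℝ) / d := by positivity
  have h1 : (vdegree G x : ℝ) / d ≤ 1 := (div_le_one hd0).2 (hd.2 x)
  rw [abs_le]
  constructor <;> linarith

/-- The mean deviation of the normalized degrees from `α` tends to zero. -/
theorem AlphaRegular.tendsto_mean_abs_sub {V : ℕ → Type} [∀ n, Fintype (V n)]
    [∀ n, Nonempty (V n)] {G : ∀ n, SimpleGraph (V n)} {d : ℕ → ℝ} {α : ℝ} (hα0 : 0 ≤ α)
    (hα1 : α ≤ 1) (hadm : ∀ n, Admissible (G n) (d n)) (hreg : AlphaRegular V G d α) :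
    Tendsto (fun n => (∑ x, |(vdegree (G n) x : ℝ) / d n - α|) / Nat.card (V n))
      atTop (𝓝 0) := by
  classical
  refine tendsto_order.2 ⟨fun a ha => Eventually.of_forall fun n => ?_, fun a ha => ?_⟩
  · exact ha.trans_le (by positivity)
  · filter_upwards [(hreg (a / 2) (half_pos ha)).eventually (gt_mem_nhds (half_pos ha))] with n hn
    have hV : (0 : ℝ) < Nat.card (V n) := Nat.cast_pos.2 Nat.card_pos
    rw [div_lt_iff₀ hV] at hn ⊢
    have hle : ∀ x : V n, |(vdegree (G n) x : ℝ) / d n - α| ≤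
        a / 2 + if a / 2 ≤ |(vdegree (G n) x : ℝ) / d n - α| then 1 else 0 := by
      intro x
      have := abs_vdegree_div_sub_le_one hα0 hα1 (hadm n) x
      split_ifs with h <;> linarith
    have hsum := Finset.sum_le_sum fun x (_ : x ∈ Finset.univ) => hle x
    rw [Finset.sum_add_distrib, Finset.sum_boole, Finset.sum_const, Finset.card_univ, nsmul_eq_mul,
      ← Fintype.card_subtype, ← Nat.card_eq_fintype_card, ← Nat.card_eq_fintype_card] at hsum
    linarith

/-- Homomorphisms from a graph with a leaf `v` attached at `p` are homomorphisms from the graph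
without `v`, together with a neighbor of the image of `p`. -/
theorem homCount_eq_sum_vdegree [Fintype V] [Finite W] {v p : W} (hvp : F.Adj v p)
    (huniq : ∀ w, F.Adj v w → w = p) [Fintype (F.induce {v}ᶜ →g G)] :
    homCount F G = ∑ φ : F.induce {v}ᶜ →g G, vdegree G (φ ⟨p, hvp.ne'⟩) := by
  classical
  rw [homCount]
  simp only [vdegree]
  rw [← Nat.card_sigma]
  refine Nat.card_congr
    { toFun := fun φ => ⟨φ.comp (SimpleGraph.Embedding.induce _).toHom, φ v, φ.map_adj hvp.symm⟩
      invFun := fun φ => ⟨fun w => if h : w = v then φ.2 else φ.1 ⟨w, h⟩, ?_⟩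
      left_inv := ?_
      right_inv := ?_ }
  · intro a b hab
    by_cases ha : a = v
    · subst ha
      have hb := huniq b hab
      subst hb
      have := ((G.mem_neighborSet _ _).1 φ.2.2).symm
      simpa [hab.ne'] using this
    · by_cases hb : b = v
      · subst hb
        have ha' := huniq a hab.symm
        subst ha'
        have := (G.mem_neighborSet _ _).1 φ.2.2
        simpa [ha] using this
      · simp only [ha, hb, dif_neg, not_false_iff]
        exact φ.1.map_adj (by simpa using hab)
  · intro φ
    ext w
    by_cases hw : w = v
    · subst hw
      simp
    · simp [hw]
  · rintro ⟨φ, y⟩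
    have h : ∀ w : ({v}ᶜ : Set W), (w : W) ≠ v := fun w => w.2
    refine Sigma.subtype_ext ?_ ?_
    · ext w
      simp [h w]
    · simp

theorem abs_sum_vdegree_sub_le [Fintype V] [Fintype W] (hF : F.Connected) (hd : Admissible G d)
    [Fintype (F →g G)] (p : W) (α : ℝ) :
    |∑ φ : F →g G, ((vdegree G (φ p) : ℝ) / d - α)| ≤
      d ^ (Nat.card W - 1) * ∑ x, |(vdegree G x : ℝ) / d - α| := by
  classical
  refine (Finset.abs_sum_le_sum_abs _ _).trans ?_
  rw [← Finset.sum_fiberwise Finset.univ (fun φ : F →g G => φ p), Finset.mul_sum]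
  refine Finset.sum_le_sum fun x _ => ?_
  rw [Finset.sum_congr rfl (g := fun _ => |(vdegree G x : ℝ) / d - α|)
    (fun φ hφ => by rw [(Finset.mem_filter.1 hφ).2]), Finset.sum_const, nsmul_eq_mul]
  refine mul_le_mul_of_nonneg_right ?_ (abs_nonneg _)
  have := card_hom_apply_eq_le hF hd p x
  rwa [Nat.card_eq_fintype_card, Fintype.card_subtype] at this

theorem tendsto_homDensity_of_isTree {V : ℕ → Type} [∀ n, Fintype (V n)] [∀ n, Nonempty (V n)]
    {G : ∀ n, SimpleGraph (V n)} {d : ℕ → ℝ} {α : ℝ} (hα0 : 0 ≤ α) (hα1 : α ≤ 1)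
    (hadm : ∀ n, Admissible (G n) (d n)) (hreg : AlphaRegular V G d α) (m : ℕ) {W : Type}
    [Fintype W] {F : SimpleGraph W} (hF : F.IsTree) (hm : Nat.card W = m + 1) :
    Tendsto (fun n => homDensity F (G n) (d n)) atTop (𝓝 (α ^ m)) := by
  classical
  have hV : ∀ n, (0 : ℝ) < Nat.card (V n) := fun n => Nat.cast_pos.2 Nat.card_pos
  have hd0 : ∀ n, 0 < d n := fun n => zero_lt_one.trans_le (hadm n).1
  induction m generalizing W with
  | zero =>
    simp only [homDensity_of_connected hF.connected]
    refine tendsto_const_nhds.congr fun n => ?_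
    have hsub : Subsingleton W := (Nat.card_eq_one_iff_unique.1 hm).1
    obtain ⟨w⟩ := hF.connected.nonempty
    have hcard : homCount F (G n) = Nat.card (V n) := by
      refine Nat.card_congr
        { toFun := fun φ => φ w
          invFun := fun x => ⟨fun _ => x, fun {a b} h => (h.ne (Subsingleton.elim a b)).elim⟩
          left_inv := fun φ => ?_
          right_inv := fun x => rfl }
      ext a
      exact congrArg φ (Subsingleton.elim w a)
    rw [hcard, hm]
    simp
  | succ m ih =>
    have : Nontrivial W := by
      rw [← Fintype.one_lt_card_iff_nontrivial, ← Nat.card_eq_fintype_card]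
      omega
    obtain ⟨v, hv⟩ := hF.exists_vert_degree_one_of_nontrivial
    obtain ⟨p, hvp, huniq⟩ := SimpleGraph.degree_eq_one_iff_existsUnique_adj.1 hv
    have hF' : (F.induce {v}ᶜ).IsTree :=
      ⟨hF.connected.induce_compl_singleton_of_degree_eq_one hv, hF.isAcyclic.induce _⟩
    have hcard : Nat.card ({v}ᶜ : Set W) = m + 1 := by
      rw [Nat.card_eq_fintype_card, Fintype.card_compl_set, ← Nat.card_eq_fintype_card, hm]
      simp
    have hlim := (ih hF' hcard).const_mul α
    have hdiff : Tendsto (fun n => homDensity F (G n) (d n) -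
        α * homDensity (F.induce {v}ᶜ) (G n) (d n)) atTop (𝓝 0) := by
      refine squeeze_zero_norm (fun n => ?_) (hreg.tendsto_mean_abs_sub hα0 hα1 hadm)
      have := Fintype.ofFinite (F.induce {v}ᶜ →g G n)
      have hd := hd0 n
      have hVn := hV n
      have hb := abs_sum_vdegree_sub_le hF'.connected (hadm n) ⟨p, hvp.ne'⟩ α
      rw [homDensity_of_connected hF.connected, homDensity_of_connected hF'.connected, hcard, hm,
        homCount_eq_sum_vdegree hvp huniq, homCount, Nat.card_eq_fintype_card (α := _ →g _),
        Real.norm_eq_abs, le_div_iff₀ hVn]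
      rw [hcard] at hb
      simp only [Nat.add_sub_cancel] at hb ⊢
      refine le_of_mul_le_mul_left ?_ (pow_pos hd m)
      refine le_trans (le_of_eq ?_) hb
      rw [Finset.sum_sub_distrib, ← Finset.sum_div, Finset.sum_const, Finset.card_univ,
        nsmul_eq_mul, Nat.cast_sum, ← mul_assoc, mul_right_comm,
        ← abs_of_pos (mul_pos (pow_pos hd m) hVn), ← abs_mul]
      congr 1
      rw [pow_succ]
      field_simp
    simpa [pow_succ'] using hdiff.add hlim

end Trees

/-- If `(Gₙ,dₙ)` is `α`-regular with large essential girth and `dₙ → ∞`,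
then both `t` and `t_inj` of any tree tend to `α^{e(F)}`, while both densities of any
connected graph containing a cycle tend to `0`. -/
theorem stmt9 (V : ℕ → Type) [∀ n, Fintype (V n)] [∀ n, Nonempty (V n)]
    (G : ∀ n, SimpleGraph (V n)) (d : ℕ → ℝ) (α : ℝ) (hα0 : 0 ≤ α) (hα1 : α ≤ 1)
    (hadm : ∀ n, Admissible (G n) (d n)) (hd : ∀ n, 1 < d n)
    (hdtop : Tendsto d atTop atTop)
    (hreg : AlphaRegular V G d α) (hgirth : LargeEssentialGirth V G d) :
    (∀ (k : ℕ) (F : SimpleGraph (Fin k)), F.IsTree →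
      Tendsto (fun n => homDensity F (G n) (d n)) atTop (𝓝 (α ^ edgeCount F)) ∧
      Tendsto (fun n => injDensity F (G n) (d n)) atTop (𝓝 (α ^ edgeCount F))) ∧
    (∀ (k : ℕ) (F : SimpleGraph (Fin k)), F.Connected → ¬ F.IsAcyclic →
      Tendsto (fun n => homDensity F (G n) (d n)) atTop (𝓝 0) ∧
      Tendsto (fun n => injDensity F (G n) (d n)) atTop (𝓝 0)) := by
  refine ⟨fun k F hF => ?_, fun k F hF hF' => ?_⟩
  · rw [tendsto_injDensity_iff_homDensity hF.connected hadm hd hdtop, and_self]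
    have := Fintype.ofFinite F.edgeSet
    have hcard : Nat.card (Fin k) = edgeCount F + 1 := by
      rw [edgeCount, Nat.card_eq_fintype_card, Nat.card_eq_fintype_card,
        ← SimpleGraph.edgeFinset_card, hF.card_edgeFinset]
    exact tendsto_homDensity_of_isTree hα0 hα1 hadm hreg _ hF hcard
  · rw [tendsto_injDensity_iff_homDensity hF hadm hd hdtop, and_self]
    exact tendsto_homDensity_of_not_isAcyclic hF hF' hadm hd hdtop hgirth
end

section
/- Let 0 ≤ α ≤ 1 and let (G_n,d_n) be an α-regular sequence of admissible pairs with v(G_n) ≥ 1 and d_n → ∞. Let M(G) denote the total number of matchings of a graph G (matchings of all sizes, including the empty matching). Then limsup_{n→∞} M(G_n)^{2/v(G_n)}/d_n ≤ α/e, where e is Euler's number. -/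
open Filter Topology

/-- The number of matchings of `G` (sets of pairwise disjoint edges, including `∅`). -/
noncomputable def matchingCount {V : Type*} (G : SimpleGraph V) : ℕ :=
  Nat.card {s : Set (Sym2 V) // s ⊆ G.edgeSet ∧
    ∀ e ∈ s, ∀ f ∈ s, ∀ x : V, x ∈ e → x ∈ f → e = f}

section Bregman

open Finset
open scoped Nat

variable {V : Type*} [Fintype V] [DecidableEq V]

/-- The logarithm of `(r!) ^ (1 / r)`. -/
noncomputable def logFactorialRoot (r : ℕ) : ℝ := Real.log (r ! : ℝ) / r

theorem logFactorialRoot_one : logFactorialRoot 1 = 0 := by simp [logFactorialRoot]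

theorem log_add_pred_mul_logFactorialRoot {r : ℕ} (hr : 1 ≤ r) :
    Real.log r + ((r : ℝ) - 1) * logFactorialRoot (r - 1) = r * logFactorialRoot r := by
  obtain ⟨k, rfl⟩ : ∃ k, r = k + 1 := ⟨r - 1, by omega⟩
  have h1 : ((k + 1 : ℕ) : ℝ) ≠ 0 := by positivity
  have h2 : ((k ! : ℕ) : ℝ) ≠ 0 := by positivity
  have h3 : ((k + 1 : ℕ) : ℝ) - 1 = k := by push_cast; ring
  have h4 : ((k + 1 : ℕ) : ℝ) * logFactorialRoot (k + 1) =
      Real.log (k + 1 : ℕ) + Real.log (k ! : ℝ) := by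
    rw [logFactorialRoot, mul_div_cancel₀ _ h1, Nat.factorial_succ, Nat.cast_mul,
      Real.log_mul h1 h2]
  rw [h4, h3, Nat.add_sub_cancel]
  rcases Nat.eq_zero_or_pos k with rfl | hk
  · simp
  · have : (k : ℝ) ≠ 0 := by positivity
    rw [logFactorialRoot, mul_div_cancel₀ _ this]

/-- The permutations sending each `x` into the prescribed set `F x`. -/
def permsWithin (F : V → Finset V) : Finset (Equiv.Perm V) :=
  univ.filter fun σ => ∀ x, σ x ∈ F x

/-- Prescribe the value `k` at `i` and forbid it elsewhere. -/
def prescribe (F : V → Finset V) (i k : V) : V → Finset V :=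
  fun j => if j = i then {k} else (F j).erase k

theorem mem_permsWithin {F : V → Finset V} {σ : Equiv.Perm V} :
    σ ∈ permsWithin F ↔ ∀ x, σ x ∈ F x := by simp [permsWithin]

theorem permsWithin_prescribe {F : V → Finset V} {i k : V} (hk : k ∈ F i) :
    permsWithin (prescribe F i k) = (permsWithin F).filter fun σ => σ i = k := by
  ext σ
  simp only [mem_filter, mem_permsWithin, prescribe]
  constructor
  · intro h
    have hi : σ i = k := by simpa using h i
    refine ⟨fun x => ?_, hi⟩
    by_cases hx : x = i
    · rw [hx, hi]; exact hk
    · have := h x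
      rw [if_neg hx] at this
      exact mem_of_mem_erase this
  · rintro ⟨h, hi⟩ x
    by_cases hx : x = i
    · simp [hx, hi]
    · rw [if_neg hx]
      refine mem_erase.2 ⟨fun h' => hx (σ.injective (h'.trans hi.symm)), h x⟩

theorem sum_log_prescribe_ge {F : V → Finset V} (i : V) (hP : (permsWithin F).Nonempty) :
    ((permsWithin F).card : ℝ) * Real.log (permsWithin F).card ≤
      (permsWithin F).card * Real.log (F i).card +
        ∑ σ ∈ permsWithin F, Real.log (permsWithin (prescribe F i (σ i))).card := by
  set Ω := permsWithin F with hΩ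
  have hmem : ∀ σ ∈ Ω, σ i ∈ F i := fun σ hσ => mem_permsWithin.1 hσ i
  have hr : (0 : ℝ) < (F i).card := by
    obtain ⟨σ, hσ⟩ := hP
    exact_mod_cast card_pos.2 ⟨_, hmem σ hσ⟩
  have hPpos : (0 : ℝ) < Ω.card := by exact_mod_cast card_pos.2 hP
  have hQ : ∀ σ ∈ Ω, (0 : ℝ) < (permsWithin (prescribe F i (σ i))).card := by
    intro σ hσ
    rw [permsWithin_prescribe (hmem σ hσ)]
    exact Nat.cast_pos.2 (card_pos.2 ⟨σ, mem_filter.2 ⟨hσ, rfl⟩⟩)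
  have hinv : ∑ σ ∈ Ω, ((permsWithin (prescribe F i (σ i))).card : ℝ)⁻¹ ≤ (F i).card := by
    rw [← sum_fiberwise_of_maps_to hmem, card_eq_sum_ones, Nat.cast_sum]
    refine sum_le_sum fun k hk => ?_
    rw [sum_congr rfl (g := fun _ => ((Ω.filter fun σ => σ i = k).card : ℝ)⁻¹), sum_const,
      nsmul_eq_mul]
    · exact_mod_cast mul_inv_le_one
    · intro σ hσ
      rw [(mem_filter.1 hσ).2, permsWithin_prescribe hk]
  have hlog : ∀ σ ∈ Ω, Real.log Ω.card - Real.log (F i).card -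
      Real.log (permsWithin (prescribe F i (σ i))).card ≤
      (Ω.card : ℝ) / (F i).card * ((permsWithin (prescribe F i (σ i))).card : ℝ)⁻¹ - 1 := by
    intro σ hσ
    have hq := hQ σ hσ
    rw [← Real.log_div hPpos.ne' hr.ne', ← Real.log_div (by positivity) hq.ne', ← div_eq_mul_inv]
    exact Real.log_le_sub_one_of_pos (by positivity)
  have hsum := sum_le_sum hlog
  simp only [sum_sub_distrib, sum_const, nsmul_eq_mul, ← mul_sum] at hsum
  have : (Ω.card : ℝ) / (F i).card *
      ∑ σ ∈ Ω, ((permsWithin (prescribe F i (σ i))).card : ℝ)⁻¹ ≤ Ω.card := by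
    calc _ ≤ (Ω.card : ℝ) / (F i).card * (F i).card := by gcongr
      _ = Ω.card := by field_simp
  linarith

/-- For a permutation `σ` respecting `F`, the logarithmic weights of row `x` in the systems
`prescribe F i (σ i)`, together with the logarithm of its size, add up exactly. -/
theorem log_add_sum_logFactorialRoot_erase {F : V → Finset V} {Z : Finset V}
    (hZ : ∀ z ∈ Z, (F z).card = 1 ∧ ∀ j, j ≠ z → Disjoint (F z) (F j))
    {σ : Equiv.Perm V} (hσ : σ ∈ permsWithin F) (x : V) :
    (if x ∈ Zᶜ then Real.log (F x).card else 0) +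
      ∑ i ∈ Zᶜ, logFactorialRoot (prescribe F i (σ i) x).card =
      Zᶜ.card * logFactorialRoot (F x).card := by
  rw [mem_permsWithin] at hσ
  by_cases hx : x ∈ Z
  · have hz := hZ x hx
    rw [if_neg (by simpa using hx), hz.1, logFactorialRoot_one, zero_add, mul_zero]
    refine sum_eq_zero fun i hi => ?_
    have hxi : x ≠ i := by rintro rfl; exact (mem_compl.1 hi) hx
    rw [prescribe, if_neg hxi, erase_eq_of_notMem, hz.1, logFactorialRoot_one]
    exact fun h => disjoint_left.1 (hz.2 i hxi.symm) h (hσ i)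
  · have hxc : x ∈ Zᶜ := mem_compl.2 hx
    rw [if_pos hxc, ← add_sum_erase _ _ hxc]
    have hself : logFactorialRoot (prescribe F x (σ x) x).card = 0 := by
      simp [prescribe, logFactorialRoot_one]
    have hr : 1 ≤ (F x).card := card_pos.2 ⟨_, hσ x⟩
    have hfilter : ((Zᶜ.erase x).filter fun i => σ i ∈ F x) =
        ((F x).map σ.symm.toEmbedding).erase x := by
      ext i
      simp only [mem_filter, mem_erase, mem_compl, mem_map_equiv, Equiv.symm_symm]
      refine ⟨fun h => ⟨h.1.1, h.2⟩, fun h => ⟨⟨h.1, fun hi => ?_⟩, h.2⟩⟩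
      exact disjoint_left.1 ((hZ i hi).2 x h.1.symm) (hσ i) h.2
    have hcard : ((Zᶜ.erase x).filter fun i => σ i ∈ F x).card = (F x).card - 1 := by
      rw [hfilter, card_erase_of_mem, card_map]
      simpa using hσ x
    have hcard' : (((Zᶜ.erase x).filter fun i => σ i ∉ F x).card : ℝ) =
        Zᶜ.card - (F x).card := by
      have h1 := card_filter_add_card_filter_not (s := Zᶜ.erase x) (fun i => σ i ∈ F x)
      rw [card_erase_of_mem hxc, hcard] at h1
      have h2 : 1 ≤ Zᶜ.card := card_pos.2 ⟨x, hxc⟩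
      rw [eq_sub_iff_add_eq]
      norm_cast
      omega
    rw [hself, zero_add, ← sum_filter_add_sum_filter_not _ (fun i => σ i ∈ F x)]
    rw [sum_congr rfl (g := fun _ => logFactorialRoot ((F x).card - 1)),
      sum_congr (s₁ := filter (fun i => ¬ σ i ∈ F x) _) rfl
        (g := fun _ => logFactorialRoot (F x).card),
      sum_const, sum_const, nsmul_eq_mul, nsmul_eq_mul, hcard, hcard', Nat.cast_sub hr]
    · have := log_add_pred_mul_logFactorialRoot hr
      push_cast
      linarith
    · intro i hi
      obtain ⟨hi, hik⟩ := mem_filter.1 hi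
      rw [prescribe, if_neg (ne_of_mem_erase hi).symm, erase_eq_of_notMem hik]
    · intro i hi
      obtain ⟨hi, hik⟩ := mem_filter.1 hi
      rw [prescribe, if_neg (ne_of_mem_erase hi).symm, card_erase_of_mem hik]

theorem log_card_permsWithin_le_aux (m : ℕ) : ∀ (F : V → Finset V) (Z : Finset V), Zᶜ.card = m →
    (∀ z ∈ Z, (F z).card = 1 ∧ ∀ j, j ≠ z → Disjoint (F z) (F j)) →
    (permsWithin F).Nonempty →
    Real.log (permsWithin F).card ≤ ∑ x, logFactorialRoot (F x).card := by
  induction m with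
  | zero =>
    intro F Z hm hZ hP
    have hZu : ∀ x, x ∈ Z := by
      intro x
      by_contra hx
      exact absurd (mem_compl.2 hx) (by simp [card_eq_zero.1 hm])
    have h1 : (permsWithin F).card ≤ 1 := by
      refine card_le_one.2 fun σ hσ τ hτ => Equiv.ext fun x => ?_
      exact card_le_one.1 (hZ x (hZu x)).1.le _ (mem_permsWithin.1 hσ x) _
        (mem_permsWithin.1 hτ x)
    have h2 : (permsWithin F).card = 1 := le_antisymm h1 (card_pos.2 hP)
    rw [h2, sum_eq_zero fun x _ => by rw [(hZ x (hZu x)).1, logFactorialRoot_one]]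
    simp
  | succ m ih =>
    intro F Z hm hZ hP
    set Ω := permsWithin F with hΩ
    have hPpos : (0 : ℝ) < Ω.card := by exact_mod_cast card_pos.2 hP
    have hstep : ∀ i ∈ Zᶜ, ∀ σ ∈ Ω, Real.log (permsWithin (prescribe F i (σ i))).card ≤
        ∑ x, logFactorialRoot (prescribe F i (σ i) x).card := by
      intro i hi σ hσ
      have hσ' := mem_permsWithin.1 hσ
      refine ih _ (insert i Z) ?_ ?_ ?_
      · rw [compl_insert, card_erase_of_mem hi, hm, Nat.add_sub_cancel]
      · intro z hz
        by_cases hzi : z = i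
        · subst hzi
          refine ⟨by simp [prescribe], fun j hj => ?_⟩
          simp [prescribe, hj]
        · have hzZ := (mem_insert.1 hz).resolve_left hzi
          have hnot : σ i ∉ F z := fun h =>
            disjoint_left.1 ((hZ z hzZ).2 i (Ne.symm hzi)) h (hσ' i)
          have heq : prescribe F i (σ i) z = F z := by
            rw [prescribe, if_neg hzi, erase_eq_of_notMem hnot]
          rw [heq]
          refine ⟨(hZ z hzZ).1, fun j hj => ?_⟩
          by_cases hji : j = i
          · simp [prescribe, hji, hnot]
          · rw [prescribe, if_neg hji]
            exact disjoint_of_subset_right (erase_subset _ _) ((hZ z hzZ).2 j hj)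
      · rw [permsWithin_prescribe (hσ' i)]
        exact ⟨σ, mem_filter.2 ⟨hσ, rfl⟩⟩
    have hsum : ∑ i ∈ Zᶜ, (Ω.card : ℝ) * Real.log Ω.card ≤ ∑ i ∈ Zᶜ,
        (Ω.card * Real.log (F i).card +
          ∑ σ ∈ Ω, ∑ x, logFactorialRoot (prescribe F i (σ i) x).card) :=
      sum_le_sum fun i hi => (sum_log_prescribe_ge i hP).trans
        (by gcongr with σ hσ; exact hstep i hi σ hσ)
    have hrhs : ∑ i ∈ Zᶜ, ((Ω.card : ℝ) * Real.log (F i).card +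
          ∑ σ ∈ Ω, ∑ x, logFactorialRoot (prescribe F i (σ i) x).card) =
        ∑ σ ∈ Ω, ∑ x, (Zᶜ.card : ℝ) * logFactorialRoot (F x).card := by
      rw [sum_add_distrib, sum_comm, ← mul_sum, ← nsmul_eq_mul, ← sum_const, ← sum_add_distrib]
      refine sum_congr rfl fun σ hσ => ?_
      rw [sum_comm, ← sum_congr rfl fun x _ => log_add_sum_logFactorialRoot_erase hZ hσ x,
        sum_add_distrib, sum_ite_mem, univ_inter]
    rw [hrhs] at hsum
    simp only [sum_const, nsmul_eq_mul, ← mul_sum] at hsum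
    have hmpos : (0 : ℝ) < Zᶜ.card := by rw [hm]; positivity
    have : ((Zᶜ.card : ℝ) * Ω.card) * Real.log Ω.card ≤
        ((Zᶜ.card : ℝ) * Ω.card) * ∑ x, logFactorialRoot (F x).card := by linarith
    exact le_of_mul_le_mul_left this (by positivity)

/-- **Bregman's theorem**: a `0-1` matrix with row sums `rₓ` has permanent at most
`∏ (rₓ!) ^ (1 / rₓ)`. -/
theorem card_permsWithin_le (F : V → Finset V) :
    ((permsWithin F).card : ℝ) ≤ ∏ x, Real.exp (logFactorialRoot (F x).card) := by
  rcases (permsWithin F).eq_empty_or_nonempty with h | h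
  · rw [h, card_empty, Nat.cast_zero]
    exact prod_nonneg fun _ _ => (Real.exp_pos _).le
  · have hpos : (0 : ℝ) < (permsWithin F).card := by exact_mod_cast card_pos.2 h
    rw [← Real.exp_sum, ← Real.log_le_iff_le_exp hpos]
    exact log_card_permsWithin_le_aux _ F ∅ rfl (by simp) h

end Bregman

section DoubleCover

open Finset
open scoped Classical

variable {V : Type*} [Fintype V]

/-- The matchings of `G` that only use vertices of `W`. -/
noncomputable def matchingsIn (G : SimpleGraph V) (W : Finset V) : Finset (Set (Sym2 V)) :=
  univ.filter fun s => (s ⊆ G.edgeSet ∧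
    ∀ e ∈ s, ∀ f ∈ s, ∀ x : V, x ∈ e → x ∈ f → e = f) ∧ ∀ e ∈ s, ∀ x ∈ e, x ∈ W

/-- The matchings between a copy of `A` and a copy of `B` in the bipartite double cover of `G`. -/
noncomputable def coverMatchings (G : SimpleGraph V) (A B : Finset V) : Finset (Set (V × V)) :=
  univ.filter fun s => (∀ p ∈ s, G.Adj p.1 p.2 ∧ p.1 ∈ A ∧ p.2 ∈ B) ∧
    ∀ p ∈ s, ∀ q ∈ s, (p.1 = q.1 ↔ p.2 = q.2)

variable (G : SimpleGraph V)

theorem matchingCount_eq_card_matchingsIn : matchingCount G = (matchingsIn G univ).card := by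
  exact Nat.subtype_card _ fun s => by simp [matchingsIn]

theorem card_matchingsIn_empty : (matchingsIn G ∅).card ≤ 1 := by
  refine card_le_one.2 fun s hs t ht => ?_
  have key : ∀ s ∈ matchingsIn G ∅, s = ∅ := by
    intro s hs
    refine Set.eq_empty_of_forall_notMem fun e he => ?_
    have h := (mem_filter.1 hs).2.2 e he
    induction e with
    | _ x y => simpa using h x (Sym2.mem_mk_left x y)
  rw [key s hs, key t ht]

theorem card_coverMatchings_pos (A B : Finset V) : 1 ≤ (coverMatchings G A B).card :=
  card_pos.2 ⟨∅, by simp [coverMatchings]⟩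

theorem card_matchingsIn_insert_le {W : Finset V} {v : V} (hv : v ∉ W) :
    (matchingsIn G (insert v W)).card ≤ (matchingsIn G W).card +
      ∑ u ∈ W.filter (G.Adj v), (matchingsIn G (W.erase u)).card := by
  have hsub : matchingsIn G (insert v W) ⊆ matchingsIn G W ∪
      (W.filter (G.Adj v)).biUnion fun u => (matchingsIn G (W.erase u)).image (insert s(v, u)) := by
    intro s hs
    obtain ⟨⟨hsG, hdis⟩, hsW⟩ := (mem_filter.1 hs).2
    by_cases hcov : ∃ e ∈ s, v ∈ e
    · obtain ⟨e, hes, hve⟩ := hcov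
      obtain ⟨u, rfl⟩ := Sym2.mem_iff_exists.1 hve
      have hadj : G.Adj v u := hsG hes
      have huW : u ∈ W := (mem_insert.1 (hsW _ hes u (Sym2.mem_mk_right v u))).resolve_left
        hadj.ne'
      refine mem_union_right _ (mem_biUnion.2 ⟨u, mem_filter.2 ⟨huW, hadj⟩,
        mem_image.2 ⟨s \ {s(v, u)}, ?_, ?_⟩⟩)
      · refine mem_filter.2 ⟨mem_univ _, ⟨Set.sdiff_subset.trans hsG, fun e he f hf =>
          hdis e he.1 f hf.1⟩, fun e he x hx => ?_⟩
        have hne : ∀ y, y ∈ s(v, u) → x ≠ y := by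
          rintro y hy rfl
          exact he.2 (hdis e he.1 _ hes x hx hy)
        exact mem_erase.2 ⟨hne u (Sym2.mem_mk_right v u),
          (mem_insert.1 (hsW e he.1 x hx)).resolve_left (hne v (Sym2.mem_mk_left v u))⟩
      · rw [Set.insert_sdiff_singleton, Set.insert_eq_of_mem hes]
    · refine mem_union_left _ (mem_filter.2 ⟨mem_univ _, ⟨hsG, hdis⟩, fun e he x hx => ?_⟩)
      refine (mem_insert.1 (hsW e he x hx)).resolve_left ?_
      rintro rfl
      exact hcov ⟨e, he, hx⟩
  refine (card_le_card hsub).trans ((card_union_le _ _).trans ?_)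
  gcongr
  exact card_biUnion_le.trans (sum_le_sum fun u _ => card_image_le)

theorem le_card_coverMatchings_insert_left {A : Finset V} (B : Finset V) {v : V} (hv : v ∉ A) :
    (coverMatchings G A B).card +
      ∑ u ∈ B.filter (G.Adj v), (coverMatchings G A (B.erase u)).card ≤
      (coverMatchings G (insert v A) B).card := by
  have hnotMem : ∀ {B' : Finset V} {s} (u : V), s ∈ coverMatchings G A B' → (v, u) ∉ s :=
    fun u hs h => hv ((mem_filter.1 hs).2.1 _ h).2.1
  have hcard : ∀ u, ((coverMatchings G A (B.erase u)).image (insert (v, u))).card =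
      (coverMatchings G A (B.erase u)).card := by
    intro u
    refine card_image_of_injOn fun s hs t ht hst => ?_
    have h := congrArg (fun r : Set (V × V) => r \ {(v, u)}) hst
    simpa [Set.insert_sdiff_self_of_notMem (hnotMem u hs),
      Set.insert_sdiff_self_of_notMem (hnotMem u ht)] using h
  have hins : ∀ u ∈ B.filter (G.Adj v), ∀ s ∈ coverMatchings G A (B.erase u),
      insert (v, u) s ∈ coverMatchings G (insert v A) B := by
    intro u hu s hs
    obtain ⟨huB, hadj⟩ := mem_filter.1 hu
    obtain ⟨hsA, hdis⟩ := (mem_filter.1 hs).2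
    refine mem_filter.2 ⟨mem_univ _, ?_, ?_⟩
    · rintro p (rfl | hp)
      · exact ⟨hadj, mem_insert_self _ _, huB⟩
      · exact ⟨(hsA p hp).1, mem_insert_of_mem (hsA p hp).2.1, mem_of_mem_erase (hsA p hp).2.2⟩
    · have h1 : ∀ p ∈ s, p.1 ≠ v := fun p hp h => hv (h ▸ (hsA p hp).2.1)
      have h2 : ∀ p ∈ s, p.2 ≠ u := fun p hp => ne_of_mem_erase (hsA p hp).2.2
      rintro p (rfl | hp) q (rfl | hq)
      · simp
      · simp [(h1 q hq).symm, (h2 q hq).symm]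
      · simp [h1 p hp, h2 p hp]
      · exact hdis p hp q hq
  have hsub : coverMatchings G A B ∪ ((B.filter (G.Adj v)).biUnion fun u =>
      (coverMatchings G A (B.erase u)).image (insert (v, u))) ⊆
      coverMatchings G (insert v A) B := by
    refine union_subset (fun s hs => ?_) (biUnion_subset.2 fun u hu => image_subset_iff.2 (hins u hu))
    obtain ⟨hsA, hdis⟩ := (mem_filter.1 hs).2
    exact mem_filter.2 ⟨mem_univ _, fun p hp =>
      ⟨(hsA p hp).1, mem_insert_of_mem (hsA p hp).2.1, (hsA p hp).2.2⟩, hdis⟩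
  refine le_trans (le_of_eq ?_) (card_le_card hsub)
  rw [card_union_of_disjoint, card_biUnion, sum_congr rfl fun u _ => hcard u]
  · intro u hu u' hu' hne
    refine disjoint_left.2 fun s hs hs' => hne ?_
    obtain ⟨t, ht, rfl⟩ := mem_image.1 hs
    obtain ⟨t', ht', heq⟩ := mem_image.1 hs'
    have h1 : (v, u) ∈ insert (v, u') t' := heq ▸ Set.mem_insert _ _
    rcases h1 with h1 | h1
    · exact (Prod.mk.inj h1).2
    · exact absurd h1 (hnotMem u ht')
  · refine disjoint_left.2 fun s hs hs' => ?_
    obtain ⟨u, -, hs'⟩ := mem_biUnion.1 hs'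
    obtain ⟨t, -, rfl⟩ := mem_image.1 hs'
    exact hnotMem u hs (Set.mem_insert _ _)

theorem card_coverMatchings_comm_le (A B : Finset V) :
    (coverMatchings G A B).card ≤ (coverMatchings G B A).card := by
  refine card_le_card_of_injOn (fun s => Prod.swap ⁻¹' s) ?_ ?_
  · intro s hs
    obtain ⟨hsA, hdis⟩ := (mem_filter.1 hs).2
    exact mem_filter.2 ⟨mem_univ _, fun p hp => ⟨(hsA _ hp).1.symm, (hsA _ hp).2.2, (hsA _ hp).2.1⟩,
      fun p hp q hq => (hdis _ hp _ hq).symm⟩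
  · exact fun s _ t _ h => Set.preimage_injective.2 Prod.swap_surjective h

theorem card_coverMatchings_comm (A B : Finset V) :
    (coverMatchings G A B).card = (coverMatchings G B A).card :=
  le_antisymm (card_coverMatchings_comm_le G A B) (card_coverMatchings_comm_le G B A)

theorem le_card_coverMatchings_insert_right (A : Finset V) {B : Finset V} {v : V} (hv : v ∉ B) :
    (coverMatchings G A B).card +
      ∑ u ∈ A.filter (G.Adj v), (coverMatchings G (A.erase u) B).card ≤
      (coverMatchings G A (insert v B)).card := by
  simpa only [card_coverMatchings_comm G _ B, card_coverMatchings_comm G _ (insert v B)] using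
    le_card_coverMatchings_insert_left G A hv

/-- The four comparisons between products of matching numbers of induced subgraphs and matching
numbers of the double cover, proved by simultaneous induction. -/
theorem card_matchingsIn_mul_le_aux (n : ℕ) : ∀ W : Finset V, W.card = n →
    ((matchingsIn G W).card * (matchingsIn G W).card ≤ (coverMatchings G W W).card) ∧
    (∀ v ∉ W, (matchingsIn G W).card * (matchingsIn G (insert v W)).card ≤
      (coverMatchings G W (insert v W)).card) ∧
    (∀ u ∉ W, ∀ v ∉ W, u ≠ v →
      (matchingsIn G W).card * (matchingsIn G (insert u (insert v W))).card ≤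
        (coverMatchings G (insert u W) (insert v W)).card) ∧
    (∀ u ∉ W, ∀ v ∉ W, u ≠ v →
      (matchingsIn G (insert u W)).card * (matchingsIn G (insert v W)).card ≤
        (coverMatchings G (insert u W) (insert v W)).card) := by
  induction n using Nat.strong_induction_on with
  | _ n ih =>
  intro W hW
  have herase : ∀ w ∈ W, (W.erase w).card < n := fun w hw => hW ▸ card_erase_lt_of_mem hw
  have hdiag : (matchingsIn G W).card * (matchingsIn G W).card ≤ (coverMatchings G W W).card := by
    rcases W.eq_empty_or_nonempty with rfl | ⟨v, hv⟩
    · have := card_matchingsIn_empty G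
      have := card_coverMatchings_pos G ∅ ∅
      nlinarith
    · set U := W.erase v with hU
      have hvU : v ∉ U := notMem_erase v W
      have hWU : W = insert v U := (insert_erase hv).symm
      have hUn : U.card < n := herase v hv
      rw [hWU]
      calc _ ≤ (matchingsIn G (insert v U)).card * ((matchingsIn G U).card +
            ∑ u ∈ U.filter (G.Adj v), (matchingsIn G (U.erase u)).card) :=
          Nat.mul_le_mul_left _ (card_matchingsIn_insert_le G hvU)
        _ = (matchingsIn G U).card * (matchingsIn G (insert v U)).card +
            ∑ u ∈ U.filter (G.Adj v),
              (matchingsIn G (U.erase u)).card * (matchingsIn G (insert v U)).card := by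
          rw [mul_add, mul_sum, mul_comm]
          congr 1
          exact sum_congr rfl fun u _ => mul_comm _ _
        _ ≤ (coverMatchings G U (insert v U)).card + ∑ u ∈ (insert v U).filter (G.Adj v),
              (coverMatchings G U ((insert v U).erase u)).card := by
          rw [filter_insert, if_neg (G.loopless.irrefl v)]
          refine add_le_add ((ih _ hUn U rfl).2.1 v hvU) (sum_le_sum fun u hu => ?_)
          obtain ⟨huU, hadj⟩ := mem_filter.1 hu
          have hlt : (U.erase u).card < n := (card_erase_lt_of_mem huU).trans hUn
          have h := (ih _ hlt _ rfl).2.2.1 u (notMem_erase u U) v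
            (fun h => hvU (mem_of_mem_erase h)) hadj.ne'
          rwa [insert_comm, insert_erase huU, ← erase_insert_of_ne hadj.ne] at h
        _ ≤ _ := le_card_coverMatchings_insert_left G _ hvU
  have hone : ∀ v ∉ W, (matchingsIn G W).card * (matchingsIn G (insert v W)).card ≤
      (coverMatchings G W (insert v W)).card := by
    intro v hv
    refine le_trans ?_ (le_card_coverMatchings_insert_right G W hv)
    refine (Nat.mul_le_mul_left _ (card_matchingsIn_insert_le G hv)).trans ?_
    rw [mul_add, mul_sum]
    refine add_le_add hdiag (sum_le_sum fun u hu => ?_)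
    have huW := (mem_filter.1 hu).1
    have h := (ih _ (herase u huW) _ rfl).2.1 u (notMem_erase u W)
    rwa [insert_erase huW, mul_comm] at h
  refine ⟨hdiag, hone, fun u hu v hv huv => ?_, fun u hu v hv huv => ?_⟩
  · have huv' : u ∉ insert v W := by simp [huv, hu]
    refine le_trans ?_ (le_card_coverMatchings_insert_left G (insert v W) hu)
    refine (Nat.mul_le_mul_left _ (card_matchingsIn_insert_le G huv')).trans ?_
    rw [mul_add, mul_sum]
    refine add_le_add (hone v hv) (sum_le_sum fun w hw => ?_)
    rcases mem_insert.1 (mem_filter.1 hw).1 with rfl | hwW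
    · rwa [erase_insert hv]
    · have hvw : v ≠ w := fun h => hv (h ▸ hwW)
      have h := (ih _ (herase w hwW) _ rfl).2.2.2 w (notMem_erase w W) v
        (fun h => hv (mem_of_mem_erase h)) hvw.symm
      rwa [insert_erase hwW, ← erase_insert_of_ne hvw] at h
  · refine le_trans ?_ (le_card_coverMatchings_insert_left G (insert v W) hu)
    refine (Nat.mul_le_mul_right _ (card_matchingsIn_insert_le G hu)).trans ?_
    rw [add_mul, sum_mul]
    refine add_le_add (hone v hv) (le_trans (sum_le_sum fun w hw => ?_)
      (sum_le_sum_of_subset (filter_subset_filter _ (subset_insert v W))))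
    have hwW := (mem_filter.1 hw).1
    have hvw : v ≠ w := fun h => hv (h ▸ hwW)
    have h := (ih _ (herase w hwW) _ rfl).2.2.1 w (notMem_erase w W) v
      (fun h => hv (mem_of_mem_erase h)) hvw.symm
    rwa [insert_comm, insert_erase hwW, ← erase_insert_of_ne hvw] at h

/-- The square of the number of matchings of `G` is at most the number of matchings of its
bipartite double cover. -/
theorem matchingCount_sq_le : matchingCount G ^ 2 ≤ (coverMatchings G univ univ).card := by
  rw [sq, matchingCount_eq_card_matchingsIn]
  exact (card_matchingsIn_mul_le_aux G _ univ rfl).1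

end DoubleCover

section CoverBound

open Finset
open scoped Classical

variable {V : Type*} [Fintype V] (G : SimpleGraph V)

theorem vdegree_eq_card_filter (x : V) : vdegree G x = (univ.filter (G.Adj x)).card := by
  rw [vdegree, Nat.card_eq_fintype_card, Fintype.card_subtype]
  simp [SimpleGraph.mem_neighborSet]

/-- The left endpoints of a set of edges of the double cover. -/
noncomputable def leftSupport (s : Set (V × V)) : Finset V := univ.filter fun x => ∃ y, (x, y) ∈ s

/-- The right endpoints of a set of edges of the double cover. -/
noncomputable def rightSupport (s : Set (V × V)) : Finset V := univ.filter fun y => ∃ x, (x, y) ∈ s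

variable {G} in
theorem card_leftSupport_eq {s : Set (V × V)} (hs : s ∈ coverMatchings G univ univ) :
    (leftSupport s).card = (rightSupport s).card := by
  obtain ⟨-, hdis⟩ := (mem_filter.1 hs).2
  have h1 : leftSupport s = s.toFinset.image Prod.fst := by ext; simp [leftSupport]
  have h2 : rightSupport s = s.toFinset.image Prod.snd := by ext; simp [rightSupport]
  rw [h1, h2, card_image_of_injOn, card_image_of_injOn]
  · intro p hp q hq h
    rw [mem_coe, Set.mem_toFinset] at hp hq
    exact Prod.ext ((hdis p hp q hq).2 h) h
  · intro p hp q hq h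
    rw [mem_coe, Set.mem_toFinset] at hp hq
    exact Prod.ext h ((hdis p hp q hq).1 h)

/-- Bregman's bound for the matchings of the double cover with prescribed endpoints. -/
theorem card_coverMatchings_support_le {S T : Finset V} (hST : S.card = T.card) :
    (((coverMatchings G univ univ).filter fun s =>
      (leftSupport s, rightSupport s) = (S, T)).card : ℝ) ≤
      ∏ x ∈ S, Real.exp (logFactorialRoot (vdegree G x)) := by
  let τ : Equiv.Perm V := (Finset.equivOfCardEq hST).extendSubtype
  have hτ : ∀ x, x ∉ S → τ x ∉ T := fun x hx => Equiv.extendSubtype_not_mem _ x hx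
  let F : V → Finset V := fun x => if x ∈ S then univ.filter (G.Adj x) else {τ x}
  have hex : ∀ s ∈ (coverMatchings G univ univ).filter fun s =>
      (leftSupport s, rightSupport s) = (S, T),
      ∃ σ : Equiv.Perm V, σ ∈ permsWithin F ∧ ∀ p, p ∈ s ↔ p.1 ∈ S ∧ σ p.1 = p.2 := by
    intro s hs
    obtain ⟨hs, hsupp⟩ := mem_filter.1 hs
    obtain ⟨hS, hT⟩ := Prod.mk.inj hsupp
    obtain ⟨hadj, hdis⟩ := (mem_filter.1 hs).2
    have hmemS : ∀ x, x ∈ S ↔ ∃ y, (x, y) ∈ s := fun x => by simp [← hS, leftSupport]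
    have hmemT : ∀ y, y ∈ T ↔ ∃ x, (x, y) ∈ s := fun y => by simp [← hT, rightSupport]
    have hval : ∀ x, ∃ y, (x ∈ S → (x, y) ∈ s) ∧ (x ∉ S → y = τ x) := by
      intro x
      by_cases hx : x ∈ S
      · obtain ⟨y, hy⟩ := (hmemS x).1 hx
        exact ⟨y, fun _ => hy, fun h => absurd hx h⟩
      · exact ⟨τ x, fun h => absurd h hx, fun _ => rfl⟩
    choose f hf hf' using hval
    have hright : ∀ x ∈ S, f x ∈ T := fun x hx => (hmemT _).2 ⟨x, hf x hx⟩
    have hinj : Function.Injective f := by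
      intro x y hxy
      by_cases hx : x ∈ S <;> by_cases hy : y ∈ S
      · exact (hdis _ (hf x hx) _ (hf y hy)).2 hxy
      · exact absurd (hxy ▸ hright x hx) (hf' y hy ▸ hτ y hy)
      · exact absurd (hxy.symm ▸ hright y hy) (hf' x hx ▸ hτ x hx)
      · exact τ.injective (by rw [← hf' x hx, ← hf' y hy, hxy])
    refine ⟨Equiv.ofBijective f (Finite.injective_iff_bijective.1 hinj),
      mem_permsWithin.2 fun x => ?_, fun p => ⟨fun hp => ?_, ?_⟩⟩
    · by_cases hx : x ∈ S
      · simpa [F, hx] using (hadj _ (hf x hx)).1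
      · simpa [F, hx] using hf' x hx
    · have hp1 : p.1 ∈ S := (hmemS _).2 ⟨p.2, hp⟩
      exact ⟨hp1, (hdis _ (hf _ hp1) _ hp).1 rfl⟩
    · rintro ⟨hp1, hp2⟩
      have := hf _ hp1
      rwa [show f p.1 = p.2 from hp2] at this
  choose! σ hσ hσs using hex
  have hle := card_le_card_of_injOn σ hσ fun s hs t ht h => by
    ext p
    rw [hσs s hs, hσs t ht, h]
  refine (Nat.cast_le.2 hle).trans ((card_permsWithin_le F).trans (le_of_eq ?_))
  rw [← prod_mul_prod_compl S, prod_eq_one (s := Sᶜ), mul_one]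
  · refine prod_congr rfl fun x hx => ?_
    rw [vdegree_eq_card_filter]
    simp [F, hx]
  · intro x hx
    simp [F, mem_compl.1 hx, logFactorialRoot_one]

theorem card_coverMatchings_le {t : ℝ} (ht : 0 < t) :
    ((coverMatchings G univ univ).card : ℝ) ≤ (1 + t) ^ Fintype.card V *
      ∏ x, (Real.exp (logFactorialRoot (vdegree G x)) + t⁻¹) := by
  set b : V → ℝ := fun x => Real.exp (logFactorialRoot (vdegree G x)) with hb
  have hfib : ∀ P : Finset V × Finset V, (((coverMatchings G univ univ).filter fun s =>
      (leftSupport s, rightSupport s) = P).card : ℝ) ≤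
      ((∏ x ∈ P.1, b x) * ∏ x ∈ univ \ P.1, t⁻¹) * (1 ^ P.2.card * t ^ (Fintype.card V - P.2.card)) := by
    rintro ⟨S, T⟩
    rcases ((coverMatchings G univ univ).filter fun s =>
      (leftSupport s, rightSupport s) = (S, T)).eq_empty_or_nonempty with h | ⟨s, hs⟩
    · rw [h, card_empty, Nat.cast_zero]
      positivity
    · obtain ⟨hs, hsupp⟩ := mem_filter.1 hs
      obtain ⟨hS, hT⟩ := Prod.mk.inj hsupp
      have hST : S.card = T.card := hS ▸ hT ▸ card_leftSupport_eq hs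
      refine (card_coverMatchings_support_le G hST).trans (le_of_eq ?_)
      rw [prod_const, card_univ_sdiff, ← hST, one_pow, one_mul, mul_assoc, ← mul_pow,
        inv_mul_cancel₀ ht.ne', one_pow, mul_one]
  have hsplit := card_eq_sum_card_fiberwise (s := coverMatchings G univ univ)
    (t := (univ : Finset (Finset V × Finset V)))
    (f := fun s => (leftSupport s, rightSupport s)) fun _ _ => mem_univ _
  rw [hsplit, Nat.cast_sum]
  refine (sum_le_sum fun P _ => hfib P).trans (le_of_eq ?_)
  rw [← univ_product_univ, sum_product]
  dsimp only
  rw [← sum_mul_sum, Fintype.sum_pow_mul_eq_add_pow,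
    prod_add, powerset_univ, mul_comm]

/-- An upper bound for the number of matchings with a free parameter `t`, which pays for
vertices left unmatched. -/
theorem matchingCount_sq_le_prod {t : ℝ} (ht : 0 < t) :
    (matchingCount G : ℝ) ^ 2 ≤ (1 + t) ^ Fintype.card V *
      ∏ x, (Real.exp (logFactorialRoot (vdegree G x)) + t⁻¹) :=
  le_trans (by exact_mod_cast matchingCount_sq_le G) (card_coverMatchings_le G ht)

end CoverBound

section Asymptotics

open scoped Nat

theorem log_factorial_succ_le (k : ℕ) :
    Real.log ((k + 1)! : ℝ) ≤
      (k + 1 : ℝ) * Real.log (k + 1) - (k + 1) + Real.log (k + 1) + 1 := by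
  induction k with
  | zero => simp
  | succ k ih =>
    have h1 : (0 : ℝ) < k + 1 := by positivity
    have h2 : (0 : ℝ) < k + 1 + 1 := by positivity
    have hratio : 1 / ((k : ℝ) + 1 + 1) ≤ Real.log (k + 1 + 1) - Real.log (k + 1) := by
      have := Real.log_le_sub_one_of_pos (div_pos h1 h2)
      rw [Real.log_div h1.ne' h2.ne'] at this
      have h3 : ((k : ℝ) + 1) / (k + 1 + 1) - 1 = -(1 / (k + 1 + 1)) := by field_simp; ring
      linarith
    have hmul : 1 ≤ ((k : ℝ) + 1 + 1) * (Real.log (k + 1 + 1) - Real.log (k + 1)) := by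
      calc (1 : ℝ) = (k + 1 + 1) * (1 / (k + 1 + 1)) := by field_simp
        _ ≤ _ := by gcongr
    rw [Nat.factorial_succ, Nat.cast_mul, Real.log_mul (by positivity) (by positivity)]
    push_cast
    nlinarith

theorem exp_logFactorialRoot_le_linear {η : ℝ} (hη : 0 < η) :
    ∃ C : ℝ, 0 ≤ C ∧ ∀ r : ℕ, Real.exp (logFactorialRoot r) ≤ Real.exp (η - 1) * r + C := by
  have hlim : Tendsto (fun r : ℕ => (Real.log r + 1) / (r : ℝ)) atTop (𝓝 0) := by
    have h1 : Tendsto (fun x : ℝ => Real.log x / x) atTop (𝓝 0) := by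
      simpa using Real.tendsto_pow_log_div_mul_add_atTop 1 0 1 one_ne_zero
    have h2 : Tendsto (fun x : ℝ => 1 / x) atTop (𝓝 0) := by
      simpa using tendsto_inv_atTop_zero (𝕜 := ℝ)
    have h3 := (h1.add h2).comp tendsto_natCast_atTop_atTop
    simp only [add_zero] at h3
    exact h3.congr fun r => by simp [add_div]
  obtain ⟨R, hR⟩ := eventually_atTop.1 (hlim.eventually_lt_const hη)
  refine ⟨∑ r ∈ Finset.range (R + 1), Real.exp (logFactorialRoot r),
    Finset.sum_nonneg fun _ _ => (Real.exp_pos _).le, fun r => ?_⟩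
  rcases lt_or_ge r (R + 1) with h | h
  · have h1 := Finset.single_le_sum (f := fun r => Real.exp (logFactorialRoot r))
      (fun _ _ => (Real.exp_pos _).le) (Finset.mem_range.2 h)
    have h2 : 0 ≤ Real.exp (η - 1) * r := by positivity
    linarith
  · obtain ⟨k, rfl⟩ : ∃ k, r = k + 1 := ⟨r - 1, by omega⟩
    have hk : (0 : ℝ) < (k + 1 : ℕ) := by positivity
    have h1 := hR (k + 1) (by omega)
    have h2 := log_factorial_succ_le k
    have h3 : logFactorialRoot (k + 1) ≤ Real.log (k + 1 : ℕ) + (η - 1) := by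
      rw [div_lt_iff₀ hk] at h1
      rw [logFactorialRoot, div_le_iff₀ hk]
      push_cast at h1 ⊢
      linarith
    have h4 : Real.exp (logFactorialRoot (k + 1)) ≤ Real.exp (η - 1) * (k + 1 : ℕ) := by
      refine (Real.exp_le_exp.2 h3).trans (le_of_eq ?_)
      rw [Real.exp_add, Real.exp_log hk, mul_comm]
    have h5 : 0 ≤ ∑ r ∈ Finset.range (R + 1), Real.exp (logFactorialRoot r) :=
      Finset.sum_nonneg fun _ _ => (Real.exp_pos _).le
    linarith

/-- A finite form of the theorem: `c` bounds the normalised weight of the typical vertices, and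
`K` compensates for the atypical ones. -/
theorem matchingCount_rpow_div_le {V : Type*} [Fintype V] [Nonempty V] (G : SimpleGraph V)
    {d t c K : ℝ} (hd : 0 < d) (ht : 0 < t) (hc : 0 ≤ c) (hK : 1 ≤ K) (p : V → Prop)
    (hgood : ∀ x, ¬ p x → Real.exp (logFactorialRoot (vdegree G x)) + t⁻¹ ≤ d * c)
    (hbad : ∀ x, Real.exp (logFactorialRoot (vdegree G x)) + t⁻¹ ≤ d * (c * K)) :
    (matchingCount G : ℝ) ^ ((2 : ℝ) / (Nat.card V : ℝ)) / d ≤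
      (1 + t) * c * K ^ ((Nat.card {x // p x} : ℝ) / (Nat.card V : ℝ)) := by
  classical
  set n := Fintype.card V with hn
  have hnV : Nat.card V = n := Nat.card_eq_fintype_card
  have hpV : Nat.card {x // p x} = (Finset.univ.filter p).card := by
    rw [Nat.card_eq_fintype_card, Fintype.card_subtype]
  have hn0 : n ≠ 0 := Fintype.card_ne_zero
  have hK0 : 0 ≤ K := zero_le_one.trans hK
  have hbase : 0 ≤ (1 + t) * (d * c) := by positivity
  have hprod : ∏ x, (Real.exp (logFactorialRoot (vdegree G x)) + t⁻¹) ≤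
      (d * c) ^ n * K ^ (Finset.univ.filter p).card := by
    calc _ ≤ ∏ x, (d * c) * (if p x then K else 1) := by
          refine Finset.prod_le_prod (fun x _ => by positivity) fun x _ => ?_
          by_cases hx : p x
          · simpa [hx, mul_assoc] using hbad x
          · simpa [hx] using hgood x hx
      _ = _ := by
          rw [Finset.prod_mul_distrib, Finset.prod_ite, Finset.prod_const, Finset.prod_const,
            Finset.prod_const_one, mul_one, Finset.card_univ]
  have hsq : (matchingCount G : ℝ) ^ 2 ≤
      ((1 + t) * (d * c)) ^ n * K ^ (Finset.univ.filter p).card := by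
    refine (matchingCount_sq_le_prod G ht).trans ?_
    rw [mul_pow, mul_assoc]
    gcongr
  have hroot : (matchingCount G : ℝ) ^ ((2 : ℝ) / n) ≤
      (1 + t) * (d * c) * K ^ (((Finset.univ.filter p).card : ℝ) / n) := by
    have h := Real.rpow_le_rpow (by positivity) hsq (by positivity : (0 : ℝ) ≤ (n : ℝ)⁻¹)
    rw [Real.mul_rpow (by positivity) (by positivity), Real.pow_rpow_inv_natCast hbase hn0,
      ← Real.rpow_natCast K, ← Real.rpow_mul hK0, ← Real.rpow_natCast (matchingCount G : ℝ),
      ← Real.rpow_mul (by positivity)] at h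
    simpa [div_eq_mul_inv] using h
  rw [hnV, hpV, div_le_iff₀ hd]
  refine hroot.trans (le_of_eq ?_)
  ring

theorem exists_good_constants {α c : ℝ} (hα0 : 0 ≤ α) (hc : α / Real.exp 1 < c) :
    ∃ t η c', 0 < t ∧ 0 < η ∧ η ≤ 1 ∧ 0 < c' ∧ (1 + t) * c' < c ∧
      Real.exp (η - 1) * (α + η) < c' := by
  obtain ⟨c', hc1, hc2⟩ := exists_between hc
  have hc'0 : 0 < c' := lt_of_le_of_lt (by positivity) hc1
  have h1 : ∀ᶠ t in 𝓝[>] (0 : ℝ), (1 + t) * c' < c := by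
    have : ContinuousAt (fun t : ℝ => (1 + t) * c') 0 := by fun_prop
    exact (this.eventually_lt_const (by simpa using hc2)).filter_mono nhdsWithin_le_nhds
  have h2 : ∀ᶠ η in 𝓝[>] (0 : ℝ), Real.exp (η - 1) * (α + η) < c' := by
    have : ContinuousAt (fun η : ℝ => Real.exp (η - 1) * (α + η)) 0 := by fun_prop
    refine (this.eventually_lt_const ?_).filter_mono nhdsWithin_le_nhds
    simpa [Real.exp_neg, div_eq_mul_inv, mul_comm] using hc1
  have h3 : ∀ᶠ η in 𝓝[>] (0 : ℝ), η < 1 :=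
    (eventually_lt_nhds one_pos).filter_mono nhdsWithin_le_nhds
  obtain ⟨t, ht, ht0⟩ := (h1.and self_mem_nhdsWithin).exists
  obtain ⟨η, ⟨hη, hη1⟩, hη0⟩ := ((h2.and h3).and self_mem_nhdsWithin).exists
  exact ⟨t, η, c', ht0, hη0, hη1.le, hc'0, ht, hη⟩

end Asymptotics

/-- If `(Gₙ,dₙ)` is `α`-regular with `dₙ → ∞`, then
`limsup M(Gₙ)^{2/v(Gₙ)}/dₙ ≤ α/e` where `M` counts all matchings. -/
theorem stmt13 (V : ℕ → Type) [∀ n, Fintype (V n)] [∀ n, Nonempty (V n)]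
    (G : ∀ n, SimpleGraph (V n)) (d : ℕ → ℝ) (α : ℝ) (hα0 : 0 ≤ α) (hα1 : α ≤ 1)
    (hadm : ∀ n, Admissible (G n) (d n))
    (hdtop : Tendsto d atTop atTop)
    (hreg : AlphaRegular V G d α) :
    Filter.limsup
        (fun n => (matchingCount (G n) : ℝ) ^ ((2 : ℝ) / (Nat.card (V n) : ℝ)) / d n)
        atTop ≤ α / Real.exp 1 := by
  refine le_of_forall_gt_imp_ge_of_dense fun c hc => ?_
  obtain ⟨t, η, c', ht, hη, hη1, hc', htc, hηc⟩ := exists_good_constants hα0 hc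
  obtain ⟨C, hC, hlin⟩ := exp_logFactorialRoot_le_linear hη
  set K : ℝ := max 1 (2 / c') with hK
  have hK0 : 0 < K := zero_lt_one.trans_le (le_max_left _ _)
  have hpow : Tendsto (fun n => (1 + t) * c' * K ^
      ((Nat.card {x : V n // η ≤ |(vdegree (G n) x : ℝ) / d n - α|} : ℝ) /
        (Nat.card (V n) : ℝ))) atTop (𝓝 ((1 + t) * c')) := by
    have h := ((Real.continuous_const_rpow hK0.ne').tendsto 0).comp (hreg η hη)
    simpa using h.const_mul ((1 + t) * c')
  have hbdd : IsCoboundedUnder (· ≤ ·) atTop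
      (fun n => (matchingCount (G n) : ℝ) ^ ((2 : ℝ) / (Nat.card (V n) : ℝ)) / d n) := by
    refine IsBoundedUnder.isCoboundedUnder_le ⟨0, eventually_map.2 (Eventually.of_forall fun n => ?_)⟩
    have := (hadm n).1
    positivity
  refine limsup_le_of_le hbdd ?_
  have hlarge : ∀ᶠ n in atTop, (C + t⁻¹) / (c' - Real.exp (η - 1) * (α + η)) ≤ d n :=
    hdtop.eventually_ge_atTop _
  filter_upwards [hpow.eventually_lt_const htc, hlarge,
    hdtop.eventually_ge_atTop (C + t⁻¹)] with n hn hd1 hd2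
  have hd : 0 < d n := zero_lt_one.trans_le (hadm n).1
  rw [div_le_iff₀ (sub_pos.2 hηc)] at hd1
  refine (matchingCount_rpow_div_le (G n) hd ht hc'.le (le_max_left _ _)
    (fun x => η ≤ |(vdegree (G n) x : ℝ) / d n - α|) (fun x hx => ?_) fun x => ?_).trans hn.le
  · have hx' := (abs_lt.1 (not_le.1 hx)).2
    have hdeg : (vdegree (G n) x : ℝ) ≤ (α + η) * d n := by
      rw [← div_le_iff₀ hd]
      linarith
    have hmul := mul_le_mul_of_nonneg_left hdeg (Real.exp_pos (η - 1)).le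
    have := hlin (vdegree (G n) x)
    linarith
  · have hcK : 2 ≤ c' * K := by
      have : 2 / c' ≤ K := le_max_right _ _
      rwa [div_le_iff₀' hc'] at this
    have hexp : Real.exp (η - 1) ≤ 1 := Real.exp_le_one_iff.2 (by linarith)
    have hmul := mul_le_mul hexp ((hadm n).2 x) (by positivity) zero_le_one
    have hd3 := mul_le_mul_of_nonneg_left hcK hd.le
    have := hlin (vdegree (G n) x)
    linarith
end
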